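/- arXiv:2001.09316 — 3 statements merged into one kernel-verified Lean document; each statement's English description precedes it below -/
import Mathlib

section
/- Fix 2 ≤ s < ∞ and let V f(x) = (∑_{n∈ℤ} |A_n f(x) − A_{n-1} f(x)|^s)^{1/s} with A_n f(x) = 2^{-n} ∫_x^{x+2^n} f(y) dy. Then V is of weak type (1,1): there exists C > 0 such that for all f ∈ L^1(ℝ) and λ > 0, the Lebesgue measure of {x : V f(x) > λ} is at most (C/λ) ‖f‖_{L^1}. -/
open MeasureTheory Set Real

/-- The averaging operator `A_n f(x) = 2^{-n} ∫_x^{x+2^n} f`. -/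
noncomputable def Aop (n : ℤ) (f : ℝ → ℝ) (x : ℝ) : ℝ :=
  ((2:ℝ)^n)⁻¹ * ∫ y in x..(x + (2:ℝ)^n), f y

/-- The variation operator. -/
noncomputable def Vop (s : ℝ) (f : ℝ → ℝ) (x : ℝ) : ℝ :=
  (∑' n : ℤ, |Aop n f x - Aop (n-1) f x| ^ s) ^ (1/s)


lemma two_zpow_pos (n : ℤ) : (0:ℝ) < 2 ^ n := by positivity

lemma Aop_cont {f : ℝ → ℝ} (hf : Integrable f) (n : ℤ) : Continuous (Aop n f) := by
  have h1 : ∀ a b, IntervalIntegrable f volume a b := fun a b => hf.intervalIntegrable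
  have h2 := intervalIntegral.continuous_primitive h1 0
  have h3 : Aop n f = fun x => ((2:ℝ)^n)⁻¹ * ((∫ y in (0:ℝ)..(x + (2:ℝ)^n), f y) - ∫ y in (0:ℝ)..x, f y) := by
    ext x
    rw [Aop, intervalIntegral.integral_interval_sub_left (h1 _ _) (h1 _ _)]
  rw [h3]
  exact continuous_const.mul ((h2.comp (continuous_id.add continuous_const)).sub h2)

lemma Aop_step {f : ℝ → ℝ} (hf : Integrable f) (n : ℤ) (x : ℝ) :
    Aop n f x = (Aop (n-1) f x + Aop (n-1) f (x + 2^(n-1))) / 2 := by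
  have h1 : ∀ a b, IntervalIntegrable f volume a b := fun a b => hf.intervalIntegrable
  have e : (2:ℝ)^n = 2 * 2^(n-1) := by
    rw [← zpow_one_add₀ (by norm_num)]; congr 1; ring
  unfold Aop
  rw [e, show x + 2 * (2:ℝ)^(n-1) = x + 2^(n-1) + 2^(n-1) by ring,
    ← intervalIntegral.integral_add_adjacent_intervals (h1 x (x + 2^(n-1))) (h1 _ _), mul_inv]
  ring

lemma Aop_sub {f g : ℝ → ℝ} (hf : Integrable f) (hg : Integrable g) (n : ℤ) (x : ℝ) :
    Aop n (fun y => f y - g y) x = Aop n f x - Aop n g x := by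
  unfold Aop
  rw [intervalIntegral.integral_sub hf.intervalIntegrable hg.intervalIntegrable]
  ring

lemma energy_step {f : ℝ → ℝ} (hf : Integrable f) (n : ℤ) :
    (∫⁻ x, ENNReal.ofReal ((Aop n f x)^2)) + (∫⁻ x, ENNReal.ofReal ((Aop n f x - Aop (n-1) f x)^2))
      = ∫⁻ x, ENNReal.ofReal ((Aop (n-1) f x)^2) := by
  have m1 : ∀ k, Measurable (fun x => ENNReal.ofReal ((Aop k f x)^2)) := fun k =>
    ((Aop_cont hf k).pow 2).measurable.ennreal_ofReal
  rw [← lintegral_add_left (m1 n)]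
  have e : ∀ x, ENNReal.ofReal ((Aop n f x)^2) + ENNReal.ofReal ((Aop n f x - Aop (n-1) f x)^2)
      = ENNReal.ofReal (1/2) * ENNReal.ofReal ((Aop (n-1) f x)^2)
        + ENNReal.ofReal (1/2) * ENNReal.ofReal ((Aop (n-1) f (x + 2^(n-1)))^2) := by
    intro x
    rw [← ENNReal.ofReal_add (by positivity) (by positivity), ← ENNReal.ofReal_mul (by positivity),
      ← ENNReal.ofReal_mul (by positivity), ← ENNReal.ofReal_add (by positivity) (by positivity),
      Aop_step hf n x]
    congr 1; ring
  simp_rw [e]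
  rw [lintegral_add_left ((m1 _).const_mul _), lintegral_const_mul _ (m1 _),
    lintegral_const_mul' _ _ ENNReal.ofReal_ne_top,
    lintegral_add_right_eq_self (fun x => ENNReal.ofReal ((Aop (n-1) f x)^2)) ((2:ℝ)^(n-1)), ← add_mul,
    ← ENNReal.ofReal_add (by positivity) (by positivity)]
  norm_num

lemma energy_tel {f : ℝ → ℝ} (hf : Integrable f) (n : ℤ) (N : ℕ) :
    (∫⁻ x, ENNReal.ofReal ((Aop (n+N) f x)^2))
     + ∑ k ∈ Finset.range N, (∫⁻ x, ENNReal.ofReal ((Aop (n+k+1) f x - Aop (n+k) f x)^2))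
      = ∫⁻ x, ENNReal.ofReal ((Aop n f x)^2) := by
  induction N with
  | zero => simp
  | succ N ih =>
    rw [Finset.sum_range_succ, ← ih]
    have := energy_step hf (n + N + 1)
    rw [add_sub_cancel_right] at this
    rw [← this]
    push_cast
    rw [← add_assoc n]
    ring

lemma energy_sum {f : ℝ → ℝ} (hf : Integrable f) (B : ENNReal)
    (hB : ∀ n, ∫⁻ x, ENNReal.ofReal ((Aop n f x)^2) ≤ B) :
    ∑' n : ℤ, (∫⁻ x, ENNReal.ofReal ((Aop n f x - Aop (n-1) f x)^2)) ≤ B := by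
  refine ENNReal.summable.tsum_le_of_sum_le fun F => ?_
  obtain ⟨M, hM⟩ : ∃ M : ℕ, ∀ n ∈ F, n.natAbs ≤ M := ⟨F.sup Int.natAbs, fun n hn => Finset.le_sup hn⟩
  have h := energy_tel hf (-M-1) (2*M+1)
  refine le_trans ?_ ((le_add_self.trans h.le).trans (hB _))
  set d : ℤ → ENNReal := fun n => ∫⁻ x, ENNReal.ofReal ((Aop n f x - Aop (n-1) f x)^2) with hd
  have : ∑ k ∈ Finset.range (2*M+1), (∫⁻ x, ENNReal.ofReal ((Aop (-M-1+k+1) f x - Aop (-M-1+k) f x)^2))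
     = ∑ n ∈ (Finset.range (2*M+1)).image (fun k : ℕ => (-M + k : ℤ)), d n := by
    rw [Finset.sum_image (by intro a _ b _ h; simpa using h)]
    refine Finset.sum_congr rfl fun k _ => ?_
    rw [hd]
    simp only
    rw [show (-M-1+k+1 : ℤ) = -M + k by ring, show (-M-1+k : ℤ) = -M + k - 1 by ring]
  rw [this]
  refine Finset.sum_le_sum_of_subset fun n hn => ?_
  have := hM n hn
  simp only [Finset.mem_image, Finset.mem_range]
  exact ⟨(n + M).toNat, by omega, by omega⟩

lemma enorm_Aop_le (f : ℝ → ℝ) (n : ℤ) (x : ℝ) :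
    ‖Aop n f x‖ₑ ≤ ENNReal.ofReal (((2:ℝ)^n)⁻¹) * ∫⁻ y in Ioc x (x + 2^n), ‖f y‖ₑ := by
  rw [Aop, enorm_mul, intervalIntegral.integral_of_le (by linarith [two_zpow_pos n]),
    Real.enorm_eq_ofReal (by positivity)]
  gcongr
  exact enorm_integral_le_lintegral_enorm _

lemma lintegral_avg {f : ℝ → ℝ} (hf : AEStronglyMeasurable f) (h : ℝ) :
    ∫⁻ x, ∫⁻ y in Ioc x (x + h), ‖f y‖ₑ ≤ ENNReal.ofReal h * ∫⁻ y, ‖f y‖ₑ := by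
  have e : ∀ x, ∫⁻ y in Ioc x (x+h), ‖f y‖ₑ = ∫⁻ y, ({p : ℝ × ℝ | p.1 < p.2 ∧ p.2 ≤ p.1 + h}.indicator (fun p => ‖f p.2‖ₑ)) (x, y) := by
    intro x
    rw [← lintegral_indicator measurableSet_Ioc]
    rfl
  simp_rw [e]
  have ms : MeasurableSet {p : ℝ × ℝ | p.1 < p.2 ∧ p.2 ≤ p.1 + h} :=
    (measurableSet_lt measurable_fst measurable_snd).inter
      (measurableSet_le measurable_snd (measurable_fst.add_const h))
  rw [lintegral_lintegral_swap]
  · rw [← lintegral_const_mul'' _ hf.enorm]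
    refine lintegral_mono fun y => ?_
    have : ∀ x, ({p : ℝ × ℝ | p.1 < p.2 ∧ p.2 ≤ p.1 + h}.indicator (fun p => ‖f p.2‖ₑ)) (x, y)
       = (Ico (y-h) y).indicator (fun _ => ‖f y‖ₑ) x := by
      intro x
      simp only [indicator, mem_ofPred_eq, mem_Ico]
      congr 1
      apply propext
      constructor
      · rintro ⟨a, b⟩; constructor <;> linarith
      · rintro ⟨a, b⟩; constructor <;> linarith
    simp_rw [this]
    rw [lintegral_indicator measurableSet_Ico]
    simp [mul_comm]
  · exact (hf.comp_snd.enorm).indicator ms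

lemma energy_bound {f : ℝ → ℝ} (hf : Integrable f) (K : ℝ) (hK : 0 ≤ K) (hb : ∀ᵐ x, |f x| ≤ K) (n : ℤ) :
    ∫⁻ x, ENNReal.ofReal ((Aop n f x)^2) ≤ ENNReal.ofReal K * ∫⁻ y, ‖f y‖ₑ := by
  have h1 : ∀ x, ENNReal.ofReal ((Aop n f x)^2) ≤
      ENNReal.ofReal K * (ENNReal.ofReal (((2:ℝ)^n)⁻¹) * ∫⁻ y in Ioc x (x + 2^n), ‖f y‖ₑ) := by
    intro x
    have h2 : ‖Aop n f x‖ₑ ≤ ENNReal.ofReal K := by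
      refine (enorm_Aop_le f n x).trans ?_
      have : ∫⁻ y in Ioc x (x + 2^n), ‖f y‖ₑ ≤ ∫⁻ y in Ioc x (x + (2:ℝ)^n), ENNReal.ofReal K := by
        refine lintegral_mono_ae (ae_restrict_of_ae ?_)
        filter_upwards [hb] with y hy
        rw [← ofReal_norm]
        exact ENNReal.ofReal_le_ofReal hy
      refine (mul_le_mul_right this _).trans ?_
      rw [setLIntegral_const, Real.volume_Ioc, ← ENNReal.ofReal_mul hK, ← ENNReal.ofReal_mul (by positivity)]
      apply ENNReal.ofReal_le_ofReal
      have := two_zpow_pos n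
      apply le_of_eq
      field_simp
      ring
    have h3 : ENNReal.ofReal ((Aop n f x)^2) = ‖Aop n f x‖ₑ * ‖Aop n f x‖ₑ := by
      rw [← enorm_mul, ← sq, Real.enorm_eq_ofReal (by positivity)]
    rw [h3]
    gcongr
    exact enorm_Aop_le f n x
  refine (lintegral_mono h1).trans ?_
  rw [lintegral_const_mul' _ _ (by simp), lintegral_const_mul' _ _ (by simp)]
  gcongr
  refine (mul_le_mul_right (lintegral_avg hf.1 _) _).trans ?_
  rw [← mul_assoc, ← ENNReal.ofReal_mul (by positivity), inv_mul_cancel₀ (two_zpow_pos n).ne']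
  simp

/-- Dyadic interval of level `p.1` and position `p.2`. -/
def dI (p : ℤ × ℤ) : Set ℝ := Ico ((p.2:ℝ) * 2^p.1) (((p.2:ℝ)+1) * 2^p.1)

lemma dI_meas (p : ℤ × ℤ) : MeasurableSet (dI p) := measurableSet_Ico

lemma dI_vol (p : ℤ × ℤ) : volume (dI p) = ENNReal.ofReal (2^p.1) := by
  rw [dI, Real.volume_Ico]; congr 1; ring

lemma mem_dI_floor (n : ℤ) (x : ℝ) : x ∈ dI (n, ⌊x / 2^n⌋) := by
  have h := two_zpow_pos n
  constructor
  · exact (le_div_iff₀ h).1 (Int.floor_le _)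
  · exact (div_lt_iff₀ h).1 (Int.lt_floor_add_one _)

lemma dI_sub {n m k j : ℤ} (hnm : n ≤ m) {x : ℝ} (hx : x ∈ dI (n,k)) (hx' : x ∈ dI (m,j)) :
    dI (n,k) ⊆ dI (m,j) := by
  obtain ⟨d, rfl⟩ := Int.le.dest hnm
  have h := two_zpow_pos n
  simp only [dI, mem_Ico] at hx hx'
  have e : (2:ℝ)^(n + (d:ℤ)) = 2^d * 2^n := by
    rw [zpow_add₀ (by norm_num), zpow_natCast, mul_comm]
  rw [e, ← mul_assoc, ← mul_assoc] at hx'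
  have h1 : (j * 2^d : ℤ) < k + 1 := by
    have := lt_of_mul_lt_mul_right (hx'.1.trans_lt hx.2) h.le
    exact_mod_cast this
  have h2 : k < ((j+1) * 2^d : ℤ) := by
    have := lt_of_mul_lt_mul_right (hx.1.trans_lt hx'.2) h.le
    exact_mod_cast this
  have h3 : ((j:ℝ) * 2^d) ≤ k := by exact_mod_cast Int.lt_add_one_iff.1 h1
  have h4 : ((k:ℝ) + 1) ≤ (j+1) * 2^d := by exact_mod_cast h2
  simp only [dI]
  rw [e, ← mul_assoc, ← mul_assoc]
  apply Ico_subset_Ico <;> gcongr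

lemma dI_parent (n k : ℤ) : ∃ j, dI (n,k) ⊆ dI (n+1,j) := by
  have hx : (k:ℝ) * 2^n ∈ dI (n,k) := by
    have := two_zpow_pos n
    constructor
    · exact le_rfl
    · simp only; nlinarith
  exact ⟨_, dI_sub (by omega) hx (mem_dI_floor (n+1) _)⟩

def bad (f : ℝ → ℝ) (lam : ℝ) (p : ℤ × ℤ) : Prop := lam * 2^p.1 < ∫ y in dI p, |f y|

def Sel (f : ℝ → ℝ) (lam : ℝ) : Set (ℤ × ℤ) :=
  {p | bad f lam p ∧ ∀ q : ℤ × ℤ, p.1 < q.1 → dI p ⊆ dI q → ¬ bad f lam q}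

lemma Sel_unique {f : ℝ → ℝ} {lam : ℝ} {p q : ℤ × ℤ} (hp : p ∈ Sel f lam) (hq : q ∈ Sel f lam)
    {x : ℝ} (hx : x ∈ dI p) (hx' : x ∈ dI q) : p = q := by
  rcases lt_trichotomy p.1 q.1 with h | h | h
  · exact absurd hq.1 (hp.2 q h (dI_sub h.le hx hx'))
  · obtain ⟨n, k⟩ := p
    obtain ⟨m, j⟩ := q
    simp only at h
    subst h
    have h := two_zpow_pos n
    simp only [dI, mem_Ico] at hx hx'
    have h1 := lt_of_mul_lt_mul_right (hx'.1.trans_lt hx.2) h.le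
    have h2 := lt_of_mul_lt_mul_right (hx.1.trans_lt hx'.2) h.le
    have h1' : j < k + 1 := by exact_mod_cast h1
    have h2' : k < j + 1 := by exact_mod_cast h2
    rw [show k = j by omega]
  · exact absurd hp.1 (hq.2 p h (dI_sub h.le hx' hx))

lemma Sel_cover {f : ℝ → ℝ} (hf : Integrable f) {lam : ℝ} (hl : 0 < lam) {x : ℝ} {n : ℤ}
    (hb : bad f lam (n, ⌊x / 2^n⌋)) : ∃ p ∈ Sel f lam, x ∈ dI p := by
  obtain ⟨M, hM⟩ : ∃ M : ℕ, (∫ y, |f y|) / lam < 2^M := pow_unbounded_of_one_lt _ (by norm_num)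
  have hbd : ∀ q : ℤ × ℤ, bad f lam q → q.1 ≤ M := by
    intro q hq
    have h1 : ∫ y in dI q, |f y| ≤ ∫ y, |f y| :=
      setIntegral_le_integral hf.abs (Filter.Eventually.of_forall fun y => abs_nonneg _)
    have h2 : lam * 2^q.1 < lam * 2^M := by
      rw [div_lt_iff₀ hl] at hM
      unfold bad at hq
      linarith
    have h3 : (2:ℝ)^q.1 < 2^(M:ℤ) := by
      rw [zpow_natCast]; exact lt_of_mul_lt_mul_left h2 hl.le
    exact ((zpow_lt_zpow_iff_right₀ (by norm_num)).1 h3).le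
  obtain ⟨m, hm, hmax⟩ := Int.exists_greatest_of_bdd (P := fun m => bad f lam (m, ⌊x / 2^m⌋))
    ⟨M, fun z hz => hbd _ hz⟩ ⟨n, hb⟩
  refine ⟨(m, ⌊x / 2^m⌋), ⟨hm, ?_⟩, mem_dI_floor m x⟩
  rintro ⟨r, j⟩ hq hsub hbq
  have hx := hsub (mem_dI_floor m x)
  have : ⌊x / 2^r⌋ = j := by
    have h := two_zpow_pos r
    rw [Int.floor_eq_iff, le_div_iff₀ h, div_lt_iff₀ h]
    exact hx
  subst this
  have := hmax r hbq
  simp only at hq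
  omega

lemma Sel_upper {f : ℝ → ℝ} (hf : Integrable f) {lam : ℝ} {p : ℤ × ℤ} (hp : p ∈ Sel f lam) :
    ∫ y in dI p, |f y| ≤ 2 * lam * 2^p.1 := by
  obtain ⟨j, hj⟩ := dI_parent p.1 p.2
  have h1 := hp.2 (p.1+1, j) (by simp) hj
  unfold bad at h1
  simp only at h1
  rw [zpow_add_one₀ (by norm_num)] at h1
  have h2 : ∫ y in dI p, |f y| ≤ ∫ y in dI (p.1+1, j), |f y| :=
    setIntegral_mono_set hf.abs.integrableOn (Filter.Eventually.of_forall fun y => abs_nonneg _)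
      hj.eventuallyLE
  linarith

lemma ae_le_of_not_bad {f : ℝ → ℝ} (hf : Integrable f) {lam : ℝ} :
    ∀ᵐ x, (∀ n : ℤ, ¬ bad f lam (n, ⌊x / 2^n⌋)) → |f x| ≤ lam := by
  have h := IsUnifLocDoublingMeasure.ae_tendsto_average (μ := volume) hf.abs.locallyIntegrable 1
  filter_upwards [h] with x hx hnb
  have e : ∀ n : ℕ, Metric.closedBall (((⌊x / 2^(-(n:ℤ))⌋:ℝ) + 1/2) * 2^(-(n:ℤ))) ((1/2:ℝ)^(n+1))
      = Icc ((⌊x / 2^(-(n:ℤ))⌋:ℝ) * 2^(-(n:ℤ))) (((⌊x / 2^(-(n:ℤ))⌋:ℝ) + 1) * 2^(-(n:ℤ))) := by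
    intro n
    rw [Real.closedBall_eq_Icc, show (1/2:ℝ)^(n+1) = 1/2 * 2^(-(n:ℤ)) by
      rw [zpow_neg, zpow_natCast, pow_succ]; simp; ring]
    congr 1 <;> ring
  have key := hx (l := Filter.atTop) (fun n : ℕ => ((⌊x / 2^(-(n:ℤ))⌋:ℝ) + 1/2) * 2^(-(n:ℤ)))
    (fun n => (1/2:ℝ)^(n+1)) ?_ ?_
  · refine le_of_tendsto key (Filter.Eventually.of_forall fun n => ?_)
    rw [e, setAverage_eq, integral_Icc_eq_integral_Ico]
    have h1 := hnb (-(n:ℤ))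
    unfold bad dI at h1
    simp only [not_lt] at h1
    have h2 := two_zpow_pos (-(n:ℤ))
    rw [measureReal_def, Real.volume_Icc, ← sub_mul, add_sub_cancel_left, one_mul,
      ENNReal.toReal_ofReal h2.le, smul_eq_mul, inv_mul_le_iff₀ h2, mul_comm _ lam]
    exact h1
  · apply tendsto_nhdsWithin_of_tendsto_nhds_of_eventually_within
    · exact (tendsto_pow_atTop_nhds_zero_of_lt_one (by norm_num) (by norm_num)).comp
        (Filter.tendsto_add_atTop_nat 1)
    · exact Filter.Eventually.of_forall fun n => by simp only [mem_Ioi]; positivity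
  · refine Filter.Eventually.of_forall fun n => ?_
    rw [one_mul, e]
    exact Ico_subset_Icc_self (mem_dI_floor _ x)

lemma Vop_le (s : ℝ) (hs : 2 ≤ s) (f : ℝ → ℝ) (x : ℝ) (lam : ℝ) (hl : 0 < lam) (G B : ℤ → ℝ)
    (hd : ∀ n, Aop n f x = G n + B n)
    (hG : ∑' n, ENNReal.ofReal ((G n - G (n-1))^2) ≤ ENNReal.ofReal (lam^2/4))
    (hB : ∑' n, ‖B n‖ₑ ≤ ENNReal.ofReal (lam/4)) : Vop s f x ≤ lam := by
  have key : ∀ F : Finset ℤ, ∑ n ∈ F, (Aop n f x - Aop (n-1) f x)^2 ≤ lam^2 := by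
    intro F
    have g1 : ∑ n ∈ F, (G n - G (n-1))^2 ≤ lam^2/4 := by
      have := (ENNReal.sum_le_tsum F).trans hG
      rw [← ENNReal.ofReal_sum_of_nonneg (fun _ _ => sq_nonneg _)] at this
      exact (ENNReal.ofReal_le_ofReal_iff (by positivity)).1 this
    have b0 : ∀ F : Finset ℤ, ∑ n ∈ F, |B n| ≤ lam/4 := by
      intro F
      have := (ENNReal.sum_le_tsum F).trans hB
      simp_rw [← ofReal_norm] at this
      rw [← ENNReal.ofReal_sum_of_nonneg (fun _ _ => norm_nonneg _)] at this
      exact (ENNReal.ofReal_le_ofReal_iff (by positivity)).1 this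
    have b1 : ∀ n, |B n| ≤ lam/4 := fun n => by simpa using b0 {n}
    have b2 : ∑ n ∈ F, |B (n-1)| ≤ lam/4 := by
      have := b0 (F.image (fun n => n-1))
      rwa [Finset.sum_image (by intro a _ b _ h; simpa using h)] at this
    have b3 : ∑ n ∈ F, (B n - B (n-1))^2 ≤ lam^2/4 := by
      calc ∑ n ∈ F, (B n - B (n-1))^2 ≤ ∑ n ∈ F, (lam/2) * (|B n| + |B (n-1)|) := by
            refine Finset.sum_le_sum fun n _ => ?_
            have h1 := abs_sub (B n) (B (n-1))
            have h2 := b1 n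
            have h3 := b1 (n-1)
            rw [← sq_abs, sq]
            exact mul_le_mul (by linarith) h1 (abs_nonneg _) (by positivity)
        _ = (lam/2) * (∑ n ∈ F, |B n| + ∑ n ∈ F, |B (n-1)|) := by
            rw [← Finset.mul_sum, Finset.sum_add_distrib]
        _ ≤ (lam/2) * (lam/4 + lam/4) := by gcongr; exact b0 F
        _ = lam^2/4 := by ring
    calc ∑ n ∈ F, (Aop n f x - Aop (n-1) f x)^2
        ≤ ∑ n ∈ F, (2 * (G n - G (n-1))^2 + 2 * (B n - B (n-1))^2) := by
          refine Finset.sum_le_sum fun n _ => ?_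
          rw [hd, hd]
          nlinarith [sq_nonneg ((G n - G (n-1)) - (B n - B (n-1)))]
      _ = 2 * ∑ n ∈ F, (G n - G (n-1))^2 + 2 * ∑ n ∈ F, (B n - B (n-1))^2 := by
          rw [Finset.sum_add_distrib, Finset.mul_sum, Finset.mul_sum]
      _ ≤ lam^2 := by linarith
  have single : ∀ n, |Aop n f x - Aop (n-1) f x| ≤ lam := by
    intro n
    have := key {n}
    rw [Finset.sum_singleton] at this
    exact abs_le_of_sq_le_sq this hl.le
  have tot : ∑' n : ℤ, |Aop n f x - Aop (n-1) f x| ^ s ≤ lam ^ s := by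
    refine Real.tsum_le_of_sum_le (fun n => by positivity) fun F => ?_
    have hp : ∀ a : ℝ, 0 ≤ a → a ^ s = a^2 * a^(s-2) := by
      intro a ha
      rcases ha.eq_or_lt with rfl | ha
      · rw [Real.zero_rpow (by linarith)]; simp
      · rw [← Real.rpow_natCast, ← Real.rpow_add ha]; congr 1; push_cast; ring
    calc ∑ n ∈ F, |Aop n f x - Aop (n-1) f x| ^ s
        ≤ ∑ n ∈ F, (Aop n f x - Aop (n-1) f x)^2 * lam^(s-2) := by
          refine Finset.sum_le_sum fun n _ => ?_
          rw [hp _ (abs_nonneg _), sq_abs]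
          gcongr
          exact single n
      _ = (∑ n ∈ F, (Aop n f x - Aop (n-1) f x)^2) * lam^(s-2) := by rw [Finset.sum_mul]
      _ ≤ lam^2 * lam^(s-2) := by gcongr; exact key F
      _ = lam ^ s := (hp _ hl.le).symm
  unfold Vop
  calc _ ≤ (lam ^ s) ^ (1/s) := by
        apply Real.rpow_le_rpow (tsum_nonneg fun n => by positivity) tot (by positivity)
    _ = lam := by rw [← Real.rpow_mul hl.le, mul_one_div_cancel (by linarith), Real.rpow_one]

noncomputable def cP (f : ℝ → ℝ) (p : ℤ × ℤ) : ℝ := ((2:ℝ)^p.1)⁻¹ * ∫ y in dI p, f y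

open Classical in
noncomputable def gP (f : ℝ → ℝ) (lam : ℝ) (x : ℝ) : ℝ :=
  if h : ∃ p ∈ Sel f lam, x ∈ dI p then cP f h.choose else f x

def EP (f : ℝ → ℝ) (lam : ℝ) : Set ℝ := ⋃ p : Sel f lam, dI p.1

lemma EP_meas (f : ℝ → ℝ) (lam : ℝ) : MeasurableSet (EP f lam) :=
  MeasurableSet.iUnion fun p => dI_meas _

lemma dI_pw (f : ℝ → ℝ) (lam : ℝ) : Pairwise (Function.onFun Disjoint fun p : Sel f lam => dI p.1) := by
  intro p q hpq
  rw [Function.onFun, Set.disjoint_left]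
  intro x hx hx'
  exact hpq (Subtype.ext (Sel_unique p.2 q.2 hx hx'))

lemma gP_on {f : ℝ → ℝ} {lam : ℝ} {p : ℤ × ℤ} (hp : p ∈ Sel f lam) {x : ℝ} (hx : x ∈ dI p) :
    gP f lam x = cP f p := by
  have h : ∃ p ∈ Sel f lam, x ∈ dI p := ⟨p, hp, hx⟩
  rw [gP, dif_pos h, Sel_unique h.choose_spec.1 hp h.choose_spec.2 hx]

lemma gP_off {f : ℝ → ℝ} {lam : ℝ} {x : ℝ} (hx : x ∉ EP f lam) : gP f lam x = f x := by
  rw [gP, dif_neg]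
  rintro ⟨p, hp, h⟩
  exact hx (mem_iUnion.2 ⟨⟨p, hp⟩, h⟩)

lemma gP_lint_on {f : ℝ → ℝ} {lam : ℝ} {p : ℤ × ℤ} (hp : p ∈ Sel f lam) :
    ∫⁻ y in dI p, ‖gP f lam y‖ₑ ≤ ∫⁻ y in dI p, ‖f y‖ₑ := by
  rw [setLIntegral_congr_fun (g := fun _ => ‖cP f p‖ₑ) (dI_meas p) (fun x hx => by simp only [gP_on hp hx]),
    setLIntegral_const, dI_vol, cP, enorm_mul, Real.enorm_eq_ofReal (by positivity), mul_comm, ← mul_assoc,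
    ← ENNReal.ofReal_mul (by positivity), mul_inv_cancel₀ (two_zpow_pos _).ne', ENNReal.ofReal_one, one_mul]
  exact enorm_integral_le_lintegral_enorm _

lemma gP_lint {f : ℝ → ℝ} {lam : ℝ} :
    ∫⁻ y, ‖gP f lam y‖ₑ ≤ ∫⁻ y, ‖f y‖ₑ := by
  rw [← lintegral_add_compl _ (EP_meas f lam), ← lintegral_add_compl (fun y => ‖f y‖ₑ) (EP_meas f lam)]
  apply add_le_add
  · rw [EP, lintegral_iUnion (fun p => dI_meas _) (dI_pw f lam), lintegral_iUnion (fun p => dI_meas _) (dI_pw f lam)]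
    exact ENNReal.tsum_le_tsum fun p => gP_lint_on p.2
  · apply le_of_eq
    exact setLIntegral_congr_fun (EP_meas f lam).compl (fun x hx => by simp only [gP_off hx])

lemma gP_int {f : ℝ → ℝ} (hf : Integrable f) (lam : ℝ) : Integrable (gP f lam) := by
  refine ⟨?_, gP_lint.trans_lt hf.2⟩
  rw [← Measure.restrict_univ (μ := volume), ← union_compl_self (EP f lam), aestronglyMeasurable_union_iff]
  constructor
  · rw [EP, aestronglyMeasurable_iUnion_iff]
    intro p
    refine (aestronglyMeasurable_const (b := cP f p)).congr ?_
    filter_upwards [ae_restrict_mem (dI_meas p.1)] with x hx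
    exact (gP_on p.2 hx).symm
  · refine hf.1.restrict.congr ?_
    filter_upwards [ae_restrict_mem (EP_meas f lam).compl] with x hx
    exact (gP_off hx).symm

lemma gP_bdd {f : ℝ → ℝ} (hf : Integrable f) {lam : ℝ} (hl : 0 < lam) : ∀ᵐ x, |gP f lam x| ≤ 2 * lam := by
  filter_upwards [ae_le_of_not_bad hf (lam := lam)] with x hx
  by_cases h : x ∈ EP f lam
  · obtain ⟨p, hp⟩ := mem_iUnion.1 h
    rw [gP_on p.2 hp, cP, abs_mul, abs_of_pos (inv_pos.2 (two_zpow_pos _)), inv_mul_le_iff₀ (two_zpow_pos _)]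
    have h1 := Sel_upper hf p.2
    have h2 : |∫ y in dI p.1, f y| ≤ ∫ y in dI p.1, |f y| := abs_integral_le_integral_abs
    linarith
  · rw [gP_off h]
    have := hx (fun n hb => h (by
      obtain ⟨p, hp, hxp⟩ := Sel_cover hf hl hb
      exact mem_iUnion.2 ⟨⟨p, hp⟩, hxp⟩))
    linarith

/-- The bad part. -/
noncomputable def bP (f : ℝ → ℝ) (lam : ℝ) (x : ℝ) : ℝ := f x - gP f lam x

lemma bP_int {f : ℝ → ℝ} (hf : Integrable f) (lam : ℝ) : Integrable (bP f lam) := hf.sub (gP_int hf lam)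

lemma bP_mean {f : ℝ → ℝ} (hf : Integrable f) {lam : ℝ} {p : ℤ × ℤ} (hp : p ∈ Sel f lam) :
    ∫ y in dI p, bP f lam y = 0 := by
  unfold bP
  rw [integral_sub hf.integrableOn (gP_int hf lam).integrableOn,
    setIntegral_congr_fun (g := fun _ => cP f p) (dI_meas p) (fun x hx => gP_on hp hx),
    setIntegral_const, measureReal_def, dI_vol, ENNReal.toReal_ofReal (two_zpow_pos _).le, cP, smul_eq_mul,
    mul_inv_cancel_left₀ (two_zpow_pos _).ne', sub_self]

lemma bP_lint {f : ℝ → ℝ} (hf : Integrable f) (lam : ℝ) :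
    ∫⁻ y, ‖bP f lam y‖ₑ ≤ 2 * ∫⁻ y, ‖f y‖ₑ := by
  calc ∫⁻ y, ‖bP f lam y‖ₑ ≤ ∫⁻ y, (‖f y‖ₑ + ‖gP f lam y‖ₑ) := lintegral_mono fun y => enorm_sub_le
    _ = (∫⁻ y, ‖f y‖ₑ) + ∫⁻ y, ‖gP f lam y‖ₑ := lintegral_add_left' hf.1.enorm _
    _ ≤ _ := by rw [two_mul]; exact add_le_add le_rfl gP_lint

lemma vol_sum {f : ℝ → ℝ} (hf : Integrable f) {lam : ℝ} (hl : 0 < lam) :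
    ∑' p : Sel f lam, ENNReal.ofReal (2^p.1.1) ≤ ENNReal.ofReal (1/lam) * ∫⁻ y, ‖f y‖ₑ := by
  have h1 : ∀ p : Sel f lam, ENNReal.ofReal (2^p.1.1) ≤ ENNReal.ofReal (1/lam) * ∫⁻ y in dI p.1, ‖f y‖ₑ := by
    intro p
    have h2 : ∫⁻ y in dI p.1, ‖f y‖ₑ = ENNReal.ofReal (∫ y in dI p.1, |f y|) := by
      simp_rw [← Real.norm_eq_abs]
      rw [ofReal_integral_norm_eq_lintegral_enorm hf.integrableOn]
    rw [h2, ← ENNReal.ofReal_mul (by positivity)]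
    apply ENNReal.ofReal_le_ofReal
    have h3 := p.2.1
    unfold bad at h3
    rw [one_div, le_inv_mul_iff₀ hl]
    exact h3.le
  refine (ENNReal.tsum_le_tsum h1).trans ?_
  rw [ENNReal.tsum_mul_left, ← lintegral_iUnion (fun p => dI_meas _) (dI_pw f lam)]
  gcongr
  exact Measure.restrict_le_self

/-- Enlarged exceptional set. -/
def ES (f : ℝ → ℝ) (lam : ℝ) : Set ℝ := ⋃ p : Sel f lam, (dI p.1 ∪ dI (p.1.1, p.1.2 - 1))

lemma ES_meas (f : ℝ → ℝ) (lam : ℝ) : MeasurableSet (ES f lam) :=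
  MeasurableSet.iUnion fun p => (dI_meas _).union (dI_meas _)

lemma ES_vol {f : ℝ → ℝ} (hf : Integrable f) {lam : ℝ} (hl : 0 < lam) :
    volume (ES f lam) ≤ ENNReal.ofReal (2/lam) * ∫⁻ y, ‖f y‖ₑ := by
  calc volume (ES f lam) ≤ ∑' p : Sel f lam, volume (dI p.1 ∪ dI (p.1.1, p.1.2 - 1)) := measure_iUnion_le _
    _ ≤ ∑' p : Sel f lam, 2 * ENNReal.ofReal (2^p.1.1) := ENNReal.tsum_le_tsum fun p => by
        refine (measure_union_le _ _).trans ?_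
        rw [dI_vol, dI_vol, two_mul]
    _ ≤ 2 * (ENNReal.ofReal (1/lam) * ∫⁻ y, ‖f y‖ₑ) := by
        rw [ENNReal.tsum_mul_left]; gcongr; exact vol_sum hf hl
    _ = _ := by
        rw [← mul_assoc, show (2:ENNReal) = ENNReal.ofReal 2 by simp, ← ENNReal.ofReal_mul (by norm_num)]
        congr 2; ring

lemma bP_off {f : ℝ → ℝ} {lam : ℝ} {x : ℝ} (hx : x ∉ EP f lam) : bP f lam x = 0 := by
  rw [bP, gP_off hx, sub_self]

/-- Pointwise majorant of the averages of the bad part. -/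
noncomputable def maj (f : ℝ → ℝ) (lam : ℝ) (p : ℤ × ℤ) (n : ℤ) (x : ℝ) : ENNReal :=
  (∫⁻ y in dI p, ‖bP f lam y‖ₑ) * ((if p.1 ≤ n then ENNReal.ofReal (((2:ℝ)^n)⁻¹) else 0) *
    (dI p).indicator 1 (x + 2^n))

lemma Aop_bP {f : ℝ → ℝ} (hf : Integrable f) {lam : ℝ} {x : ℝ} (hx : x ∉ ES f lam) (n : ℤ) :
    ‖Aop n (bP f lam) x‖ₑ ≤ ∑' p : Sel f lam, maj f lam p.1 n x := by
  have hn := two_zpow_pos n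
  have hb := bP_int hf lam
  have e : ∫ y in x..(x + 2^n), bP f lam y = ∑' p : Sel f lam, ∫ y in dI p.1 ∩ Ioc x (x + 2^n), bP f lam y := by
    rw [intervalIntegral.integral_of_le (by linarith), ← integral_iUnion
      (fun p => (dI_meas _).inter measurableSet_Ioc)
      (fun p q hpq => (dI_pw f lam hpq).mono inter_subset_left inter_subset_left) hb.integrableOn,
      ← iUnion_inter]
    apply setIntegral_eq_of_subset_of_forall_sdiff_eq_zero measurableSet_Ioc inter_subset_right
    rintro y ⟨hy, hy'⟩
    exact bP_off fun h => hy' ⟨h, hy⟩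
  rw [Aop, enorm_mul, e, Real.enorm_eq_ofReal (by positivity)]
  refine (mul_le_mul_right enorm_tsum_le_tsum_enorm _).trans ?_
  rw [← ENNReal.tsum_mul_left]
  refine ENNReal.tsum_le_tsum fun p => ?_
  have hxp : x ∉ dI p.1 := fun h => hx (mem_iUnion.2 ⟨p, Or.inl h⟩)
  have hxl : x ∉ dI (p.1.1, p.1.2 - 1) := fun h => hx (mem_iUnion.2 ⟨p, Or.inr h⟩)
  by_cases hm : x + 2^n ∈ dI p.1
  · have hle : p.1.1 ≤ n := by
      have hp := two_zpow_pos p.1.1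
      simp only [dI, mem_Ico, not_and, not_lt] at hxp hxl hm
      push_cast at hxl
      rw [sub_add_cancel] at hxl
      by_contra hlt
      have h1 : (2:ℝ)^n < 2^p.1.1 := zpow_lt_zpow_right₀ (by norm_num) (not_le.1 hlt)
      have h2 := hxl (by linarith [hm.1])
      have h3 := hxp h2
      linarith [hm.2]
    rw [maj, if_pos hle, indicator_of_mem hm, mul_comm]
    simp only [Pi.one_apply, mul_one]
    gcongr
    exact (enorm_integral_le_lintegral_enorm _).trans
      (lintegral_mono' (Measure.restrict_mono inter_subset_left le_rfl) le_rfl)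
  · have : ∫ y in dI p.1 ∩ Ioc x (x + 2^n), bP f lam y = 0 := by
      by_cases hc : dI p.1 ⊆ Ioc x (x + 2^n)
      · rw [inter_eq_left.2 hc]; exact bP_mean hf p.2
      · have : dI p.1 ∩ Ioc x (x + 2^n) = ∅ := by
          rw [eq_empty_iff_forall_notMem]
          rintro y ⟨⟨h1, h2⟩, h3, h4⟩
          apply hc
          simp only [dI, mem_Ico, not_and, not_lt] at hxp hm
          have h5 := hm (h1.trans h4)
          have h6 : x < (p.1.2:ℝ) * 2^p.1.1 := by
            by_contra hh
            have := hxp (not_lt.1 hh)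
            linarith
          rintro z ⟨z1, z2⟩
          constructor <;> linarith
        rw [this]; simp
    rw [this]; simp

lemma geom (m : ℤ) : ∑' n : ℤ, (if m ≤ n then ENNReal.ofReal (((2:ℝ)^n)⁻¹) else 0) * ENNReal.ofReal (2^m) ≤ 2 := by
  have hinj : Function.Injective (fun j : ℕ => m + (j:ℤ)) := fun a b h => by simpa using h
  rw [← hinj.tsum_eq]
  · have e : ∀ j : ℕ, (if m ≤ m + (j:ℤ) then ENNReal.ofReal (((2:ℝ)^(m + (j:ℤ)))⁻¹) else 0) * ENNReal.ofReal (2^m)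
        = (2⁻¹ : ENNReal)^j := by
      intro j
      have h2 := two_zpow_pos m
      rw [if_pos (by omega), ← ENNReal.ofReal_mul (by positivity), zpow_add₀ (by norm_num), zpow_natCast,
        show ((2:ℝ)^m * 2^j)⁻¹ * 2^m = (2⁻¹)^j by field_simp; simp,
        ENNReal.ofReal_pow (by norm_num), ENNReal.ofReal_inv_of_pos (by norm_num)]
      simp
    simp_rw [e]
    rw [ENNReal.tsum_geometric, ENNReal.one_sub_inv_two, inv_inv]
  · intro n hn
    by_contra h
    apply hn
    have : ¬ m ≤ n := fun hle => h ⟨(n-m).toNat, by simp; omega⟩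
    simp [this]

lemma lint_maj {f : ℝ → ℝ} {lam : ℝ} (p : ℤ × ℤ) :
    ∑' n : ℤ, ∫⁻ x, maj f lam p n x ≤ 2 * ∫⁻ y in dI p, ‖bP f lam y‖ₑ := by
  have mi : Measurable ((dI p).indicator (1 : ℝ → ENNReal)) := measurable_one.indicator (dI_meas p)
  have h1 : ∀ n, ∫⁻ x, maj f lam p n x = (∫⁻ y in dI p, ‖bP f lam y‖ₑ) *
      ((if p.1 ≤ n then ENNReal.ofReal (((2:ℝ)^n)⁻¹) else 0) * ENNReal.ofReal (2^p.1)) := by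
    intro n
    have mt : Measurable (fun x : ℝ => (dI p).indicator (1 : ℝ → ENNReal) (x + 2^n)) :=
      mi.comp (measurable_id.add_const _)
    unfold maj
    rw [lintegral_const_mul _ (mt.const_mul _), lintegral_const_mul _ mt,
      lintegral_add_right_eq_self (fun x => (dI p).indicator (1 : ℝ → ENNReal) x), lintegral_indicator_one (dI_meas p), dI_vol]
  simp_rw [h1]
  rw [ENNReal.tsum_mul_left, mul_comm]
  gcongr
  exact geom _

lemma lint_bad {f : ℝ → ℝ} (hf : Integrable f) {lam : ℝ} :
    ∫⁻ x in (ES f lam)ᶜ, ∑' n : ℤ, ‖Aop n (bP f lam) x‖ₑ ≤ 4 * ∫⁻ y, ‖f y‖ₑ := by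
  have mm : ∀ p n, Measurable (maj f lam p n) := by
    intro p n
    have mi : Measurable ((dI p).indicator (1 : ℝ → ENNReal)) := measurable_one.indicator (dI_meas p)
    have mt : Measurable (fun x : ℝ => (dI p).indicator (1 : ℝ → ENNReal) (x + 2^n)) :=
      mi.comp (measurable_id.add_const _)
    exact (mt.const_mul _).const_mul _
  calc ∫⁻ x in (ES f lam)ᶜ, ∑' n : ℤ, ‖Aop n (bP f lam) x‖ₑ
      ≤ ∫⁻ x in (ES f lam)ᶜ, ∑' n : ℤ, ∑' p : Sel f lam, maj f lam p.1 n x :=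
        setLIntegral_mono' (ES_meas f lam).compl fun x hx => ENNReal.tsum_le_tsum fun n => Aop_bP hf hx n
    _ ≤ ∫⁻ x, ∑' n : ℤ, ∑' p : Sel f lam, maj f lam p.1 n x := setLIntegral_le_lintegral _ _
    _ = ∑' n : ℤ, ∑' p : Sel f lam, ∫⁻ x, maj f lam p.1 n x := by
        rw [lintegral_tsum (fun n => (Measurable.tsum fun p => mm _ _).aemeasurable)]
        congr 1; ext n
        rw [lintegral_tsum (fun p => (mm _ _).aemeasurable)]
    _ = ∑' p : Sel f lam, ∑' n : ℤ, ∫⁻ x, maj f lam p.1 n x := ENNReal.tsum_comm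
    _ ≤ ∑' p : Sel f lam, 2 * ∫⁻ y in dI p.1, ‖bP f lam y‖ₑ := ENNReal.tsum_le_tsum fun p => lint_maj p.1
    _ = 2 * ∫⁻ y in EP f lam, ‖bP f lam y‖ₑ := by
        rw [ENNReal.tsum_mul_left, EP, lintegral_iUnion (fun p => dI_meas _) (dI_pw f lam)]
    _ ≤ 2 * (2 * ∫⁻ y, ‖f y‖ₑ) := by
        gcongr
        exact (setLIntegral_le_lintegral _ _).trans (bP_lint hf lam)
    _ = _ := by rw [← mul_assoc]; norm_num

lemma lint_good {f : ℝ → ℝ} (hf : Integrable f) {lam : ℝ} (hl : 0 < lam) :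
    ∫⁻ x, ∑' n : ℤ, ENNReal.ofReal ((Aop n (gP f lam) x - Aop (n-1) (gP f lam) x)^2)
      ≤ ENNReal.ofReal (2 * lam) * ∫⁻ y, ‖f y‖ₑ := by
  have hg := gP_int hf lam
  have mD : ∀ n : ℤ, Measurable (fun x => ENNReal.ofReal ((Aop n (gP f lam) x - Aop (n-1) (gP f lam) x)^2)) :=
    fun n => (((Aop_cont hg n).sub (Aop_cont hg (n-1))).pow 2).measurable.ennreal_ofReal
  rw [lintegral_tsum (fun n => (mD n).aemeasurable)]
  apply energy_sum hg
  intro n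
  refine (energy_bound hg (2*lam) (by positivity) (gP_bdd hf hl) n).trans ?_
  exact mul_le_mul_right gP_lint _

theorem stmt7 (s : ℝ) (hs : 2 ≤ s) :
    ∃ C > 0, ∀ f : ℝ → ℝ, Integrable f → ∀ lam : ℝ, 0 < lam →
      volume {x : ℝ | lam < Vop s f x}
        ≤ ENNReal.ofReal ((C / lam) * ∫ x : ℝ, |f x|) := by
  refine ⟨26, by norm_num, fun f hf lam hl => ?_⟩
  have hg := gP_int hf lam
  have hb := bP_int hf lam
  set T : ℝ → ENNReal := fun x => ∑' n : ℤ, ENNReal.ofReal ((Aop n (gP f lam) x - Aop (n-1) (gP f lam) x)^2) with hT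
  set U : ℝ → ENNReal := fun x => ∑' n : ℤ, ‖Aop n (bP f lam) x‖ₑ with hU
  have mT : Measurable T := Measurable.tsum fun n =>
    (((Aop_cont hg n).sub (Aop_cont hg (n-1))).pow 2).measurable.ennreal_ofReal
  have mU : Measurable U := Measurable.tsum fun n => (Aop_cont hb n).measurable.enorm
  have hsub : {x : ℝ | lam < Vop s f x} ⊆ ES f lam ∪ ({x | ENNReal.ofReal (lam^2/4) ≤ T x} ∪
      ({x | ENNReal.ofReal (lam/4) ≤ U x} ∩ (ES f lam)ᶜ)) := by
    intro x hx
    by_contra hcon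
    simp only [mem_union, mem_inter_iff, not_or, not_and, mem_compl_iff, not_not] at hcon
    obtain ⟨h1, h2, h3⟩ := hcon
    have h4 : ¬ (ENNReal.ofReal (lam/4) ≤ U x) := fun h => h1 (h3 h)
    have h2' : ¬ (ENNReal.ofReal (lam^2/4) ≤ T x) := h2
    refine absurd hx (not_lt.2 (Vop_le s hs f x lam hl (fun n => Aop n (gP f lam) x)
      (fun n => Aop n (bP f lam) x) (fun n => ?_) (not_le.1 h2').le (not_le.1 h4).le))
    have := Aop_sub hf hg n x
    change Aop n (bP f lam) x = _ at this
    rw [this]; ring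
  have v1 := ES_vol hf hl
  have v2 : volume {x | ENNReal.ofReal (lam^2/4) ≤ T x} ≤ ENNReal.ofReal (8/lam) * ∫⁻ y, ‖f y‖ₑ := by
    refine (meas_ge_le_lintegral_div mT.aemeasurable (by simp; positivity) (by simp)).trans ?_
    refine (ENNReal.div_le_div_right (lint_good hf hl) _).trans ?_
    rw [ENNReal.mul_div_right_comm, ← ENNReal.ofReal_div_of_pos (by positivity),
      show 2 * lam / (lam^2/4) = 8/lam by field_simp; ring]
  have v3 : volume ({x | ENNReal.ofReal (lam/4) ≤ U x} ∩ (ES f lam)ᶜ) ≤ ENNReal.ofReal (16/lam) * ∫⁻ y, ‖f y‖ₑ := by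
    rw [← Measure.restrict_apply' (ES_meas f lam).compl]
    refine (meas_ge_le_lintegral_div mU.aemeasurable (by simp; positivity) (by simp)).trans ?_
    refine (ENNReal.div_le_div_right (lint_bad hf) _).trans ?_
    rw [ENNReal.mul_div_right_comm, show (4:ENNReal) = ENNReal.ofReal 4 by simp, ← ENNReal.ofReal_div_of_pos (by positivity),
      show 4 / (lam/4) = 16/lam by field_simp; ring]
  have hL : ENNReal.ofReal (∫ x, |f x|) = ∫⁻ y, ‖f y‖ₑ := by
    simp_rw [← Real.norm_eq_abs]
    exact ofReal_integral_norm_eq_lintegral_enorm hf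
  rw [ENNReal.ofReal_mul (by positivity), hL]
  refine (measure_mono hsub).trans ((measure_union_le _ _).trans
    ((add_le_add v1 ((measure_union_le _ _).trans (add_le_add v2 v3))).trans ?_))
  rw [← add_mul, ← add_mul, ← ENNReal.ofReal_add (by positivity) (by positivity),
    ← ENNReal.ofReal_add (by positivity) (by positivity),
    show 2/lam + (8/lam + 16/lam) = 26/lam by ring]
end

section
/- Fix 2 ≤ s < ∞ and let V f(x) = (∑_{n∈ℤ} |A_n f(x) − A_{n-1} f(x)|^s)^{1/s} with A_n f(x) = 2^{-n} ∫_x^{x+2^n} f(y) dy. Then there exists C > 0 such that ‖V f‖_{L^1(ℝ)} ≤ C ‖f‖_{H^1(ℝ)} for all f in the real Hardy space H^1(ℝ). -/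
open MeasureTheory Set Real

/-- An `H^1`-atom: a measurable function supported in a bounded interval `[c-r, c+r]`,
bounded by the reciprocal of the length of that interval, with vanishing integral. -/
def IsH1Atom (a : ℝ → ℝ) : Prop :=
  Measurable a ∧ ∃ c r : ℝ, 0 < r ∧
    (∀ x, x ∉ Set.Icc (c - r) (c + r) → a x = 0) ∧
    (∀ x, |a x| ≤ (2 * r)⁻¹) ∧
    (∫ x : ℝ, a x) = 0

/-- The difference operator. -/
noncomputable def Dop (n : ℤ) (f : ℝ → ℝ) (x : ℝ) : ℝ := Aop n f x - Aop (n-1) f x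

/-- The extended-valued variation operator. -/
noncomputable def Wop (s : ℝ) (f : ℝ → ℝ) (x : ℝ) : ENNReal :=
  (∑' n : ℤ, ‖Dop n f x‖ₑ ^ s) ^ (1/s)

lemma two_zpow_pred (n : ℤ) : (2:ℝ)^n = 2 * (2:ℝ)^(n-1) := by
  rw [← zpow_one_add₀ (by norm_num)]; congr 1; ring

lemma Vop_le_Wop (s : ℝ) (hs : 2 ≤ s) (f : ℝ → ℝ) (x : ℝ) :
    ENNReal.ofReal (Vop s f x) ≤ Wop s f x := by
  have hs0 : 0 < 1 / s := by positivity
  unfold Vop Wop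
  by_cases h : Summable (fun n : ℤ => |Aop n f x - Aop (n-1) f x| ^ s)
  · rw [← ENNReal.ofReal_rpow_of_nonneg (tsum_nonneg fun n => by positivity) hs0.le,
      ENNReal.ofReal_tsum_of_nonneg (fun n => by positivity) h]
    apply le_of_eq
    congr 2
    ext n
    rw [← ENNReal.ofReal_rpow_of_nonneg (abs_nonneg _) (by linarith), Real.enorm_eq_ofReal_abs]
    rfl
  · rw [tsum_eq_zero_of_not_summable h, Real.zero_rpow hs0.ne']
    simp

lemma Lp_finset_le (s : ℝ) (hs : 2 ≤ s) (F : Finset ℤ) (u : ℕ → ℤ → ENNReal) (J : ℕ) :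
    (∑ n ∈ F, (∑ j ∈ Finset.range J, u j n) ^ s) ^ (1/s)
      ≤ ∑ j ∈ Finset.range J, (∑ n ∈ F, u j n ^ s) ^ (1/s) := by
  have hs0 : 0 < s := by linarith
  induction J with
  | zero => simp [hs0]
  | succ J ih =>
    simp only [Finset.sum_range_succ]
    refine (ENNReal.Lp_add_le F _ _ (by linarith)).trans ?_
    gcongr

lemma Lp_tsum_le (s : ℝ) (hs : 2 ≤ s) (u : ℕ → ℤ → ENNReal) :
    (∑' n, (∑' j, u j n) ^ s) ^ (1/s) ≤ ∑' j, (∑' n, u j n ^ s) ^ (1/s) := by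
  have hs0 : 0 < s := by linarith
  have key : ∀ F : Finset ℤ,
      (∑ n ∈ F, (∑' j, u j n) ^ s) ^ (1/s) ≤ ∑' j, (∑' n, u j n ^ s) ^ (1/s) := by
    intro F
    have ht : Filter.Tendsto
        (fun J : ℕ => (∑ n ∈ F, (∑ j ∈ Finset.range J, u j n) ^ s) ^ (1/s)) Filter.atTop
        (nhds ((∑ n ∈ F, (∑' j, u j n) ^ s) ^ (1/s))) := by
      apply Filter.Tendsto.ennrpow_const
      apply tendsto_finsetSum
      intro n _
      apply Filter.Tendsto.ennrpow_const
      exact ENNReal.tendsto_nat_tsum _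
    refine le_of_tendsto ht (Filter.Eventually.of_forall fun J => ?_)
    refine (Lp_finset_le s hs F u J).trans ?_
    refine le_trans ?_ (ENNReal.sum_le_tsum (Finset.range J))
    gcongr
    exact ENNReal.sum_le_tsum F
  rw [one_div, ENNReal.rpow_inv_le_iff hs0]
  rw [ENNReal.tsum_eq_iSup_sum]
  refine iSup_le fun F => ?_
  rw [← ENNReal.rpow_inv_le_iff hs0, ← one_div]
  exact key F

lemma l1_bound (s : ℝ) (hs : 2 ≤ s) (d : ℤ → ENNReal) :
    (∑' n, d n ^ s) ^ (1/s) ≤ ∑' n, d n := by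
  have hs0 : 0 < s := by linarith
  rw [one_div, ENNReal.rpow_inv_le_iff hs0]
  have h1 : ∀ y : ENNReal, y ^ s = y ^ (s-1) * y := by
    intro y
    conv_lhs => rw [show s = (s-1) + 1 by ring]
    rw [ENNReal.rpow_add_of_nonneg _ _ (by linarith) zero_le_one, ENNReal.rpow_one]
  rw [h1 (∑' n, d n), ← ENNReal.tsum_mul_left]
  refine ENNReal.tsum_le_tsum fun n => ?_
  rw [h1]
  gcongr
  · linarith
  · exact ENNReal.le_tsum n

/-- Explicit data of an atom. -/
structure AtomData (a : ℝ → ℝ) (c r : ℝ) : Prop where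
  meas : Measurable a
  rpos : 0 < r
  supp : ∀ x, x ∉ Set.Icc (c - r) (c + r) → a x = 0
  bdd : ∀ x, |a x| ≤ (2 * r)⁻¹
  int0 : (∫ x : ℝ, a x) = 0

lemma AtomData.enorm_le {a : ℝ → ℝ} {c r : ℝ} (h : AtomData a c r) :
    ∫⁻ x, ‖a x‖ₑ ≤ 1 := by
  have hr := h.rpos
  calc ∫⁻ x, ‖a x‖ₑ ≤ ∫⁻ x, (Set.Icc (c-r) (c+r)).indicator
        (fun _ => ENNReal.ofReal (2*r)⁻¹) x := by
        refine lintegral_mono fun x => ?_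
        by_cases hx : x ∈ Set.Icc (c-r) (c+r)
        · rw [Set.indicator_of_mem hx, Real.enorm_eq_ofReal_abs]
          exact ENNReal.ofReal_le_ofReal (h.bdd x)
        · simp [h.supp x hx]
    _ = 1 := by
        rw [lintegral_indicator_const measurableSet_Icc, Real.volume_Icc,
          ← ENNReal.ofReal_mul (by positivity)]
        rw [show (2*r)⁻¹ * (c + r - (c - r)) = 1 by field_simp; ring]
        simp

lemma AtomData.integrable {a : ℝ → ℝ} {c r : ℝ} (h : AtomData a c r) : Integrable a :=
  ⟨h.meas.aestronglyMeasurable, h.enorm_le.trans_lt (by simp)⟩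

lemma AtomData.continuous {a : ℝ → ℝ} {c r : ℝ} (h : AtomData a c r) (n : ℤ) :
    Continuous (Aop n a) := by
  have hp : Continuous (fun x => ∫ y in (0:ℝ)..x, a y) :=
    intervalIntegral.continuous_primitive (fun _ _ => h.integrable.intervalIntegrable) 0
  have : Aop n a = fun x => ((2:ℝ)^n)⁻¹ *
      ((∫ y in (0:ℝ)..(x + (2:ℝ)^n), a y) - ∫ y in (0:ℝ)..x, a y) := by
    ext x
    unfold Aop
    rw [intervalIntegral.integral_interval_sub_left] <;> exact h.integrable.intervalIntegrable
  rw [this]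
  exact continuous_const.mul ((hp.comp (continuous_id.add continuous_const)).sub hp)

lemma AtomData.abs_int_le {a : ℝ → ℝ} {c r : ℝ} (h : AtomData a c r) (x y : ℝ) (hxy : x ≤ y) :
    |∫ t in x..y, a t| ≤ 1 := by
  rw [intervalIntegral.integral_of_le hxy]
  refine (norm_integral_le_lintegral_norm (G := ℝ) _).trans ?_
  refine ENNReal.toReal_le_of_le_ofReal zero_le_one ?_
  rw [ENNReal.ofReal_one]
  refine le_trans ?_ h.enorm_le
  refine (setLIntegral_le_lintegral _ _).trans (le_of_eq ?_)
  simp only [ofReal_norm]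

lemma AtomData.abs_A_le {a : ℝ → ℝ} {c r : ℝ} (h : AtomData a c r) (n : ℤ) (x : ℝ) :
    |Aop n a x| ≤ ((2:ℝ)^n)⁻¹ := by
  have h2 : (0:ℝ) < 2^n := by positivity
  unfold Aop
  rw [abs_mul, abs_of_pos (inv_pos.2 h2)]
  have := h.abs_int_le x (x+2^n) (by linarith)
  exact mul_le_of_le_one_right (inv_pos.2 h2).le this

lemma AtomData.abs_A_le' {a : ℝ → ℝ} {c r : ℝ} (h : AtomData a c r) (n : ℤ) (x : ℝ) :
    |Aop n a x| ≤ (2*r)⁻¹ := by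
  have h2 : (0:ℝ) < 2^n := by positivity
  unfold Aop
  rw [abs_mul, abs_of_pos (inv_pos.2 h2)]
  have := intervalIntegral.norm_integral_le_of_norm_le_const (a := x) (b := x+2^n) (f := a)
    (C := (2*r)⁻¹) (fun t _ => h.bdd t)
  rw [show x + (2:ℝ)^n - x = 2^n by ring, abs_of_pos h2, Real.norm_eq_abs] at this
  rw [inv_mul_le_iff₀ h2]
  linarith

lemma AtomData.A_zero {a : ℝ → ℝ} {c r : ℝ} (h : AtomData a c r) (n : ℤ) (x : ℝ)
    (hx : c + r < x ∨ x + 2^n < c - r) : Aop n a x = 0 := by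
  have h2 : (0:ℝ) < 2^n := by positivity
  unfold Aop
  rw [intervalIntegral.integral_zero_ae, mul_zero]
  refine Filter.Eventually.of_forall fun t ht => h.supp t fun ht' => ?_
  rw [uIoc_of_le (by linarith)] at ht
  rcases hx with hx | hx
  · linarith [ht.1, ht'.2]
  · linarith [ht.2, ht'.1]

lemma AtomData.A_zero' {a : ℝ → ℝ} {c r : ℝ} (h : AtomData a c r) (n : ℤ) (x : ℝ)
    (hx : x < c - r) (hx' : c + r < x + 2^n) : Aop n a x = 0 := by
  have h2 : (0:ℝ) < 2^n := by positivity
  unfold Aop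
  rw [intervalIntegral.integral_eq_integral_of_support_subset, h.int0, mul_zero]
  intro t ht
  by_contra hc
  refine ht (h.supp t fun ht' => hc ⟨by linarith [ht'.1], by linarith [ht'.2]⟩)

lemma AtomData.A_split {a : ℝ → ℝ} {c r : ℝ} (h : AtomData a c r) (n : ℤ) (x : ℝ) :
    Aop n a x = (Aop (n-1) a x + Aop (n-1) a (x + 2^(n-1))) / 2 := by
  have h2 : (0:ℝ) < 2^(n-1) := by positivity
  unfold Aop
  rw [two_zpow_pred n]
  rw [← intervalIntegral.integral_add_adjacent_intervals (b := x + 2^(n-1))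
    h.integrable.intervalIntegrable h.integrable.intervalIntegrable]
  rw [show x + 2^(n-1) + (2:ℝ)^(n-1) = x + 2 * 2^(n-1) by ring]
  field_simp

/-- The energy of the `n`-th average. -/
noncomputable def En (a : ℝ → ℝ) (n : ℤ) : ENNReal := ∫⁻ x, ENNReal.ofReal ((Aop n a x)^2)

/-- The energy of the `n`-th difference. -/
noncomputable def Dn (a : ℝ → ℝ) (n : ℤ) : ENNReal := ∫⁻ x, ENNReal.ofReal ((Dop n a x)^2)

lemma AtomData.continuousD {a : ℝ → ℝ} {c r : ℝ} (h : AtomData a c r) (n : ℤ) :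
    Continuous (Dop n a) := (h.continuous n).sub (h.continuous (n-1))

lemma AtomData.energy_step {a : ℝ → ℝ} {c r : ℝ} (h : AtomData a c r) (n : ℤ) :
    En a n + Dn a n = En a (n-1) := by
  have hm : ∀ k, Measurable fun x => ENNReal.ofReal ((Aop k a x)^2) := fun k =>
    (((h.continuous k).pow 2).measurable).ennreal_ofReal
  have hmd : ∀ k, Measurable fun x => ENNReal.ofReal ((Dop k a x)^2) := fun k =>
    (((h.continuousD k).pow 2).measurable).ennreal_ofReal
  have h1 : ∫⁻ x, ENNReal.ofReal ((Aop (n-1) a (x + 2^(n-1)))^2) = En a (n-1) :=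
    lintegral_add_right_eq_self (fun x => ENNReal.ofReal ((Aop (n-1) a x)^2)) _
  have h2 : 2 * (En a n + Dn a n) = 2 * En a (n-1) := by
    conv_rhs => rw [two_mul]
    nth_rewrite 2 [← h1]
    unfold En Dn
    rw [← lintegral_add_left (hm n), ← lintegral_add_left (hm (n-1)),
      ← lintegral_const_mul' _ _ (by norm_num)]
    refine lintegral_congr fun x => ?_
    rw [← ENNReal.ofReal_add (by positivity) (by positivity),
      ← ENNReal.ofReal_add (by positivity) (by positivity),
      ← ENNReal.ofReal_ofNat 2, ← ENNReal.ofReal_mul (by norm_num)]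
    congr 1
    unfold Dop
    rw [h.A_split n x]
    ring
  exact (ENNReal.mul_right_inj (by norm_num) (by norm_num)).1 h2

lemma AtomData.energy_sum {a : ℝ → ℝ} {c r : ℝ} (h : AtomData a c r) (m : ℤ) (N : ℕ) :
    En a (m + N) + ∑ n ∈ Finset.Ioc m (m+N), Dn a n = En a m := by
  induction N with
  | zero => simp
  | succ N ih =>
    have : Finset.Ioc m (m + ((N+1 : ℕ) : ℤ)) = insert (m + N + 1) (Finset.Ioc m (m+N)) := by
      ext k; simp only [Finset.mem_Ioc, Finset.mem_insert]; push_cast; omega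
    rw [this, Finset.sum_insert (by simp), ← add_assoc]
    have h2 := h.energy_step (m + N + 1)
    rw [add_sub_cancel_right] at h2
    rw [show m + ((N+1 : ℕ) : ℤ) = m + N + 1 by push_cast; ring, h2, ih]

lemma AtomData.En_le {a : ℝ → ℝ} {c r : ℝ} (h : AtomData a c r) (m : ℤ) (hm : (2:ℝ)^m ≤ r) :
    En a m ≤ ENNReal.ofReal r⁻¹ := by
  have hr := h.rpos
  unfold En
  calc ∫⁻ x, ENNReal.ofReal ((Aop m a x)^2)
      ≤ ∫⁻ x, (Set.Icc (c-2*r) (c+r)).indicator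
        (fun _ => ENNReal.ofReal ((2*r)⁻¹^2)) x := by
        refine lintegral_mono fun x => ?_
        by_cases hx : x ∈ Set.Icc (c-2*r) (c+r)
        · rw [Set.indicator_of_mem hx]
          apply ENNReal.ofReal_le_ofReal
          rw [← sq_abs]
          exact pow_le_pow_left₀ (abs_nonneg _) (h.abs_A_le' m x) 2
        · rw [h.A_zero m x]
          · simp
          · by_contra! hc
            exact hx ⟨by linarith [hc.2], hc.1⟩
    _ ≤ ENNReal.ofReal r⁻¹ := by
        rw [lintegral_indicator_const measurableSet_Icc, Real.volume_Icc,
          ← ENNReal.ofReal_mul (by positivity)]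
        apply ENNReal.ofReal_le_ofReal
        rw [show (2*r)⁻¹^2 * (c + r - (c - 2*r)) = 3/4 * r⁻¹ by field_simp; ring]
        have := inv_pos.2 hr
        linarith

lemma AtomData.energy {a : ℝ → ℝ} {c r : ℝ} (h : AtomData a c r) :
    ∑' n, Dn a n ≤ ENNReal.ofReal r⁻¹ := by
  have hr := h.rpos
  rw [ENNReal.tsum_eq_iSup_sum]
  refine iSup_le fun F => ?_
  obtain ⟨k, hk⟩ := exists_mem_Ioc_zpow hr (one_lt_two)
  obtain ⟨l, hl⟩ := F.bddBelow
  obtain ⟨u, hu⟩ := F.bddAbove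
  set m := min k (l-1) with hmdef
  have hm : (2:ℝ)^m ≤ r :=
    (zpow_le_zpow_right₀ one_le_two (min_le_left _ _)).trans hk.1.le
  refine le_trans ?_ (h.En_le m hm)
  rw [← h.energy_sum m (u - m).toNat]
  refine le_trans (Finset.sum_le_sum_of_subset ?_) le_add_self
  intro n hn
  have h1 := hl hn
  have h2 := hu hn
  rw [Finset.mem_Ioc]
  omega

lemma AtomData.measurable_W {a : ℝ → ℝ} {c r : ℝ} (h : AtomData a c r) (s : ℝ) :
    Measurable (Wop s a) := by
  unfold Wop
  refine Measurable.pow_const ?_ _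
  refine Measurable.tsum fun n => ?_
  exact ((h.continuousD n).measurable.enorm).pow_const _

lemma rpow_le_one_add (t : ℝ) (ht0 : 0 ≤ t) (ht : t ≤ 1) (y : ENNReal) : y ^ t ≤ 1 + y := by
  rcases le_total y 1 with hy | hy
  · exact (ENNReal.rpow_le_one hy ht0).trans le_self_add
  · refine le_trans ?_ le_add_self
    conv_rhs => rw [← ENNReal.rpow_one y]
    exact ENNReal.rpow_le_rpow_of_exponent_le hy ht

lemma AtomData.local_pt {a : ℝ → ℝ} {c r : ℝ} (h : AtomData a c r) (s : ℝ) (hs : 2 ≤ s) (x : ℝ) :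
    Wop s a x ≤ ENNReal.ofReal r⁻¹ * (1 + ENNReal.ofReal (r^2) *
      ∑' n, ENNReal.ofReal ((Dop n a x)^2)) := by
  have hr := h.rpos
  have hs0 : 0 < s := by linarith
  have hd : ∀ n, |Dop n a x| ≤ r⁻¹ := by
    intro n
    have h1 := h.abs_A_le' n x
    have h2 := h.abs_A_le' (n-1) x
    have h3 : (2*r)⁻¹ + (2*r)⁻¹ = r⁻¹ := by field_simp; norm_num
    unfold Dop
    exact (abs_sub _ _).trans (by linarith)
  have h1 : ∀ n, ‖Dop n a x‖ₑ ^ s ≤ (ENNReal.ofReal r⁻¹)^s *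
      (ENNReal.ofReal (r^2) * ENNReal.ofReal ((Dop n a x)^2)) := by
    intro n
    rw [Real.enorm_eq_ofReal_abs, ENNReal.ofReal_rpow_of_nonneg (abs_nonneg _) hs0.le,
      ENNReal.ofReal_rpow_of_nonneg (by positivity) hs0.le, ← ENNReal.ofReal_mul (by positivity),
      ← ENNReal.ofReal_mul (by positivity)]
    apply ENNReal.ofReal_le_ofReal
    have e : |Dop n a x| = r⁻¹ * (r * |Dop n a x|) := by field_simp
    have hle : r * |Dop n a x| ≤ 1 := by
      have := mul_le_mul_of_nonneg_left (hd n) hr.le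
      rwa [mul_inv_cancel₀ hr.ne'] at this
    conv_lhs => rw [e]
    rw [Real.mul_rpow (by positivity) (by positivity)]
    gcongr
    rw [← sq_abs (Dop n a x), ← mul_pow, ← Real.rpow_two]
    rcases eq_or_lt_of_le (show 0 ≤ r * |Dop n a x| by positivity) with h0 | h0
    · rw [← h0, Real.zero_rpow hs0.ne', Real.zero_rpow (by norm_num)]
    · exact Real.rpow_le_rpow_of_exponent_ge h0 hle hs
  unfold Wop
  calc _ ≤ (∑' n, (ENNReal.ofReal r⁻¹)^s *
      (ENNReal.ofReal (r^2) * ENNReal.ofReal ((Dop n a x)^2))) ^ (1/s) := by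
        gcongr with n
        exact h1 n
    _ = ENNReal.ofReal r⁻¹ * (ENNReal.ofReal (r^2) *
      ∑' n, ENNReal.ofReal ((Dop n a x)^2)) ^ (1/s) := by
        rw [ENNReal.tsum_mul_left, ENNReal.tsum_mul_left, ENNReal.mul_rpow_of_nonneg _ _
          (by positivity), ← ENNReal.rpow_mul, mul_one_div_cancel hs0.ne', ENNReal.rpow_one]
    _ ≤ _ := by
        gcongr
        exact rpow_le_one_add _ (by positivity) (by rw [div_le_one hs0]; linarith) _

lemma AtomData.local_int {a : ℝ → ℝ} {c r : ℝ} (h : AtomData a c r) (s : ℝ) (hs : 2 ≤ s) :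
    ∫⁻ x in Set.Icc (c-4*r) (c+r), Wop s a x ≤ 6 := by
  have hr := h.rpos
  have hmd : ∀ k, Measurable fun x => ENNReal.ofReal ((Dop k a x)^2) := fun k =>
    (((h.continuousD k).pow 2).measurable).ennreal_ofReal
  have hms : Measurable fun x => ∑' n, ENNReal.ofReal ((Dop n a x)^2) := Measurable.tsum hmd
  calc _ ≤ ∫⁻ x in Set.Icc (c-4*r) (c+r), ENNReal.ofReal r⁻¹ * (1 + ENNReal.ofReal (r^2) *
      ∑' n, ENNReal.ofReal ((Dop n a x)^2)) := lintegral_mono fun x => h.local_pt s hs x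
    _ = ENNReal.ofReal r⁻¹ * (ENNReal.ofReal (5*r) + ENNReal.ofReal (r^2) *
        ∫⁻ x in Set.Icc (c-4*r) (c+r), ∑' n, ENNReal.ofReal ((Dop n a x)^2)) := by
        rw [lintegral_const_mul _ (by fun_prop), lintegral_add_left (by fun_prop),
          lintegral_const_mul _ hms, setLIntegral_one, Real.volume_Icc]
        congr 4
        ring
    _ ≤ ENNReal.ofReal r⁻¹ * (ENNReal.ofReal (5*r) + ENNReal.ofReal (r^2) *
        ENNReal.ofReal r⁻¹) := by
        gcongr
        refine (setLIntegral_le_lintegral _ _).trans ?_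
        rw [lintegral_tsum fun n => (hmd n).aemeasurable]
        exact h.energy
    _ = 6 := by
        rw [← ENNReal.ofReal_mul (by positivity), ← ENNReal.ofReal_add (by positivity)
          (by positivity), ← ENNReal.ofReal_mul (by positivity)]
        rw [show r⁻¹ * (5*r + r^2 * r⁻¹) = 6 by field_simp; norm_num]
        simp

lemma AtomData.far_A {a : ℝ → ℝ} {c r : ℝ} (h : AtomData a c r) (n k : ℤ)
    (hk : r ∈ Set.Ioc ((2:ℝ)^k) (2^(k+1))) :
    ∫⁻ x in (Set.Icc (c-4*r) (c+r))ᶜ, ‖Aop n a x‖ₑ ≤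
      if k < n then ENNReal.ofReal (2*r*((2:ℝ)^n)⁻¹) else 0 := by
  have hr := h.rpos
  have h2 : (0:ℝ) < 2^n := by positivity
  split_ifs with hkn
  · calc _ ≤ ∫⁻ x in (Set.Icc (c-4*r) (c+r))ᶜ, (Set.Icc (c-r-2^n) (c+r-2^n)).indicator
          (fun _ => ENNReal.ofReal ((2:ℝ)^n)⁻¹) x := by
          refine setLIntegral_mono' measurableSet_Icc.compl fun x hx => ?_
          by_cases hx' : x ∈ Set.Icc (c-r-2^n) (c+r-2^n)
          · rw [Set.indicator_of_mem hx', Real.enorm_eq_ofReal_abs]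
            exact ENNReal.ofReal_le_ofReal (h.abs_A_le n x)
          · suffices Aop n a x = 0 by simp [this]
            by_cases h3 : c + r < x ∨ x + 2^n < c - r
            · exact h.A_zero n x h3
            · push Not at h3
              have h4 : x < c - 4 * r := by
                by_contra! h5; exact hx ⟨h5, h3.1⟩
              refine h.A_zero' n x (by linarith) ?_
              by_contra! h5
              exact hx' ⟨by linarith [h3.2], by linarith⟩
      _ ≤ _ := by
          refine (setLIntegral_le_lintegral _ _).trans ?_
          rw [lintegral_indicator_const measurableSet_Icc, Real.volume_Icc,
            ← ENNReal.ofReal_mul (by positivity)]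
          apply ENNReal.ofReal_le_ofReal
          apply le_of_eq
          ring
  · have h6 : (2:ℝ)^n ≤ r := (zpow_le_zpow_right₀ one_le_two (not_lt.1 hkn)).trans hk.1.le
    rw [nonpos_iff_eq_zero, setLIntegral_congr_fun (g := fun _ => 0) measurableSet_Icc.compl]
    · simp
    · intro x hx
      suffices Aop n a x = 0 by simp [this]
      apply h.A_zero
      by_contra! h5
      exact hx ⟨by linarith [h5.2], h5.1⟩

lemma sum_far (k : ℤ) (r : ℝ) (hr : 0 < r) (hk : r ∈ Set.Ioc ((2:ℝ)^k) (2^(k+1))) :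
    ∑' n : ℤ, (if k < n then ENNReal.ofReal (2*r*((2:ℝ)^n)⁻¹) else 0) ≤ 4 := by
  have hinj : Function.Injective (fun m : ℕ => k + 1 + (m:ℤ)) := by
    intro a b hab; simpa using hab
  rw [← hinj.tsum_eq]
  · calc _ ≤ ∑' m : ℕ, ENNReal.ofReal (2 * (1/2)^m) := by
          refine ENNReal.tsum_le_tsum fun m => ?_
          rw [if_pos (by omega)]
          apply ENNReal.ofReal_le_ofReal
          rw [zpow_add₀ (by norm_num), zpow_natCast, mul_inv, one_div, inv_pow]
          have : r * ((2:ℝ)^(k+1))⁻¹ ≤ 1 := by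
            rw [← div_eq_mul_inv, div_le_one (by positivity)]; exact hk.2
          have h3 : (0:ℝ) < ((2:ℝ)^m)⁻¹ := by positivity
          nlinarith
      _ = 4 := by
          rw [← ENNReal.ofReal_tsum_of_nonneg (fun m => by positivity)
            (summable_geometric_two.mul_left 2), tsum_mul_left, tsum_geometric_two]
          norm_num
  · intro n hn
    have : k < n := by
      by_contra h; simp [h] at hn
    exact ⟨(n - (k+1)).toNat, by simp only []; omega⟩

lemma AtomData.far_int {a : ℝ → ℝ} {c r : ℝ} (h : AtomData a c r) (s : ℝ) (hs : 2 ≤ s) :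
    ∫⁻ x in (Set.Icc (c-4*r) (c+r))ᶜ, Wop s a x ≤ 8 := by
  have hr := h.rpos
  obtain ⟨k, hk⟩ := exists_mem_Ioc_zpow hr (one_lt_two)
  have hm : ∀ n, Measurable fun x => ‖Aop n a x‖ₑ := fun n => (h.continuous n).measurable.enorm
  calc _ ≤ ∫⁻ x in (Set.Icc (c-4*r) (c+r))ᶜ, ∑' n : ℤ, (‖Aop n a x‖ₑ + ‖Aop (n-1) a x‖ₑ) := by
        refine lintegral_mono fun x => ?_
        refine (l1_bound s hs _).trans ?_
        exact ENNReal.tsum_le_tsum fun n => enorm_sub_le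
    _ = (∑' n : ℤ, ∫⁻ x in (Set.Icc (c-4*r) (c+r))ᶜ, ‖Aop n a x‖ₑ) +
        (∑' n : ℤ, ∫⁻ x in (Set.Icc (c-4*r) (c+r))ᶜ, ‖Aop (n-1) a x‖ₑ) := by
        rw [lintegral_tsum fun n => (show Measurable fun x => ‖Aop n a x‖ₑ + ‖Aop (n-1) a x‖ₑ from
          (hm n).add (hm (n-1))).aemeasurable, ← ENNReal.tsum_add]
        refine tsum_congr fun n => ?_
        exact lintegral_add_left (hm n) _
    _ = (∑' n : ℤ, ∫⁻ x in (Set.Icc (c-4*r) (c+r))ᶜ, ‖Aop n a x‖ₑ) +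
        (∑' n : ℤ, ∫⁻ x in (Set.Icc (c-4*r) (c+r))ᶜ, ‖Aop n a x‖ₑ) := by
        congr 1
        exact (Equiv.subRight (1:ℤ)).tsum_eq
          (fun n => ∫⁻ x in (Set.Icc (c-4*r) (c+r))ᶜ, ‖Aop n a x‖ₑ)
    _ ≤ 4 + 4 := by
        have : (∑' n : ℤ, ∫⁻ x in (Set.Icc (c-4*r) (c+r))ᶜ, ‖Aop n a x‖ₑ) ≤ 4 :=
          (ENNReal.tsum_le_tsum fun n => h.far_A n k hk).trans (sum_far k r hr hk)
        gcongr
    _ = 8 := by norm_num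

lemma AtomData.int_W {a : ℝ → ℝ} {c r : ℝ} (h : AtomData a c r) (s : ℝ) (hs : 2 ≤ s) :
    ∫⁻ x, Wop s a x ≤ 14 := by
  rw [← lintegral_add_compl _ (measurableSet_Icc (a := c-4*r) (b := c+r))]
  refine (add_le_add (h.local_int s hs) (h.far_int s hs)).trans ?_
  norm_num

lemma Dop_le (f : ℝ → ℝ) (c : ℕ → ℝ) (a : ℕ → ℝ → ℝ) (ctr rad : ℕ → ℝ)
    (h : ∀ j, AtomData (a j) (ctr j) (rad j)) (hc : Summable (fun j => |c j|))
    (hf : ∀ x, f x = ∑' j : ℕ, c j * a j x) (n : ℤ) (x : ℝ) :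
    ‖Dop n f x‖ₑ ≤ ∑' j, ‖c j‖ₑ * ‖Dop n (a j) x‖ₑ := by
  have hfin : ∑' j, ‖c j‖ₑ ≠ ⊤ := by
    simp only [Real.enorm_eq_ofReal_abs]
    exact hc.tsum_ofReal_ne_top
  have hA : ∀ k, Aop k f x = ∑' j, c j * Aop k (a j) x := by
    intro k
    have h2 : (0:ℝ) < 2^k := by positivity
    unfold Aop
    rw [intervalIntegral.integral_of_le (by linarith), funext hf, integral_tsum, ← tsum_mul_left]
    · refine tsum_congr fun j => ?_
      rw [integral_const_mul, intervalIntegral.integral_of_le (by linarith)]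
      ring
    · exact fun j => ((h j).meas.const_mul _).aestronglyMeasurable
    · refine ne_top_of_le_ne_top hfin (ENNReal.tsum_le_tsum fun j => ?_)
      simp only [enorm_mul]
      rw [lintegral_const_mul _ (h j).meas.enorm]
      refine mul_le_of_le_one_right (by simp) ?_
      exact (setLIntegral_le_lintegral _ _).trans (h j).enorm_le
  have hS : ∀ k, Summable fun j => c j * Aop k (a j) x := by
    intro k
    refine Summable.of_norm_bounded (hc.mul_right ((2:ℝ)^k)⁻¹) fun j => ?_
    rw [Real.norm_eq_abs, abs_mul]
    exact mul_le_mul_of_nonneg_left ((h j).abs_A_le k x) (abs_nonneg _)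
  have hD : Dop n f x = ∑' j, c j * Dop n (a j) x := by
    unfold Dop
    rw [hA, hA, ← (hS n).tsum_sub (hS (n-1))]
    exact tsum_congr fun j => by ring
  rw [hD]
  refine (enorm_tsum_le_tsum_enorm).trans (le_of_eq ?_)
  simp only [enorm_mul]

/-- `V` maps `H¹(ℝ)` (defined via atomic decomposition) to `L¹(ℝ)`:
for every atomic decomposition `f = ∑ c_j a_j`, `‖V f‖₁ ≤ C ∑ |c_j|`. -/
theorem stmt8 (s : ℝ) (hs : 2 ≤ s) :
    ∃ C > 0, ∀ (f : ℝ → ℝ) (c : ℕ → ℝ) (a : ℕ → ℝ → ℝ),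
      (∀ j, IsH1Atom (a j)) → Summable (fun j => |c j|) →
      (∀ x, f x = ∑' j : ℕ, c j * a j x) →
      ∫⁻ x : ℝ, ENNReal.ofReal (Vop s f x)
        ≤ ENNReal.ofReal (C * ∑' j : ℕ, |c j|) := by
  refine ⟨14, by norm_num, fun f c a ha hc hf => ?_⟩
  have hs0 : 0 < s := by linarith
  have h' : ∀ j, ∃ ct r, AtomData (a j) ct r := by
    intro j
    obtain ⟨hm, ct, r, h1, h2, h3, h4⟩ := ha j
    exact ⟨ct, r, hm, h1, h2, h3, h4⟩
  choose ctr rad h using h'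
  have hpt : ∀ x, ENNReal.ofReal (Vop s f x) ≤ ∑' j, ‖c j‖ₑ * Wop s (a j) x := by
    intro x
    refine (Vop_le_Wop s hs f x).trans ?_
    calc Wop s f x ≤ (∑' n, (∑' j, ‖c j‖ₑ * ‖Dop n (a j) x‖ₑ) ^ s) ^ (1/s) := by
          unfold Wop
          gcongr with n
          exact Dop_le f c a ctr rad h hc hf n x
      _ ≤ _ := Lp_tsum_le s hs (fun j n => ‖c j‖ₑ * ‖Dop n (a j) x‖ₑ)
      _ = _ := by
          refine tsum_congr fun j => ?_
          unfold Wop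
          simp only [ENNReal.mul_rpow_of_nonneg _ _ hs0.le]
          rw [ENNReal.tsum_mul_left, ENNReal.mul_rpow_of_nonneg _ _ (by positivity),
            ← ENNReal.rpow_mul, mul_one_div_cancel hs0.ne', ENNReal.rpow_one]
  refine (lintegral_mono hpt).trans ?_
  rw [lintegral_tsum fun j => (((h j).measurable_W s).const_mul _).aemeasurable]
  calc _ ≤ ∑' j, ‖c j‖ₑ * 14 := by
        refine ENNReal.tsum_le_tsum fun j => ?_
        rw [lintegral_const_mul _ ((h j).measurable_W s)]
        gcongr
        exact (h j).int_W s hs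
    _ = _ := by
        rw [ENNReal.tsum_mul_right, mul_comm, ENNReal.ofReal_mul (by norm_num),
          ENNReal.ofReal_tsum_of_nonneg (fun j => abs_nonneg _) hc]
        simp [Real.enorm_eq_ofReal_abs]
end

section
/- Fix 2 ≤ s < ∞ and let V f(x) = (∑_{n∈ℤ} |A_n f(x) − A_{n-1} f(x)|^s)^{1/s} with A_n f(x) = 2^{-n} ∫_x^{x+2^n} f(y) dy. If w is a positive weight with w^{r'} ∈ A_1 for some 1 < r < ∞ (r' the conjugate exponent of r), then there exists C > 0 such that for all λ > 0 and all f, w({x : V f(x) > λ}) ≤ (C/λ) ∫_ℝ |f(x)| w(x) dx, where w(E) = ∫_E w. -/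
open MeasureTheory Set Real

/-- `w` is an `A₁` weight on `ℝ`. -/
def IsA1Weight (w : ℝ → ℝ) : Prop :=
  (∀ x, 0 < w x) ∧ LocallyIntegrable w volume ∧
  ∃ C > 0, ∀ a b : ℝ, a < b →
    ∀ᵐ x : ℝ, x ∈ Set.Icc a b →
      (b - a)⁻¹ * ∫ t in a..b, w t ≤ C * w x

open scoped ENNReal Topology

namespace VarW

/-- index of the dyadic cell of length `2^j` containing `x` -/
noncomputable def idx (j : ℤ) (x : ℝ) : ℤ := ⌊x / (2:ℝ)^j⌋

def cell (j m : ℤ) : Set ℝ := Ico ((m:ℝ) * 2^j) (((m:ℝ)+1) * 2^j)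
def cell2 (j m : ℤ) : Set ℝ := Ico (((m:ℝ)-1) * 2^j) (((m:ℝ)+1) * 2^j)

noncomputable def V (j : ℤ) : ℝ≥0∞ := ENNReal.ofReal ((2:ℝ)^j)

lemma p2 (j : ℤ) : (0:ℝ) < (2:ℝ)^j := by positivity

lemma p2_succ (j : ℤ) : (2:ℝ)^(j+1) = 2 * (2:ℝ)^j := by
  rw [zpow_add₀ (by norm_num)]; simp [mul_comm]

lemma p2_add (j : ℤ) (n : ℕ) : (2:ℝ)^(j+n) = (2:ℝ)^j * 2^n := by
  rw [zpow_add₀ (by norm_num)]; simp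

lemma V_ne_zero (j : ℤ) : V j ≠ 0 := by
  simp [V, p2 j]

lemma V_ne_top (j : ℤ) : V j ≠ ∞ := by simp [V]

lemma V_add (j : ℤ) (n : ℕ) : V (j+n) = V j * 2^n := by
  unfold V
  rw [p2_add, ENNReal.ofReal_mul (p2 j).le, ENNReal.ofReal_pow (by norm_num)]; simp

lemma V_succ (j : ℤ) : V (j+1) = 2 * V j := by
  unfold V
  rw [p2_succ, ENNReal.ofReal_mul (by norm_num)]; simp

lemma mem_cell {j m : ℤ} {x : ℝ} : x ∈ cell j m ↔ idx j x = m := by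
  unfold cell idx
  rw [Int.floor_eq_iff, mem_Ico, le_div_iff₀ (p2 j), div_lt_iff₀ (p2 j)]

lemma mem_cell_idx (j : ℤ) (x : ℝ) : x ∈ cell j (idx j x) := mem_cell.2 rfl

lemma measurableSet_cell (j m : ℤ) : MeasurableSet (cell j m) := measurableSet_Ico
lemma measurableSet_cell2 (j m : ℤ) : MeasurableSet (cell2 j m) := measurableSet_Ico

lemma measurable_idx (j : ℤ) : Measurable (idx j) :=
  Int.measurable_floor.comp (measurable_id.div_const _)

lemma cell_sub_cell2 (j m : ℤ) : cell j m ⊆ cell2 j m := by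
  apply Ico_subset_Ico _ le_rfl
  have := p2 j
  nlinarith

lemma volume_cell (j m : ℤ) : volume (cell j m) = V j := by
  unfold cell V
  rw [Real.volume_Ico]; congr 1; ring

lemma idx_add (j : ℤ) (n : ℕ) (x : ℝ) : idx (j+n) x = idx j x / 2^n := by
  have h := @mem_cell_idx j x
  rw [← mem_cell]
  unfold cell at *
  set m := idx j x
  have e := Int.mul_ediv_add_emod m (2^n)
  have e1 := Int.emod_nonneg m (b := 2^n) (by positivity)
  have e2 := Int.emod_lt_of_pos m (b := 2^n) (by positivity)
  set q := m / 2^n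
  have f1 : q * 2^n ≤ m := by linarith
  have f2 : m + 1 ≤ (q + 1) * 2^n := by linarith
  have f1' : (q:ℝ) * 2^n ≤ m := by exact_mod_cast f1
  have f2' : (m:ℝ) + 1 ≤ (q + 1) * 2^n := by exact_mod_cast f2
  rw [p2_add]
  have := p2 j
  constructor
  · have := h.1
    nlinarith
  · have := h.2
    nlinarith

lemma idx_left (j m : ℤ) : idx j ((m:ℝ) * 2^j) = m := by
  unfold idx
  rw [mul_div_cancel_right₀ _ (p2 j).ne']; simp

lemma idx_shift (j : ℤ) (x : ℝ) : idx j (x + 2^j) = idx j x + 1 := by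
  unfold idx
  rw [add_div, div_self (p2 j).ne']; simp

lemma cell_subset (j m : ℤ) (n : ℕ) : cell j m ⊆ cell (j+n) (m / 2^n) := by
  intro x hx
  rw [mem_cell] at *
  rw [idx_add, hx]

/-- if `x` is in cell `(i,p)` then `x - 2^(i+n)` is in the double of the ancestor -/
lemma sub_mem_cell2 (i p : ℤ) (n : ℕ) (x : ℝ) (h : x + 2^(i+n) ∈ cell i p) :
    x ∈ cell2 (i+n) (p / 2^n) := by
  have h := cell_subset i p n h
  unfold cell cell2 at *
  have := p2 (i+n)
  constructor
  · have := h.1; linarith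
  · have := h.2; linarith

lemma lintegral_cells (μ : Measure ℝ) (j : ℤ) (F : ℝ → ℝ≥0∞) :
    ∫⁻ x, F x ∂μ = ∑' m, ∫⁻ x in cell j m, F x ∂μ := by
  rw [← lintegral_iUnion (fun m => measurableSet_cell j m)]
  · have : (⋃ m, cell j m) = univ := by
      ext x; simp only [mem_iUnion, mem_univ, iff_true]; exact ⟨_, mem_cell_idx j x⟩
    rw [this]; simp
  · intro a b hab
    rw [Function.onFun, Set.disjoint_left]
    intro x hx hx'
    rw [mem_cell] at *
    exact hab (hx.symm.trans hx')

lemma tsum_even_odd (F : ℤ → ℝ≥0∞) : ∑' m, F m = ∑' m, (F (2*m) + F (2*m+1)) := by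
  have h1 : Function.Injective (fun m : ℤ => 2*m) := fun a b h => by simpa using h
  have h2 : Function.Injective (fun m : ℤ => 2*m+1) := fun a b h => by simpa using h
  have hc : IsCompl (Set.range (fun m : ℤ => 2*m)) (Set.range (fun m : ℤ => 2*m+1)) := by
    constructor
    · rw [Set.disjoint_left]; rintro x ⟨a, rfl⟩ ⟨b, hb⟩; simp only at hb; omega
    · rw [codisjoint_iff_le_sup]
      intro x _
      rcases Int.even_or_odd' x with ⟨k, hk | hk⟩
      · left; exact ⟨k, hk.symm⟩
      · right; exact ⟨k, hk.symm⟩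
  have a1 : HasSum (F ∘ ((↑) : Set.range (fun m : ℤ => 2*m) → ℤ)) (∑' m, F (2*m)) :=
    (h1.hasSum_range_iff).2 ENNReal.summable.hasSum
  have a2 : HasSum (F ∘ ((↑) : Set.range (fun m : ℤ => 2*m+1) → ℤ)) (∑' m, F (2*m+1)) :=
    (h2.hasSum_range_iff).2 ENNReal.summable.hasSum
  have := a1.add_isCompl hc a2
  rw [this.tsum_eq, ENNReal.tsum_add]

structure WD (μ : Measure ℝ) (c : ℤ → ℤ → ℝ≥0∞) (K Q : ℝ≥0∞) : Prop where
  hK : K ≠ ∞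
  hQ0 : Q ≠ 0
  hQ : Q < 1
  h1 : ∀ j m (F : ℝ → ℝ≥0∞), Measurable F →
    c j m * ∫⁻ x in cell j m, F x ≤ K * ∫⁻ x in cell j m, F x ∂μ
  h2 : ∀ j m (n : ℕ) (S : Set ℝ), MeasurableSet S → S ⊆ cell2 (j+n) m → volume S ≤ V j →
    μ S ≤ 2 * V (j+n) * Q^n * c (j+n) m
  h3 : ∀ j m, μ (cell2 j m) ≤ 2 * V j * c j m
  h4 : ∀ j m, μ (cell j m) ≠ 0

/-- the increasing process -/
noncomputable def U (c : ℤ → ℤ → ℝ≥0∞) (j m : ℤ) : ℝ≥0∞ := ⨆ n : ℕ, c (j+n) (m / 2^n)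

lemma le_U (c : ℤ → ℤ → ℝ≥0∞) (j m : ℤ) (n : ℕ) : c (j+n) (m / 2^n) ≤ U c j m :=
  le_iSup (fun n : ℕ => c (j+n) (m / 2^n)) n

lemma le_U0 (c : ℤ → ℤ → ℝ≥0∞) (j m : ℤ) : c j m ≤ U c j m := by
  simpa using le_U c j m 0

lemma U_mono (c : ℤ → ℤ → ℝ≥0∞) (j m : ℤ) : U c (j+1) (m/2) ≤ U c j m := by
  refine iSup_le fun n => ?_
  refine le_trans (le_of_eq ?_) (le_U c j m (n+1))
  congr 1
  · push_cast; ring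
  · rw [pow_succ', Int.ediv_ediv_of_nonneg (by norm_num)]

lemma WD.anc {μ c K Q} (h : WD μ c K Q) (j m : ℤ) (n : ℕ) (F : ℝ → ℝ≥0∞) (hF : Measurable F) :
    c (j+n) (m/2^n) * ∫⁻ x in cell j m, F x ≤ K * ∫⁻ x in cell j m, F x ∂μ := by
  have := h.h1 (j+n) (m/2^n) ((cell j m).indicator F) (hF.indicator (measurableSet_cell _ _))
  rw [lintegral_indicator (measurableSet_cell _ _), lintegral_indicator (measurableSet_cell _ _),
    Measure.restrict_restrict (measurableSet_cell _ _),
    Measure.restrict_restrict (measurableSet_cell _ _),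
    inter_eq_self_of_subset_left (cell_subset j m n)] at this
  exact this

lemma WD.hU {μ c K Q} (h : WD μ c K Q) (j m : ℤ) (F : ℝ → ℝ≥0∞) (hF : Measurable F) :
    U c j m * ∫⁻ x in cell j m, F x ≤ K * ∫⁻ x in cell j m, F x ∂μ := by
  unfold U
  rw [ENNReal.iSup_mul]
  exact iSup_le fun n => h.anc j m n F hF

lemma WD.hU1 {μ c K Q} (h : WD μ c K Q) (j m : ℤ) :
    U c j m * V j ≤ K * μ (cell j m) := by
  have := h.hU j m (fun _ => 1) measurable_const
  simpa [volume_cell] using this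

end VarW

namespace VarW

noncomputable def EE (G : ℝ → ℝ) (j m : ℤ) : ℝ := (G (((m:ℝ)+1) * 2^j) - G ((m:ℝ) * 2^j)) / 2^j

/-- martingale difference on the cell `(j+1,m)` -/
noncomputable def Dr (G : ℝ → ℝ) (j m : ℤ) : ℝ := |EE G j (2*m) - EE G j (2*m+1)| / 2

noncomputable def De (G : ℝ → ℝ) (j m : ℤ) : ℝ≥0∞ := ENNReal.ofReal (Dr G j m)

noncomputable def lin (G : ℝ → ℝ) (j : ℤ) (x : ℝ) : ℝ :=
  G ((idx j x : ℝ) * 2^j) + (x - (idx j x : ℝ) * 2^j) * EE G j (idx j x)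

lemma EE_split (G : ℝ → ℝ) (j m : ℤ) :
    EE G (j+1) m = (EE G j (2*m) + EE G j (2*m+1)) / 2 := by
  unfold EE
  have hp := p2 j
  rw [p2_succ]
  have e1 : ((m:ℝ)+1) * (2 * 2^j) = (((2*m+1:ℤ):ℝ)+1) * 2^j := by push_cast; ring
  have e2 : (m:ℝ) * (2 * 2^j) = ((2*m:ℤ):ℝ) * 2^j := by push_cast; ring
  have e3 : (((2*m:ℤ):ℝ)+1) * 2^j = ((2*m+1:ℤ):ℝ) * 2^j := by push_cast; ring
  rw [e1, e2, e3]
  field_simp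
  ring

lemma EE_anc (G : ℝ → ℝ) (j p : ℤ) : |EE G j p - EE G (j+1) (p/2)| ≤ Dr G j (p/2) := by
  rw [EE_split]
  unfold Dr
  rcases Int.even_or_odd' p with ⟨k, hk | hk⟩
  · have : p / 2 = k := by omega
    rw [this, hk]
    apply le_of_eq
    rw [← abs_of_pos (show (0:ℝ) < 2 by norm_num), ← abs_div, abs_of_pos (show (0:ℝ) < 2 by norm_num)]
    congr 1; ring
  · have : p / 2 = k := by omega
    rw [this, hk]
    apply le_of_eq
    rw [← abs_of_pos (show (0:ℝ) < 2 by norm_num), ← abs_div, abs_of_pos (show (0:ℝ) < 2 by norm_num),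
      ← abs_neg]
    congr 1; ring

lemma idx_succ (j : ℤ) (x : ℝ) : idx (j+1) x = idx j x / 2 := by
  simpa using idx_add j 1 x

lemma lin_step (G : ℝ → ℝ) (j : ℤ) (x : ℝ) :
    |lin G j x - lin G (j+1) x| ≤ 2^j * Dr G j (idx (j+1) x) := by
  have hx := mem_cell_idx j x
  have hp := p2 j
  unfold lin
  rw [idx_succ]
  set p := idx j x
  rcases Int.even_or_odd' p with ⟨k, hk | hk⟩
  · have hk2 : p / 2 = k := by omega
    have e2 : (k:ℝ) * (2 ^ (j+1)) = (p:ℝ) * 2^j := by rw [p2_succ, hk]; push_cast; ring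
    rw [hk2, e2]
    have h3 := EE_anc G j p
    rw [hk2] at h3
    have : G (↑p * 2 ^ j) + (x - ↑p * 2 ^ j) * EE G j p - (G (↑p * 2 ^ j) + (x - ↑p * 2 ^ j) * EE G (j + 1) k)
      = (x - ↑p * 2 ^ j) * (EE G j p - EE G (j + 1) k) := by ring
    rw [this, abs_mul]
    refine mul_le_mul ?_ h3 (abs_nonneg _) hp.le
    have h1 := hx.1
    have h2 := hx.2
    rw [abs_of_nonneg (by linarith)]
    linarith
  · have hk2 : p / 2 = k := by omega
    have e2 : (k:ℝ) * (2 ^ (j+1)) = ((2*k:ℤ):ℝ) * 2^j := by rw [p2_succ]; push_cast; ring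
    rw [hk2, e2]
    have hG : G ((p:ℝ) * 2^j) = G (((2*k:ℤ):ℝ) * 2^j) + 2^j * EE G j (2*k) := by
      unfold EE
      have e3 : (((2*k:ℤ):ℝ)+1) * 2^j = (p:ℝ) * 2^j := by rw [hk]; push_cast; ring
      rw [e3]; field_simp; ring
    have h1 := hx.1
    have h2 := hx.2
    rw [EE_split, hG]
    unfold Dr
    have hp2 : (p:ℝ) = 2 * k + 1 := by rw [hk]; push_cast; ring
    have : G (((2*k:ℤ):ℝ) * 2^j) + 2^j * EE G j (2*k) + (x - p * 2^j) * EE G j p -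
      (G (((2*k:ℤ):ℝ) * 2^j) + (x - ((2*k:ℤ):ℝ) * 2^j) * ((EE G j (2*k) + EE G j (2*k+1)) / 2))
      = (2^j - (x - p * 2^j)) * ((EE G j (2*k) - EE G j (2*k+1)) / 2) := by
      rw [← hk]
      push_cast
      have : x - 2 * (k:ℝ) * 2^j = (x - p * 2^j) + 2^j := by rw [hp2]; ring
      rw [this]
      ring
    rw [this, abs_mul, abs_div, abs_of_pos (show (0:ℝ) < 2 by norm_num)]
    refine mul_le_mul_of_nonneg_right ?_ (by positivity)
    rw [abs_of_nonneg (by linarith)]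
    linarith

lemma tele (z b : ℕ → ℝ≥0∞) (h : ∀ n, z n ≤ b n + z (n+1)) (hz : Filter.Tendsto z Filter.atTop (𝓝 0)) :
    z 0 ≤ ∑' n, b n := by
  have h1 : ∀ N, z 0 ≤ (∑' n, b n) + z N := by
    intro N
    have : z 0 ≤ (∑ n ∈ Finset.range N, b n) + z N := by
      induction N with
      | zero => simp
      | succ N ih =>
        rw [Finset.sum_range_succ, add_assoc]
        exact ih.trans (by gcongr; exact h N)
    exact this.trans (by gcongr; exact ENNReal.sum_le_tsum _)
  have h2 : Filter.Tendsto (fun N => (∑' n, b n) + z N) Filter.atTop (𝓝 ((∑' n, b n) + 0)) :=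
    tendsto_const_nhds.add hz
  rw [add_zero] at h2
  exact ge_of_tendsto' h2 h1

lemma ofReal_abs_tri (a b c : ℝ) : ENNReal.ofReal |a - c| ≤ ENNReal.ofReal |a - b| + ENNReal.ofReal |b - c| := by
  rw [← ENNReal.ofReal_add (abs_nonneg _) (abs_nonneg _)]
  exact ENNReal.ofReal_le_ofReal (abs_sub_le a b c)

lemma tendsto_ofReal_abs {u : ℕ → ℝ} (h : Filter.Tendsto u Filter.atTop (𝓝 0)) :
    Filter.Tendsto (fun n => ENNReal.ofReal |u n|) Filter.atTop (𝓝 0) := by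
  have h2 := ENNReal.tendsto_ofReal h.abs
  simpa using h2

lemma low_bound (G : ℝ → ℝ) (hl : ∀ k x, Filter.Tendsto (fun n : ℕ => lin G (k-n) x) Filter.atTop (𝓝 (G x)))
    (k : ℤ) (x : ℝ) :
    ENNReal.ofReal |G x - lin G k x| ≤ ∑' n : ℕ, V (k-(n+1)) * De G (k-(n+1)) (idx (k-n) x) := by
  have := tele (fun n : ℕ => ENNReal.ofReal |G x - lin G (k-n) x|)
    (fun n : ℕ => V (k-(n+1)) * De G (k-(n+1)) (idx (k-n) x)) ?_ ?_
  · simpa using this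
  · intro n
    refine (ofReal_abs_tri _ (lin G (k-(n+1)) x) _).trans ?_
    rw [add_comm]
    refine add_le_add ?_ ?_
    · have := lin_step G (k-(n+1)) x
      rw [show k - ((n:ℤ)+1) + 1 = k - n by ring] at this
      refine (ENNReal.ofReal_le_ofReal this).trans ?_
      rw [ENNReal.ofReal_mul (p2 _).le]; rfl
    · push_cast; rfl
  · apply tendsto_ofReal_abs
    have := (hl k x).const_sub (G x)
    simpa using this

lemma high_bound (G : ℝ → ℝ)
    (hE : ∀ k m, Filter.Tendsto (fun n : ℕ => EE G (k+n) (m/2^n)) Filter.atTop (𝓝 0))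
    (k m : ℤ) :
    ENNReal.ofReal |EE G k (m+1) - EE G k m| ≤ ∑' n : ℕ, (if (2:ℤ)^n ∣ m+1 then
      De G (k+n) (m/2^(n+1)) + De G (k+n) ((m+1)/2^(n+1)) else 0) := by
  have := tele (fun n : ℕ => ENNReal.ofReal |EE G (k+n) ((m+1)/2^n) - EE G (k+n) (m/2^n)|)
    (fun n : ℕ => (if (2:ℤ)^n ∣ m+1 then
      De G (k+n) (m/2^(n+1)) + De G (k+n) ((m+1)/2^(n+1)) else 0)) ?_ ?_
  · simpa using this
  · intro n
    split_ifs with hd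
    · have key : ∀ p : ℤ, ENNReal.ofReal |EE G (k+n) (p/2^n) - EE G (k+n+1) (p/2^(n+1))| ≤ De G (k+n) (p/2^(n+1)) := by
        intro p
        have := EE_anc G (k+n) (p/2^n)
        rw [Int.ediv_ediv_of_nonneg (by positivity), ← pow_succ] at this
        exact ENNReal.ofReal_le_ofReal this
      have k1 := key (m+1)
      have k2 := key m
      rw [abs_sub_comm] at k2
      have t1 := ofReal_abs_tri (EE G (k+n) ((m+1)/2^n)) (EE G (k+n+1) ((m+1)/2^(n+1))) (EE G (k+n) (m/2^n))
      have t2 := ofReal_abs_tri (EE G (k+n+1) ((m+1)/2^(n+1))) (EE G (k+n+1) (m/2^(n+1))) (EE G (k+n) (m/2^n))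
      rw [show k + ((n+1:ℕ):ℤ) = k+n+1 by push_cast; ring]
      refine t1.trans ((add_le_add k1 (t2.trans (add_le_add le_rfl k2))).trans (le_of_eq ?_))
      ring
    · have : (m+1)/2^n = m/2^n := by
        rw [Int.add_ediv_of_pos (by positivity)]
        have h1 := Int.emod_nonneg m (b := 2^n) (by positivity)
        rcases Nat.eq_zero_or_pos n with h0 | h0
        · subst h0; simp at hd
        have h2n : (1:ℤ) < 2^n := one_lt_pow₀ (by norm_num) h0.ne'
        have h2 : ¬ (2^n ≤ m % 2^n + 1 % 2^n) := by
          intro hle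
          apply hd
          have h3 := Int.emod_lt_of_pos m (b := 2^n) (by positivity)
          rw [Int.emod_eq_of_lt (by norm_num) h2n] at hle
          have h4 : m % 2^n = 2^n - 1 := by omega
          have h5 := Int.mul_ediv_add_emod m (2^n)
          exact ⟨m / 2^n + 1, by rw [h4] at h5; linarith⟩
        rw [if_neg h2, Int.ediv_eq_zero_of_lt (by norm_num) h2n]; simp
      rw [this]; simp
  · apply tendsto_ofReal_abs
    simpa using (hE k (m+1)).sub (hE k m)

noncomputable def bl (G : ℝ → ℝ) (k : ℤ) (n : ℕ) (x : ℝ) : ℝ≥0∞ :=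
  (2⁻¹)^(n+1) * (De G (k-(n+1)) (idx (k-n) x) + De G (k-(n+1)) (idx (k-n) (x+2^k)))

noncomputable def bh (G : ℝ → ℝ) (k : ℤ) (n : ℕ) (x : ℝ) : ℝ≥0∞ :=
  if (2:ℤ)^n ∣ idx k x + 1 then
    De G (k+n) (idx (k+(n+1)) x) + De G (k+n) (idx (k+(n+1)) (x+2^k)) else 0

lemma V_inv_mul (k : ℤ) (n : ℕ) : (V k)⁻¹ * V (k-(n+1)) = (2⁻¹)^(n+1) := by
  have := V_add (k-(n+1)) (n+1)
  push_cast at this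
  rw [show k - ((n:ℤ)+1) + (n+1) = k by ring] at this
  rw [this, ENNReal.mul_inv (Or.inl (V_ne_zero _)) (Or.inl (V_ne_top _)), mul_comm, ← mul_assoc,
    ENNReal.mul_inv_cancel (V_ne_zero _) (V_ne_top _), one_mul, ENNReal.inv_pow]

lemma R_bound (G : ℝ → ℝ)
    (hl : ∀ k x, Filter.Tendsto (fun n : ℕ => lin G (k-n) x) Filter.atTop (𝓝 (G x)))
    (hE : ∀ k m, Filter.Tendsto (fun n : ℕ => EE G (k+n) (m/2^n)) Filter.atTop (𝓝 0))
    (k : ℤ) (x : ℝ) :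
    ENNReal.ofReal |(G (x+2^k) - G x) / 2^k - EE G k (idx k x)|
      ≤ (∑' n, bl G k n x) + ∑' n, bh G k n x := by
  have hp := p2 k
  set m := idx k x with hm
  have hx := mem_cell_idx k x
  rw [← hm] at hx
  have e : (G (x+2^k) - G x) / 2^k - EE G k m = 
      ((2:ℝ)^k)⁻¹ * ((G (x+2^k) - lin G k (x+2^k)) - (G x - lin G k x))
      + ((x - m * 2^k)/2^k) * (EE G k (m+1) - EE G k m) := by
    unfold lin
    rw [idx_shift, ← hm]
    have e1 : G (((m+1:ℤ):ℝ) * 2^k) = G ((m:ℝ) * 2^k) + 2^k * EE G k m := by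
      unfold EE; push_cast; field_simp; ring
    rw [e1]
    push_cast
    field_simp
    ring
  have e2 : |(G (x+2^k) - G x) / 2^k - EE G k m| ≤ ((2:ℝ)^k)⁻¹ * (|G (x+2^k) - lin G k (x+2^k)| + |G x - lin G k x|)
      + |EE G k (m+1) - EE G k m| := by
    rw [e]
    refine (abs_add_le _ _).trans (add_le_add ?_ ?_)
    · rw [abs_mul, abs_of_pos (inv_pos.2 hp)]
      gcongr
      exact abs_sub _ _
    · rw [abs_mul]
      apply mul_le_of_le_one_left (abs_nonneg _)
      have h1 := hx.1
      have h2 := hx.2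
      rw [abs_of_nonneg (div_nonneg (by linarith) hp.le), div_le_one hp]
      linarith
  refine (ENNReal.ofReal_le_ofReal e2).trans ?_
  rw [ENNReal.ofReal_add (by positivity) (by positivity), ENNReal.ofReal_mul (by positivity),
    ENNReal.ofReal_add (by positivity) (by positivity), ENNReal.ofReal_inv_of_pos hp]
  gcongr
  · refine (mul_le_mul_right (add_le_add (low_bound G hl k (x+2^k)) (low_bound G hl k x)) _).trans ?_
    rw [← ENNReal.tsum_add, ← ENNReal.tsum_mul_left]
    gcongr with n
    rw [← mul_add, ← mul_assoc]
    change (V k)⁻¹ * V _ * _ ≤ _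
    rw [V_inv_mul, add_comm (De _ _ _)]
    rfl
  · refine (high_bound G hE k m).trans ?_
    gcongr with n
    unfold bh
    have q := idx_add k (n+1)
    push_cast at q
    rw [q, q, idx_shift, ← hm]

end VarW

namespace VarW

lemma sq_add_le (a b : ℝ≥0∞) : (a+b)^2 ≤ 2*(a^2+b^2) := by
  induction a with
  | top => simp
  | coe a =>
    induction b with
    | top => simp
    | coe b =>
      have : (a+b)^2 ≤ 2*(a^2+b^2) := by
        have := add_sq_le (a := (a:ℝ)) (b := (b:ℝ))
        exact_mod_cast this
      exact_mod_cast this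

noncomputable def aj (c : ℤ → ℤ → ℝ≥0∞) (G : ℝ → ℝ) (j : ℤ) : ℝ≥0∞ :=
  ∑' m, V (j+1) * De G j m ^ 2 * U c (j+1) m

noncomputable def ej (c : ℤ → ℤ → ℝ≥0∞) (G : ℝ → ℝ) (j : ℤ) : ℝ≥0∞ :=
  ∑' m, V j * ENNReal.ofReal |EE G j m| ^ 2 * U c j m

lemma ae_step (c : ℤ → ℤ → ℝ≥0∞) (G : ℝ → ℝ) (j : ℤ) : aj c G j + ej c G (j+1) ≤ ej c G j := by
  unfold aj ej
  rw [← ENNReal.tsum_add, tsum_even_odd (fun m => V j * ENNReal.ofReal |EE G j m| ^ 2 * U c j m)]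
  refine ENNReal.tsum_le_tsum fun m => ?_
  have u1 := U_mono c j (2*m)
  have u2 := U_mono c j (2*m+1)
  rw [show 2*m/2 = m by omega] at u1
  rw [show (2*m+1)/2 = m by omega] at u2
  have key : V (j+1) * De G j m ^ 2 + V (j+1) * ENNReal.ofReal |EE G (j+1) m| ^ 2
      = V j * ENNReal.ofReal |EE G j (2*m)| ^ 2 + V j * ENNReal.ofReal |EE G j (2*m+1)| ^ 2 := by
    rw [V_succ, EE_split]
    unfold De Dr V
    have := p2 j
    rw [show (2:ℝ≥0∞) = ENNReal.ofReal 2 by simp]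
    rw [← ENNReal.ofReal_mul (by positivity), ← ENNReal.ofReal_pow (by positivity),
      ← ENNReal.ofReal_pow (by positivity), ← ENNReal.ofReal_pow (by positivity),
      ← ENNReal.ofReal_pow (by positivity), ← ENNReal.ofReal_mul (by positivity),
      ← ENNReal.ofReal_mul (by positivity), ← ENNReal.ofReal_mul (by positivity),
      ← ENNReal.ofReal_mul (by positivity), ← ENNReal.ofReal_add (by positivity) (by positivity),
      ← ENNReal.ofReal_add (by positivity) (by positivity)]
    congr 1
    rw [div_pow, sq_abs, sq_abs, sq_abs, sq_abs]
    ring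
  rw [← add_mul, key, add_mul]
  gcongr

lemma sum_aj_le (c : ℤ → ℤ → ℝ≥0∞) (G : ℝ → ℝ) (B : ℝ≥0∞) (hB : ∀ j, ej c G j ≤ B) :
    ∑' j, aj c G j ≤ B := by
  have h1 : ∀ (j : ℤ) (N : ℕ), (∑ n ∈ Finset.range N, aj c G (j+n)) + ej c G (j+N) ≤ ej c G j := by
    intro j N
    induction N with
    | zero => simp
    | succ N ih =>
      refine le_trans ?_ ih
      rw [Finset.sum_range_succ, add_assoc]
      gcongr
      have := ae_step c G (j+N)
      push_cast
      rwa [← add_assoc]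
  apply ENNReal.summable.tsum_le_of_sum_le
  intro s
  obtain ⟨j, N, hs⟩ : ∃ (j : ℤ) (N : ℕ), s ⊆ (Finset.range N).image (fun n : ℕ => j + (n:ℤ)) := by
    obtain ⟨a, ha⟩ := s.bddBelow
    obtain ⟨b, hb⟩ := s.bddAbove
    refine ⟨a, (b-a+1).toNat, fun x hx => ?_⟩
    have h1 := ha hx
    have h2 := hb hx
    rw [Finset.mem_image]
    refine ⟨(x-a).toNat, ?_, ?_⟩
    · rw [Finset.mem_range]; omega
    · omega
  calc ∑ i ∈ s, aj c G i ≤ ∑ i ∈ (Finset.range N).image (fun n : ℕ => j + (n:ℤ)), aj c G i :=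
        Finset.sum_le_sum_of_subset hs
    _ = ∑ n ∈ Finset.range N, aj c G (j+n) := by
        rw [Finset.sum_image]; intro a _ b _ h; simpa using h
    _ ≤ _ := le_self_add.trans ((h1 j N).trans (hB j))

lemma cs (p : ℝ≥0∞) (hp0 : p ≠ 0) (hp : p ≠ ∞) (b : ℕ → ℝ≥0∞) :
    (∑' n, b n)^2 ≤ (∑' n, (p^2)^n) * ∑' n, ((p^2)^n)⁻¹ * b n ^ 2 := by
  have h := ENNReal.lintegral_mul_le_Lp_mul_Lq (Measure.count : Measure ℕ) (p := 2) (q := 2)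
    (Real.HolderConjugate.two_two) (f := fun n => p^n) (g := fun n => (p^n)⁻¹ * b n)
    (measurable_of_countable _).aemeasurable (measurable_of_countable _).aemeasurable
  simp only [lintegral_count, Pi.mul_apply] at h
  have e : ∀ n, p^n * ((p^n)⁻¹ * b n) = b n := by
    intro n
    rw [← mul_assoc, ENNReal.mul_inv_cancel (pow_ne_zero _ hp0) (ENNReal.pow_ne_top hp), one_mul]
  simp only [e] at h
  have h2 := pow_le_pow_left' h 2
  refine h2.trans (le_of_eq ?_)
  rw [mul_pow]
  have hh : ∀ x : ℝ≥0∞, (x ^ (1/(2:ℝ)))^2 = x := by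
    intro x
    rw [← ENNReal.rpow_natCast, ← ENNReal.rpow_mul]; simp
  rw [hh, hh]
  congr 2
  · ext n
    rw [show (2:ℝ) = ((2:ℕ):ℝ) by norm_num, ENNReal.rpow_natCast, ← pow_mul, ← pow_mul, mul_comm]
  · ext n
    rw [show (2:ℝ) = ((2:ℕ):ℝ) by norm_num, ENNReal.rpow_natCast, mul_pow]
    congr 1
    rw [← ENNReal.inv_pow, ← pow_mul, ← pow_mul, mul_comm]

noncomputable def SS (Q : ℝ≥0∞) : ℝ≥0∞ := (∑' n : ℕ, (Q ^ (1/2:ℝ))^n)^2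

lemma SS_ne_top (Q : ℝ≥0∞) (hQ : Q < 1) : SS Q ≠ ∞ := by
  unfold SS
  apply ENNReal.pow_ne_top
  rw [ENNReal.tsum_geometric]
  have : Q ^ (1/2:ℝ) < 1 := ENNReal.rpow_lt_one hQ (by norm_num)
  rw [ENNReal.inv_ne_top]
  exact (tsub_pos_of_lt this).ne'

lemma l2sum (μ : Measure ℝ) (Q : ℝ≥0∞) (hQ0 : Q ≠ 0) (hQ : Q < 1) (b : ℤ → ℕ → ℝ → ℝ≥0∞)
    (hb : ∀ k n, Measurable (b k n)) (A : ℤ → ℕ → ℝ≥0∞) (T : ℝ≥0∞)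
    (h : ∀ k n, ∫⁻ x, b k n x ^ 2 ∂μ ≤ Q^n * A k n) (hA : ∀ n, ∑' k, A k n ≤ T) :
    ∑' k, ∫⁻ x, (∑' n, b k n x)^2 ∂μ ≤ SS Q * T := by
  set p := Q ^ (1/4:ℝ) with hp
  set q := Q ^ (1/2:ℝ) with hq
  have hpq : p^2 = q := by
    rw [hp, hq, ← ENNReal.rpow_natCast, ← ENNReal.rpow_mul]; norm_num
  have hqQ : q^2 = Q := by
    rw [hq, ← ENNReal.rpow_natCast, ← ENNReal.rpow_mul]; norm_num
  have hQt : Q ≠ ∞ := hQ.ne_top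
  have hp0 : p ≠ 0 := by simp [hp, hQ0, hQt]
  have hpt : p ≠ ∞ := by simp [hp, hQ0, hQt]
  have hq0 : q ≠ 0 := by simp [hq, hQ0, hQt]
  have hqt : q ≠ ∞ := by simp [hq, hQ0, hQt]
  set s := ∑' n : ℕ, q^n with hs
  have h1 : ∀ k, ∫⁻ x, (∑' n, b k n x)^2 ∂μ ≤ s * ∑' n, q^n * A k n := by
    intro k
    calc ∫⁻ x, (∑' n, b k n x)^2 ∂μ ≤ ∫⁻ x, s * ∑' n, (q^n)⁻¹ * b k n x ^ 2 ∂μ := by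
          apply lintegral_mono
          intro x
          have := cs p hp0 hpt (fun n => b k n x)
          rwa [hpq] at this
      _ = s * ∑' n, (q^n)⁻¹ * ∫⁻ x, b k n x ^ 2 ∂μ := by
          rw [lintegral_const_mul _ (Measurable.tsum fun n => ((hb k n).pow_const 2).const_mul _),
            lintegral_tsum fun n => (((hb k n).pow_const 2).const_mul _).aemeasurable]
          congr 2; ext n
          rw [lintegral_const_mul _ ((hb k n).pow_const 2)]
      _ ≤ s * ∑' n, q^n * A k n := by
          refine mul_le_mul_right (ENNReal.tsum_le_tsum fun n => ?_) _
          refine (mul_le_mul_right (h k n) _).trans (le_of_eq ?_)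
          rw [← hqQ, ← pow_mul, mul_comm 2 n, pow_mul, sq, ← mul_assoc, ← mul_assoc,
            ENNReal.inv_mul_cancel (pow_ne_zero _ hq0) (ENNReal.pow_ne_top hqt), one_mul]
  calc ∑' k, ∫⁻ x, (∑' n, b k n x)^2 ∂μ ≤ ∑' k, s * ∑' n, q^n * A k n := ENNReal.tsum_le_tsum h1
    _ = s * ∑' n, q^n * ∑' k, A k n := by
        rw [ENNReal.tsum_mul_left, ENNReal.tsum_comm]
        simp_rw [ENNReal.tsum_mul_left]
    _ ≤ s * ∑' n, q^n * T := by gcongr with n; exact hA n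
    _ = SS Q * T := by
        rw [ENNReal.tsum_mul_right, ← mul_assoc, ← sq]; rfl

lemma lint_idx (μ : Measure ℝ) (ι : ℝ → ℤ) (hι : Measurable ι) (φ : ℤ → ℝ≥0∞) :
    ∫⁻ x, φ (ι x) ∂μ = ∑' m, φ m * μ (ι ⁻¹' {m}) := by
  rw [← lintegral_map (measurable_of_countable φ) hι, lintegral_countable']
  congr 1; ext m
  rw [Measure.map_apply hι (measurableSet_singleton m)]

lemma lint_De {μ : Measure ℝ} {c : ℤ → ℤ → ℝ≥0∞} (G : ℝ → ℝ) (j : ℤ) (ι : ℝ → ℤ) (hι : Measurable ι)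
    (S : Set ℝ) (M : ℝ≥0∞)
    (h : ∀ m, μ (ι ⁻¹' {m} ∩ S) ≤ M * V (j+1) * U c (j+1) m) :
    ∫⁻ x in S, De G j (ι x) ^ 2 ∂μ ≤ M * aj c G j := by
  rw [lint_idx _ ι hι (fun m => De G j m ^ 2)]
  unfold aj
  rw [← ENNReal.tsum_mul_left]
  refine ENNReal.tsum_le_tsum fun m => ?_
  rw [Measure.restrict_apply (hι (measurableSet_singleton m))]
  refine (mul_le_mul_right (h m) _).trans (le_of_eq ?_)
  ring

lemma measurable_De (G : ℝ → ℝ) (j i : ℤ) (t : ℝ) : Measurable fun x => De G j (idx i (x+t)) :=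
  (measurable_of_countable (De G j)).comp ((measurable_idx i).comp (measurable_id.add_const t))

lemma measurable_De0 (G : ℝ → ℝ) (j i : ℤ) : Measurable fun x => De G j (idx i x) :=
  (measurable_of_countable (De G j)).comp (measurable_idx i)

lemma measurable_bl (G : ℝ → ℝ) (k : ℤ) (n : ℕ) : Measurable (bl G k n) :=
  ((measurable_De0 _ _ _).add (measurable_De _ _ _ _)).const_mul _

def Sset (k : ℤ) (n : ℕ) : Set ℝ := {x | (2:ℤ)^n ∣ idx k x + 1}

lemma measurableSet_Sset (k : ℤ) (n : ℕ) : MeasurableSet (Sset k n) :=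
  (measurable_idx k) (MeasurableSet.of_discrete (s := {m : ℤ | (2:ℤ)^n ∣ m+1}))

lemma measurable_bh (G : ℝ → ℝ) (k : ℤ) (n : ℕ) : Measurable (bh G k n) :=
  Measurable.ite (measurableSet_Sset k n)
    ((measurable_De0 _ _ _).add (measurable_De _ _ _ _)) measurable_const

variable {μ : Measure ℝ} {c : ℤ → ℤ → ℝ≥0∞} {K Q : ℝ≥0∞}

lemma int_De (h : WD μ c K Q) (G : ℝ → ℝ) (j : ℤ) :
    ∫⁻ x, De G j (idx (j+1) x) ^ 2 ∂μ ≤ 2 * aj c G j := by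
  have := lint_De (μ := μ) (c := c) G j (idx (j+1)) (measurable_idx _) univ 2 ?_
  · simpa using this
  · intro m
    rw [inter_univ]
    have e : idx (j+1) ⁻¹' {m} ⊆ cell2 (j+1) m := fun x hx => cell_sub_cell2 _ _ (mem_cell.2 hx)
    refine (measure_mono e).trans ((h.h3 _ _).trans ?_)
    gcongr
    exact le_U0 _ _ _

lemma int_bl (h : WD μ c K Q) (G : ℝ → ℝ) (k : ℤ) (n : ℕ) :
    ∫⁻ x, bl G k n x ^ 2 ∂μ ≤ (2⁻¹)^n * (2 * aj c G (k-(n+1))) := by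
  set j := k - ((n:ℤ)+1) with hj
  have ej1 : k - (n:ℤ) = j + 1 := by rw [hj]; ring
  have ek : k = j + 1 + n := by rw [hj]; ring
  have h1 := int_De h G j
  have h2 : ∫⁻ x, De G j (idx (j+1) (x+2^k)) ^ 2 ∂μ ≤ 2 * 2^n * aj c G j := by
    have := lint_De (μ := μ) (c := c) G j (fun x => idx (j+1) (x+2^k))
      ((measurable_idx _).comp (measurable_id.add_const _)) univ (2 * 2^n) ?_
    · simpa using this
    · intro m
      rw [inter_univ]
      have e : (fun x => idx (j+1) (x+2^k)) ⁻¹' {m} ⊆ cell2 (j+1+n) (m/2^n) := by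
        intro x hx
        apply sub_mem_cell2
        rw [← ek]
        exact mem_cell.2 hx
      refine (measure_mono e).trans ((h.h3 _ _).trans ?_)
      rw [V_add]
      calc 2 * (V (j+1) * 2^n) * c (j+1+n) (m/2^n) ≤ 2 * (V (j+1) * 2^n) * U c (j+1) m := by
            gcongr; exact le_U _ _ _ _
        _ = _ := by ring
  calc ∫⁻ x, bl G k n x ^ 2 ∂μ
      ≤ ∫⁻ x, ((2⁻¹)^(n+1))^2 * (2 * (De G j (idx (j+1) x) ^ 2 + De G j (idx (j+1) (x+2^k)) ^ 2)) ∂μ := by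
        apply lintegral_mono
        intro x
        unfold bl
        beta_reduce
        rw [mul_pow, ej1, ← hj]
        gcongr
        exact sq_add_le _ _
    _ = ((2⁻¹)^(n+1))^2 * (2 * (∫⁻ x, De G j (idx (j+1) x) ^ 2 ∂μ + ∫⁻ x, De G j (idx (j+1) (x+2^k)) ^ 2 ∂μ)) := by
        rw [lintegral_const_mul, lintegral_const_mul, lintegral_add_left]
        · exact (measurable_De0 _ _ _).pow_const _
        · exact ((measurable_De0 _ _ _).pow_const _).add ((measurable_De _ _ _ _).pow_const _)
        · exact (((measurable_De0 _ _ _).pow_const _).add ((measurable_De _ _ _ _).pow_const _)).const_mul _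
    _ ≤ ((2⁻¹)^(n+1))^2 * (2 * (2 * 2^n * aj c G j + 2 * 2^n * aj c G j)) := by
        gcongr
        refine h1.trans ?_
        gcongr
        exact le_mul_of_one_le_right (by simp) (one_le_pow₀ (by norm_num))
    _ = _ := by
        have e2 : (2⁻¹:ℝ≥0∞)^n * 2^n = 1 := by
          rw [← mul_pow, ENNReal.inv_mul_cancel (by norm_num) (by norm_num), one_pow]
        have e3 : (2⁻¹:ℝ≥0∞) * 2 = 1 := ENNReal.inv_mul_cancel (by norm_num) (by norm_num)
        calc _ = (2⁻¹)^n * (2 * aj c G j) * ((2⁻¹:ℝ≥0∞)^n * 2^n) * (2⁻¹ * 2) * (2⁻¹ * 2) := by ring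
          _ = _ := by rw [e2, e3]; ring

lemma two_strips (h : WD μ c K Q) (k : ℤ) (n : ℕ) (M : ℤ) (T : Set ℝ) (hT : MeasurableSet T)
    (hs : T ⊆ cell2 (k+(n+1)) M) (a b : ℤ) (hab : T ⊆ cell k a ∪ cell k b) :
    μ T ≤ (4 * Q^n) * V (k+(n+1)) * U c (k+(n+1)) M := by
  have hh := h.h2 k M (n+1)
  push_cast at hh
  have key : ∀ a, μ (T ∩ cell k a) ≤ 2 * V (k+(n+1)) * Q^n * U c (k+(n+1)) M := by
    intro a
    refine (hh (T ∩ cell k a) (hT.inter (measurableSet_cell _ _)) (inter_subset_left.trans hs)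
      ((measure_mono inter_subset_right).trans (volume_cell _ _).le)).trans ?_
    gcongr ?_ * ?_
    · gcongr _ * ?_
      rw [pow_succ]; exact mul_le_of_le_one_right (by simp) h.hQ.le
    · exact le_U0 _ _ _
  have e : T = (T ∩ cell k a) ∪ (T ∩ cell k b) := by
    rw [← inter_union_distrib_left, inter_eq_self_of_subset_left hab]
  rw [e]
  refine (measure_union_le _ _).trans ((add_le_add (key a) (key b)).trans (le_of_eq ?_))
  ring

lemma int_bh (h : WD μ c K Q) (G : ℝ → ℝ) (k : ℤ) (n : ℕ) :
    ∫⁻ x, bh G k n x ^ 2 ∂μ ≤ Q^n * (16 * aj c G (k+n)) := by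
  have ek : k + ((n:ℤ)+1) = k + n + 1 := by ring
  have hi := fun x => idx_add k (n+1) x
  push_cast at hi
  have hpos : (0:ℤ) < 2^n := by positivity
  have h1 : ∫⁻ x in Sset k n, De G (k+n) (idx (k+n+1) x) ^ 2 ∂μ ≤ 4 * Q^n * aj c G (k+n) := by
    apply lint_De _ _ _ (measurable_idx _)
    intro M
    rw [← ek]
    apply two_strips h k n M _ (((measurable_idx _) (measurableSet_singleton M)).inter (measurableSet_Sset k n))
      _ (2^n*(2*M+1)-1) (2^n*(2*M+2)-1)
    · rintro x ⟨hx, ⟨p, hp⟩⟩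
      simp only [mem_preimage, mem_singleton_iff] at hx
      rw [hi, Int.ediv_eq_iff_of_pos (by positivity), pow_succ] at hx
      rw [mem_union, mem_cell, mem_cell]
      have a1 : 2^n * (2*M) < 2^n * p := by nlinarith [hx.1]
      have a2 : 2^n * p < 2^n * (2*M+3) := by nlinarith [hx.2]
      have a3 := lt_of_mul_lt_mul_left a1 hpos.le
      have a4 := lt_of_mul_lt_mul_left a2 hpos.le
      have : p = 2*M+1 ∨ p = 2*M+2 := by omega
      rcases this with rfl | rfl
      · left; linarith
      · right; linarith
    · exact inter_subset_left.trans fun x hx => cell_sub_cell2 _ _ (mem_cell.2 hx)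
  have h2 : ∫⁻ x in Sset k n, De G (k+n) (idx (k+n+1) (x+2^k)) ^ 2 ∂μ ≤ 4 * Q^n * aj c G (k+n) := by
    have hm : Measurable (fun x : ℝ => idx (k+n+1) (x+2^k)) :=
      (measurable_idx _).comp (measurable_id.add_const _)
    apply lint_De _ _ (fun x => idx (k+n+1) (x+2^k)) hm
    intro M
    have hm2 := (hm (measurableSet_singleton M)).inter (measurableSet_Sset k n)
    rw [← ek] at hm2 ⊢
    apply two_strips h k n M _ hm2 _ (2^n*(2*M)-1) (2^n*(2*M+1)-1)
    · rintro x ⟨hx, ⟨p, hp⟩⟩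
      simp only [mem_preimage, mem_singleton_iff] at hx
      rw [hi, Int.ediv_eq_iff_of_pos (by positivity), pow_succ, idx_shift] at hx
      rw [mem_union, mem_cell, mem_cell]
      have a1 : 2^n * (2*M) ≤ 2^n * p := by nlinarith [hx.1]
      have a2 : 2^n * p < 2^n * (2*M+2) := by nlinarith [hx.2]
      have a3 := le_of_mul_le_mul_left a1 hpos
      have a4 := lt_of_mul_lt_mul_left a2 hpos.le
      have : p = 2*M ∨ p = 2*M+1 := by omega
      rcases this with rfl | rfl
      · left; linarith
      · right; linarith
    · rintro x ⟨hx, -⟩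
      simp only [mem_preimage, mem_singleton_iff] at hx
      rw [← mem_cell] at hx
      have hp := p2 k
      have : (2:ℝ)^k ≤ 2^(k+((n:ℤ)+1)) := zpow_le_zpow_right₀ (by norm_num) (by omega)
      unfold cell at hx
      unfold cell2
      constructor
      · have := hx.1; linarith
      · have := hx.2; linarith
  calc ∫⁻ x, bh G k n x ^ 2 ∂μ
      ≤ ∫⁻ x, (Sset k n).indicator (fun x => 2 * (De G (k+n) (idx (k+n+1) x) ^ 2
          + De G (k+n) (idx (k+n+1) (x+2^k)) ^ 2)) x ∂μ := by
        apply lintegral_mono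
        intro x
        unfold bh
        rw [ek]
        beta_reduce
        by_cases hx : (2:ℤ)^n ∣ idx k x + 1
        · rw [if_pos hx, indicator_of_mem (show x ∈ Sset k n from hx)]
          exact sq_add_le _ _
        · rw [if_neg hx]; simp
    _ = 2 * (∫⁻ x in Sset k n, De G (k+n) (idx (k+n+1) x) ^ 2 ∂μ +
          ∫⁻ x in Sset k n, De G (k+n) (idx (k+n+1) (x+2^k)) ^ 2 ∂μ) := by
        rw [lintegral_indicator (measurableSet_Sset k n), lintegral_const_mul, lintegral_add_left]
        · exact (measurable_De0 _ _ _).pow_const _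
        · exact ((measurable_De0 _ _ _).pow_const _).add ((measurable_De _ _ _ _).pow_const _)
    _ ≤ 2 * (4 * Q^n * aj c G (k+n) + 4 * Q^n * aj c G (k+n)) := by gcongr
    _ = _ := by ring

noncomputable def HG (G : ℝ → ℝ) (x : ℝ) : ℝ≥0∞ :=
  8 * (∑' k, ((∑' n, bl G k n x) + ∑' n, bh G k n x)^2) + 2 * ∑' k, De G k (idx (k+1) x) ^ 2

lemma measurable_HG (G : ℝ → ℝ) : Measurable (HG G) := by
  unfold HG
  refine Measurable.add (Measurable.const_mul (Measurable.tsum fun k => ?_) _)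
    (Measurable.const_mul (Measurable.tsum fun k => (measurable_De0 _ _ _).pow_const _) _)
  exact ((Measurable.tsum fun n => measurable_bl G k n).add
    (Measurable.tsum fun n => measurable_bh G k n)).pow_const _

lemma tsum_shift (F : ℤ → ℝ≥0∞) (a : ℤ) : ∑' k, F (k + a) = ∑' k, F k :=
  (Equiv.addRight a).tsum_eq F

lemma int_HG (h : WD μ c K Q) (G : ℝ → ℝ) (B : ℝ≥0∞) (hB : ∀ j, ej c G j ≤ B) :
    ∫⁻ x, HG G x ∂μ ≤ (16 * (SS 2⁻¹ * 2 + SS Q * 16) + 4) * B := by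
  have ha := sum_aj_le c G B hB
  have i1 : ∑' k, ∫⁻ x, (∑' n, bl G k n x)^2 ∂μ ≤ SS 2⁻¹ * (2 * B) := by
    apply l2sum μ 2⁻¹ (by simp) (by simp) _ (measurable_bl G) _ _ (int_bl h G)
    intro n
    rw [ENNReal.tsum_mul_left]
    have := tsum_shift (aj c G) (-(n+1))
    simp only [← sub_eq_add_neg] at this
    rw [this]
    gcongr
  have i2 : ∑' k, ∫⁻ x, (∑' n, bh G k n x)^2 ∂μ ≤ SS Q * (16 * B) := by
    apply l2sum μ Q h.hQ0 h.hQ _ (measurable_bh G) _ _ (int_bh h G)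
    intro n
    rw [ENNReal.tsum_mul_left, tsum_shift (aj c G) n]
    gcongr
  have m1 : ∀ k, Measurable fun x => ∑' n, bl G k n x := fun k => Measurable.tsum fun n => measurable_bl G k n
  have m2 : ∀ k, Measurable fun x => ∑' n, bh G k n x := fun k => Measurable.tsum fun n => measurable_bh G k n
  have i3 : ∑' k, ∫⁻ x, De G k (idx (k+1) x) ^ 2 ∂μ ≤ 2 * B := by
    calc _ ≤ ∑' k, 2 * aj c G k := ENNReal.tsum_le_tsum fun k => int_De h G k
      _ ≤ _ := by rw [ENNReal.tsum_mul_left]; gcongr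
  have i4 : ∑' k, ∫⁻ x, ((∑' n, bl G k n x) + ∑' n, bh G k n x)^2 ∂μ ≤
      2 * (SS 2⁻¹ * (2 * B) + SS Q * (16 * B)) := by
    calc _ ≤ ∑' k, ∫⁻ x, 2 * ((∑' n, bl G k n x)^2 + (∑' n, bh G k n x)^2) ∂μ := by
          gcongr with k x
          exact sq_add_le _ _
      _ = 2 * (∑' k, ∫⁻ x, (∑' n, bl G k n x)^2 ∂μ + ∑' k, ∫⁻ x, (∑' n, bh G k n x)^2 ∂μ) := by
          rw [← ENNReal.tsum_add, ← ENNReal.tsum_mul_left]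
          congr 1; ext k
          rw [lintegral_const_mul, lintegral_add_left ((m1 k).pow_const 2)]
          exact ((m1 k).pow_const 2).add ((m2 k).pow_const 2)
      _ ≤ _ := by gcongr
  unfold HG
  rw [lintegral_add_right, lintegral_const_mul, lintegral_const_mul, lintegral_tsum, lintegral_tsum]
  · refine (add_le_add (mul_le_mul_right i4 _) (mul_le_mul_right i3 _)).trans (le_of_eq ?_)
    ring
  · intro k; exact ((measurable_De0 _ _ _).pow_const _).aemeasurable
  · intro k; exact (((m1 k).add (m2 k)).pow_const _).aemeasurable
  · exact Measurable.tsum fun k => (measurable_De0 _ _ _).pow_const _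
  · exact Measurable.tsum fun k => ((m1 k).add (m2 k)).pow_const _
  · exact Measurable.const_mul (Measurable.tsum fun k => (measurable_De0 _ _ _).pow_const _) _

noncomputable def AG (G : ℝ → ℝ) (k : ℤ) (x : ℝ) : ℝ := (G (x+2^k) - G x) / 2^k

lemma T_le_HG (G : ℝ → ℝ)
    (hl : ∀ k x, Filter.Tendsto (fun n : ℕ => lin G (k-n) x) Filter.atTop (𝓝 (G x)))
    (hE : ∀ k m, Filter.Tendsto (fun n : ℕ => EE G (k+n) (m/2^n)) Filter.atTop (𝓝 0)) (x : ℝ) :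
    ∑' k, ENNReal.ofReal |AG G (k+1) x - AG G k x| ^ 2 ≤ HG G x := by
  set r : ℤ → ℝ≥0∞ := fun k => (∑' n, bl G k n x) + ∑' n, bh G k n x
  have hr := fun k => R_bound G hl hE k x
  have hk : ∀ k, ENNReal.ofReal |AG G (k+1) x - AG G k x| ^ 2 ≤
      4 * r (k+1)^2 + 4 * r k ^2 + 2 * De G k (idx (k+1) x)^2 := by
    intro k
    have t1 := ofReal_abs_tri (AG G (k+1) x) (EE G (k+1) (idx (k+1) x)) (AG G k x)
    have t2 := ofReal_abs_tri (EE G (k+1) (idx (k+1) x)) (EE G k (idx k x)) (AG G k x)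
    have t3 : ENNReal.ofReal |EE G (k+1) (idx (k+1) x) - EE G k (idx k x)| ≤ De G k (idx (k+1) x) := by
      rw [abs_sub_comm, idx_succ]
      exact ENNReal.ofReal_le_ofReal (EE_anc G k (idx k x))
    have t4 := hr k
    rw [abs_sub_comm] at t4
    have t : ENNReal.ofReal |AG G (k+1) x - AG G k x| ≤ (r (k+1) + r k) + De G k (idx (k+1) x) := by
      refine t1.trans ((add_le_add (hr (k+1)) (t2.trans (add_le_add t3 t4))).trans (le_of_eq ?_))
      ring
    calc _ ≤ ((r (k+1) + r k) + De G k (idx (k+1) x))^2 := pow_le_pow_left' t 2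
      _ ≤ 2 * ((r (k+1) + r k)^2 + De G k (idx (k+1) x)^2) := sq_add_le _ _
      _ ≤ 2 * (2 * (r (k+1)^2 + r k^2) + De G k (idx (k+1) x)^2) := by
        gcongr; exact sq_add_le _ _
      _ = _ := by ring
  refine (ENNReal.tsum_le_tsum hk).trans (le_of_eq ?_)
  rw [ENNReal.tsum_add, ENNReal.tsum_add, ENNReal.tsum_mul_left, ENNReal.tsum_mul_left,
    ENNReal.tsum_mul_left, tsum_shift (fun k => r k ^ 2) 1]
  unfold HG
  rw [← add_mul]
  norm_num
  rfl

end VarW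

namespace VarW

open Classical in
noncomputable def GG (F : ℝ → ℝ) (Sel : ℤ → ℤ → Prop) (x : ℝ) : ℝ :=
  if h : ∃ j, Sel j (idx j x) then lin F h.choose x else F x

def Anti (Sel : ℤ → ℤ → Prop) : Prop :=
  ∀ i p (n : ℕ), 1 ≤ n → Sel i p → ¬ Sel (i+n) (p/2^n)

variable {F : ℝ → ℝ} {Sel : ℤ → ℤ → Prop}

lemma sel_unique (hS : Anti Sel) {i j : ℤ} {x : ℝ} (hi : Sel i (idx i x)) (hj : Sel j (idx j x)) : i = j := by
  have key : ∀ i j, i < j → Sel i (idx i x) → Sel j (idx j x) → False := by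
    intro i j hij hi hj
    obtain ⟨n, rfl⟩ : ∃ n : ℕ, j = i + n := ⟨(j-i).toNat, by omega⟩
    rw [idx_add] at hj
    exact hS i _ n (by omega) hi hj
  rcases lt_trichotomy i j with h | h | h
  · exact (key i j h hi hj).elim
  · exact h
  · exact (key j i h hj hi).elim

lemma G_sel (hS : Anti Sel) {j : ℤ} {x : ℝ} (hj : Sel j (idx j x)) : GG F Sel x = lin F j x := by
  have h : ∃ j, Sel j (idx j x) := ⟨j, hj⟩
  unfold GG
  rw [dif_pos h, sel_unique hS h.choose_spec hj]

lemma G_not {x : ℝ} (h : ∀ j, ¬ Sel j (idx j x)) : GG F Sel x = F x := by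
  unfold GG
  rw [dif_neg (by simpa using h)]

lemma G_ne (hS : Anti Sel) {x : ℝ} (h : GG F Sel x ≠ F x) :
    ∃ i p : ℤ, Sel i p ∧ (p:ℝ) * 2^i < x ∧ x < ((p:ℝ)+1) * 2^i := by
  by_cases hx : ∃ j, Sel j (idx j x)
  · obtain ⟨j, hj⟩ := hx
    have hc := mem_cell_idx j x
    refine ⟨j, idx j x, hj, lt_of_le_of_ne hc.1 ?_, hc.2⟩
    intro he
    apply h
    rw [G_sel hS hj]
    unfold lin
    rw [he]; simp
  · exact (h (G_not (by simpa using hx))).elim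

lemma endpt {l q j m : ℤ} (h1 : (q:ℝ) * 2^l < m * 2^j) (h2 : (m:ℝ) * 2^j < ((q:ℝ)+1) * 2^l) :
    ∃ n : ℕ, 1 ≤ n ∧ l = j + n ∧ m/2^n = q ∧ (m-1)/2^n = q := by
  rcases le_or_gt l j with h | h
  · obtain ⟨n, rfl⟩ : ∃ n : ℕ, j = l + n := ⟨(j-l).toNat, by omega⟩
    rw [p2_add] at h1 h2
    have hp := p2 l
    have a1 : (q:ℝ) < m * 2^n := by
      apply lt_of_mul_lt_mul_right _ hp.le; linarith
    have a2 : (m:ℝ) * 2^n < q + 1 := by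
      apply lt_of_mul_lt_mul_right _ hp.le; linarith
    have a1' : q < m * 2^n := by exact_mod_cast a1
    have a2' : m * 2^n < q + 1 := by exact_mod_cast a2
    omega
  · obtain ⟨n, rfl⟩ : ∃ n : ℕ, l = j + n := ⟨(l-j).toNat, by omega⟩
    rw [p2_add] at h1 h2
    have hp := p2 j
    have a1 : (q:ℝ) * 2^n < m := by
      apply lt_of_mul_lt_mul_right _ hp.le; linarith
    have a2 : (m:ℝ) < (q + 1) * 2^n := by
      apply lt_of_mul_lt_mul_right _ hp.le; linarith
    have a1' : q * 2^n < m := by exact_mod_cast a1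
    have a2' : m < (q + 1) * 2^n := by exact_mod_cast a2
    refine ⟨n, by omega, rfl, ?_, ?_⟩
    · rw [Int.ediv_eq_iff_of_pos (by positivity)]
      constructor <;> nlinarith
    · rw [Int.ediv_eq_iff_of_pos (by positivity)]
      constructor <;> nlinarith

lemma G_left (hS : Anti Sel) {j m : ℤ} (h : ∀ n : ℕ, 1 ≤ n → ¬ Sel (j+n) (m/2^n)) :
    GG F Sel ((m:ℝ) * 2^j) = F ((m:ℝ) * 2^j) := by
  by_contra hne
  obtain ⟨i, p, hs, h1, h2⟩ := G_ne hS hne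
  obtain ⟨n, hn, rfl, e, -⟩ := endpt h1 h2
  rw [← e] at hs
  exact h n hn hs

lemma G_right (hS : Anti Sel) {j m : ℤ} (h : ∀ n : ℕ, 1 ≤ n → ¬ Sel (j+n) (m/2^n)) :
    GG F Sel (((m:ℝ)+1) * 2^j) = F (((m:ℝ)+1) * 2^j) := by
  by_contra hne
  obtain ⟨i, p, hs, h1, h2⟩ := G_ne hS hne
  have e0 : ((m:ℝ)+1) = ((m+1:ℤ):ℝ) := by push_cast; ring
  rw [e0] at h1 h2
  obtain ⟨n, hn, rfl, -, e⟩ := endpt h1 h2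
  rw [← e] at hs
  simp only [add_sub_cancel_right] at hs
  exact h n hn hs

lemma EE_unhalted (hS : Anti Sel) {j m : ℤ} (h : ∀ n : ℕ, ¬ Sel (j+n) (m/2^n)) :
    EE (GG F Sel) j m = EE F j m := by
  unfold EE
  rw [G_left hS fun n _ => h n, G_right hS fun n _ => h n]

lemma G_lin (hS : Anti Sel) {i p : ℤ} (h : Sel i p) {x : ℝ} (hx1 : (p:ℝ) * 2^i ≤ x)
    (hx2 : x ≤ ((p:ℝ)+1) * 2^i) :
    GG F Sel x = F ((p:ℝ) * 2^i) + (x - (p:ℝ) * 2^i) * EE F i p := by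
  rcases hx2.eq_or_lt with he | hlt
  · rw [he, G_right hS (fun n hn => hS i p n hn h)]
    unfold EE
    have := p2 i
    field_simp
    ring
  · have : idx i x = p := mem_cell.1 ⟨hx1, hlt⟩
    rw [G_sel hS (this ▸ h : Sel i (idx i x))]
    unfold lin
    rw [this]

lemma cell_ineq (j m : ℤ) (n : ℕ) : ((m/2^n : ℤ):ℝ) * 2^(j+n) ≤ m * 2^j ∧
    ((m:ℝ)+1) * 2^j ≤ (((m/2^n : ℤ):ℝ) + 1) * 2^(j+n) := by
  have e := Int.mul_ediv_add_emod m (2^n)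
  have e1 := Int.emod_nonneg m (b := 2^n) (by positivity)
  have e2 := Int.emod_lt_of_pos m (b := 2^n) (by positivity)
  set q := m / 2^n
  have f1 : q * 2^n ≤ m := by linarith
  have f2 : m + 1 ≤ (q + 1) * 2^n := by linarith
  have f1' : (q:ℝ) * 2^n ≤ m := by exact_mod_cast f1
  have f2' : (m:ℝ) + 1 ≤ (q + 1) * 2^n := by exact_mod_cast f2
  rw [p2_add]
  have := p2 j
  constructor <;> nlinarith

lemma EE_halted (hS : Anti Sel) {j m : ℤ} {n : ℕ} (h : Sel (j+n) (m/2^n)) :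
    EE (GG F Sel) j m = EE F (j+n) (m/2^n) := by
  obtain ⟨h1, h2⟩ := cell_ineq j m n
  have hp := p2 j
  have h3 : (m:ℝ) * 2^j ≤ ((m:ℝ)+1) * 2^j := by nlinarith
  have e : EE (GG F Sel) j m = (GG F Sel (((m:ℝ)+1) * 2^j) - GG F Sel ((m:ℝ) * 2^j)) / 2^j := rfl
  rw [e, G_lin hS h (h1.trans h3) h2, G_lin hS h h1 (h3.trans h2)]
  rw [div_eq_iff hp.ne']
  ring

lemma lin_halted (hS : Anti Sel) {j : ℤ} {x : ℝ} {n : ℕ} (h : Sel (j+n) (idx (j+n) x)) :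
    lin (GG F Sel) j x = GG F Sel x := by
  have hx := mem_cell_idx (j+n) x
  rw [G_lin hS h hx.1 hx.2.le]
  unfold lin
  rw [idx_add] at h ⊢
  rw [EE_halted hS h]
  obtain ⟨h1, h2⟩ := cell_ineq j (idx j x) n
  have hp := p2 j
  rw [G_lin hS h h1 (by nlinarith)]
  ring

lemma lin_tendsto (hF : Continuous F) (k : ℤ) (x : ℝ) :
    Filter.Tendsto (fun n : ℕ => lin F (k-n) x) Filter.atTop (𝓝 (F x)) := by
  have h2 : Filter.Tendsto (fun n : ℕ => (2:ℝ)^(k-(n:ℤ))) Filter.atTop (𝓝 0) := by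
    have : ∀ n : ℕ, (2:ℝ)^(k-(n:ℤ)) = (2:ℝ)^k * (1/2)^n := by
      intro n
      rw [zpow_sub₀ (by norm_num)]; simp [div_eq_mul_inv]
    simp_rw [this]
    simpa using (tendsto_pow_atTop_nhds_zero_of_lt_one (r := (1/2:ℝ)) (by norm_num) (by norm_num)).const_mul ((2:ℝ)^k)
  have hc := fun n : ℕ => mem_cell_idx (k-(n:ℤ)) x
  have ha : Filter.Tendsto (fun n : ℕ => (idx (k-n) x : ℝ) * 2^(k-(n:ℤ))) Filter.atTop (𝓝 x) := by
    have l : Filter.Tendsto (fun n : ℕ => x - (2:ℝ)^(k-(n:ℤ))) Filter.atTop (𝓝 x) := by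
      simpa using h2.const_sub x
    refine tendsto_of_tendsto_of_tendsto_of_le_of_le l tendsto_const_nhds ?_ ?_
    · intro n; have := (hc n).2; simp only; linarith
    · intro n; exact (hc n).1
  have hb : Filter.Tendsto (fun n : ℕ => ((idx (k-n) x : ℝ) + 1) * 2^(k-(n:ℤ))) Filter.atTop (𝓝 x) := by
    have := ha.add h2
    simp only [add_zero] at this
    refine this.congr fun n => by ring
  have hFa := (hF.tendsto x).comp ha
  have hFb := (hF.tendsto x).comp hb
  have hd := hFb.sub hFa
  rw [sub_self] at hd
  have hz : Filter.Tendsto (fun n : ℕ => (x - (idx (k-n) x : ℝ) * 2^(k-(n:ℤ))) * EE F (k-n) (idx (k-n) x))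
      Filter.atTop (𝓝 0) := by
    apply squeeze_zero_norm _ (by simpa using hd.norm)
    intro n
    have hp := p2 (k-(n:ℤ))
    have h1 := (hc n).1
    have h3 := (hc n).2
    unfold EE
    simp only [Function.comp, Real.norm_eq_abs, abs_mul, abs_div]
    rw [abs_of_pos hp, abs_of_nonneg (by linarith), mul_div_assoc', div_le_iff₀ hp, mul_comm]
    gcongr
    linarith
  have := hFa.add hz
  rw [add_zero] at this
  exact this

lemma G_tendsto (hS : Anti Sel) (hF : Continuous F) (k : ℤ) (x : ℝ) :
    Filter.Tendsto (fun n : ℕ => lin (GG F Sel) (k-n) x) Filter.atTop (𝓝 (GG F Sel x)) := by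
  by_cases h : ∃ i, Sel i (idx i x)
  · obtain ⟨i, hi⟩ := h
    apply tendsto_const_nhds.congr'
    filter_upwards [Filter.eventually_ge_atTop (k-i).toNat] with n hn
    obtain ⟨l, rfl⟩ : ∃ l : ℕ, i = (k-n) + l := ⟨(i-(k-n)).toNat, by omega⟩
    exact (lin_halted hS hi).symm
  · push Not at h
    rw [G_not h]
    refine (lin_tendsto hF k x).congr fun n => ?_
    unfold lin
    have hn : ∀ l : ℕ, ¬ Sel (k-n+l) (idx (k-n) x / 2^l) := by
      intro l
      rw [← idx_add]; exact h _
    rw [EE_unhalted hS hn, G_left hS fun n _ => hn n]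

end VarW

namespace VarW

noncomputable def Xf (μ : Measure ℝ) (f : ℝ → ℝ) (j m : ℤ) : ℝ≥0∞ := ∫⁻ x in cell j m, ENNReal.ofReal |f x| ∂μ
noncomputable def Xt (μ : Measure ℝ) (f : ℝ → ℝ) : ℝ≥0∞ := ∫⁻ x, ENNReal.ofReal |f x| ∂μ
noncomputable def Fp (f : ℝ → ℝ) (x : ℝ) : ℝ := ∫ y in (0:ℝ)..x, f y

variable {μ : Measure ℝ} {c : ℤ → ℤ → ℝ≥0∞} {K Q : ℝ≥0∞} {f : ℝ → ℝ}

lemma meas_abs (hf : Measurable f) : Measurable (fun x => ENNReal.ofReal |f x|) :=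
  (continuous_abs.measurable.comp hf).ennreal_ofReal

lemma WD.c_ne (h : WD μ c K Q) (j m : ℤ) : c j m ≠ 0 := by
  intro h0
  have h1 := (measure_mono (cell_sub_cell2 j m)).trans (h.h3 j m)
  rw [h0, mul_zero] at h1
  exact h.h4 j m (le_antisymm h1 bot_le)

lemma Xf_le_Xt (j m : ℤ) : Xf μ f j m ≤ Xt μ f := setLIntegral_le_lintegral _ _

lemma WD.cX (h : WD μ c K Q) (hf : Measurable f) (j m : ℤ) (n : ℕ) :
    c (j+n) (m/2^n) * Xf volume f j m ≤ K * Xf μ f j m :=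
  h.anc j m n _ (meas_abs hf)

lemma WD.cX0 (h : WD μ c K Q) (hf : Measurable f) (j m : ℤ) :
    c j m * Xf volume f j m ≤ K * Xf μ f j m :=
  h.h1 j m _ (meas_abs hf)

lemma WD.X_ne_top (h : WD μ c K Q) (hf : Measurable f) (hX : Xt μ f ≠ ∞) (j m : ℤ) :
    Xf volume f j m ≠ ∞ := by
  intro h0
  have h1 := (h.cX0 hf j m).trans (mul_le_mul_right (Xf_le_Xt j m) K)
  rw [h0, ENNReal.mul_top (h.c_ne j m)] at h1
  exact ENNReal.mul_ne_top h.hK hX (top_le_iff.1 h1)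

lemma WD.intOn (h : WD μ c K Q) (hf : Measurable f) (hX : Xt μ f ≠ ∞) (j m : ℤ) :
    IntegrableOn f (cell j m) := by
  refine ⟨hf.aestronglyMeasurable, ?_⟩
  rw [hasFiniteIntegral_iff_norm]
  exact (h.X_ne_top hf hX j m).lt_top

lemma WD.intInt (h : WD μ c K Q) (hf : Measurable f) (hX : Xt μ f ≠ ∞) (a b : ℝ) :
    IntervalIntegrable f volume a b := by
  rw [intervalIntegrable_iff]
  obtain ⟨N, hN⟩ := pow_unbounded_of_one_lt (max |a| |b|) (one_lt_two : (1:ℝ) < 2)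
  refine ((h.intOn hf hX N (-1)).union (h.intOn hf hX N 0)).mono_set ?_
  intro x hx
  have hx' := uIoc_subset_uIcc hx
  rw [mem_uIcc] at hx'
  have h1 := abs_lt.1 ((le_max_left _ _).trans_lt hN)
  have h2 := abs_lt.1 ((le_max_right _ _).trans_lt hN)
  simp only [cell, mem_union, mem_Ico]
  push_cast
  simp only [zpow_natCast]
  rcases le_or_gt 0 x with h0 | h0
  · right; constructor
    · linarith
    · rcases hx' with hx' | hx' <;> linarith [hx'.1, hx'.2]
  · left; constructor
    · rcases hx' with hx' | hx' <;> linarith [hx'.1, hx'.2]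
    · linarith

lemma Fp_sub (hi : ∀ a b, IntervalIntegrable f volume a b) (a b : ℝ) :
    Fp f b - Fp f a = ∫ y in a..b, f y :=
  intervalIntegral.integral_interval_sub_left (hi _ _) (hi _ _)

lemma Fp_cont (hi : ∀ a b, IntervalIntegrable f volume a b) : Continuous (Fp f) :=
  intervalIntegral.continuous_primitive hi 0

lemma Fp_diff (hi : ∀ a b, IntervalIntegrable f volume a b) {j m : ℤ} {x y : ℝ}
    (hx : x ∈ Icc ((m:ℝ) * 2^j) (((m:ℝ)+1) * 2^j)) (hy : y ∈ Icc ((m:ℝ) * 2^j) (((m:ℝ)+1) * 2^j)) :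
    ENNReal.ofReal |Fp f y - Fp f x| ≤ Xf volume f j m := by
  rw [Fp_sub hi]
  have h1 := intervalIntegral.norm_integral_le_integral_norm_uIoc (f := f) (μ := volume) (a := x) (b := y)
  rw [Real.norm_eq_abs] at h1
  refine (ENNReal.ofReal_le_ofReal h1).trans ?_
  rw [ofReal_integral_eq_lintegral_ofReal]
  · unfold Xf cell
    rw [setLIntegral_congr (Ico_ae_eq_Icc (μ := volume) )]
    apply lintegral_mono_set
    exact uIoc_subset_uIcc.trans (uIcc_subset_Icc hx hy)
  · exact ((intervalIntegrable_iff).1 (hi x y)).norm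
  · exact Filter.Eventually.of_forall fun x => norm_nonneg _

lemma EE_le (hi : ∀ a b, IntervalIntegrable f volume a b) (j m : ℤ) :
    ENNReal.ofReal |EE (Fp f) j m| * V j ≤ Xf volume f j m := by
  have hp := p2 j
  have h3 : (m:ℝ) * 2^j ≤ ((m:ℝ)+1) * 2^j := by nlinarith
  refine le_trans (le_of_eq ?_) (Fp_diff hi (j := j) (m := m) (left_mem_Icc.2 h3) (right_mem_Icc.2 h3))
  unfold V EE
  rw [← ENNReal.ofReal_mul (abs_nonneg _), abs_div, abs_of_pos hp, div_mul_cancel₀ _ hp.ne']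

lemma WD.decay0 (h : WD μ c K Q) (hf : Measurable f) (j m : ℤ) (n : ℕ) :
    Xf volume f (j+n) (m/2^n) * μ (cell j m) ≤ V (j+n) * (Q^n * (2 * K * Xt μ f)) := by
  have h2 := h.h2 j (m/2^n) n (cell j m) (measurableSet_cell _ _)
    ((cell_subset j m n).trans (cell_sub_cell2 _ _)) (volume_cell j m).le
  have h1 := (h.cX0 hf (j+n) (m/2^n)).trans (mul_le_mul_right (Xf_le_Xt _ _) K)
  calc _ ≤ Xf volume f (j+n) (m/2^n) * (2 * V (j+n) * Q^n * c (j+n) (m/2^n)) := by gcongr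
    _ = 2 * V (j+n) * Q^n * (c (j+n) (m/2^n) * Xf volume f (j+n) (m/2^n)) := by ring
    _ ≤ 2 * V (j+n) * Q^n * (K * Xt μ f) := by gcongr
    _ = _ := by ring

lemma WD.mu_ne_top (h : WD μ c K Q) (hf : Measurable f) (hX : Xt μ f ≠ ∞) (j m : ℤ)
    (h0 : Xf volume f j m ≠ 0) : μ (cell j m) ≠ ∞ := by
  intro h1
  have h2 := h.decay0 hf j m 0
  simp only [Nat.cast_zero, add_zero, pow_zero, Int.ediv_one, one_mul] at h2
  rw [h1, ENNReal.mul_top h0] at h2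
  exact ENNReal.mul_ne_top (V_ne_top j) (ENNReal.mul_ne_top (ENNReal.mul_ne_top (by simp) h.hK) hX) (top_le_iff.1 h2)

lemma WD.decay (h : WD μ c K Q) (hf : Measurable f) (hX : Xt μ f ≠ ∞) (j m : ℤ) :
    Filter.Tendsto (fun n : ℕ => Xf volume f (j+n) (m/2^n) / V (j+n)) Filter.atTop (𝓝 0) := by
  set D := 2 * K * Xt μ f / μ (cell j m)
  have hD : D ≠ ∞ := ENNReal.div_ne_top (ENNReal.mul_ne_top (ENNReal.mul_ne_top (by simp) h.hK) hX) (h.h4 j m)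
  have h1 : Filter.Tendsto (fun n : ℕ => Q^n * D) Filter.atTop (𝓝 0) := by
    have := ENNReal.Tendsto.mul_const (b := D) (ENNReal.tendsto_pow_atTop_nhds_zero_of_lt_one h.hQ) (Or.inr hD)
    simpa using this
  refine tendsto_of_tendsto_of_tendsto_of_le_of_le tendsto_const_nhds h1 (fun n => bot_le) fun n => ?_
  rw [ENNReal.div_le_iff (V_ne_zero _) (V_ne_top _)]
  by_cases hm : μ (cell j m) = ∞
  · have h2 := h.decay0 hf j m n
    by_cases h0 : Xf volume f (j+n) (m/2^n) = 0
    · rw [h0]; exact bot_le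
    rw [hm, ENNReal.mul_top h0] at h2
    refine absurd (top_le_iff.1 h2) ?_
    refine ENNReal.mul_ne_top (V_ne_top _) (ENNReal.mul_ne_top ?_ (ENNReal.mul_ne_top (ENNReal.mul_ne_top (by simp) h.hK) hX))
    exact ENNReal.pow_ne_top (ne_top_of_lt h.hQ)
  have e : Q^n * D * V (j+n) = V (j+n) * (Q^n * (2 * K * Xt μ f)) / μ (cell j m) := by
    simp only [D, div_eq_mul_inv]; ring
  rw [e, ENNReal.le_div_iff_mul_le (Or.inl (h.h4 j m)) (Or.inl hm)]
  exact h.decay0 hf j m n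

lemma WD.EE_decay (h : WD μ c K Q) (hf : Measurable f) (hX : Xt μ f ≠ ∞) (j m : ℤ) :
    Filter.Tendsto (fun n : ℕ => EE (Fp f) (j+n) (m/2^n)) Filter.atTop (𝓝 0) := by
  rw [tendsto_zero_iff_abs_tendsto_zero]
  have h1 : Filter.Tendsto (fun n : ℕ => ENNReal.ofReal |EE (Fp f) (j+n) (m/2^n)|) Filter.atTop (𝓝 0) := by
    refine tendsto_of_tendsto_of_tendsto_of_le_of_le tendsto_const_nhds (h.decay hf hX j m) (fun n => bot_le) fun n => ?_
    rw [ENNReal.le_div_iff_mul_le (Or.inl (V_ne_zero _)) (Or.inl (V_ne_top _))]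
    exact EE_le (h.intInt hf hX) _ _
  have h2 := (ENNReal.tendsto_toReal ENNReal.zero_ne_top).comp h1
  simpa [Function.comp_def] using h2

end VarW

namespace VarW

variable {μ : Measure ℝ} {c : ℤ → ℤ → ℝ≥0∞} {K Q : ℝ≥0∞} {f : ℝ → ℝ} {l : ℝ≥0∞}

def PP (f : ℝ → ℝ) (l : ℝ≥0∞) (j m : ℤ) : Prop := l * V j < Xf volume f j m
def Se (f : ℝ → ℝ) (l : ℝ≥0∞) (j m : ℤ) : Prop :=
  PP f l j m ∧ ∀ n : ℕ, 1 ≤ n → ¬ PP f l (j+n) (m/2^n)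

lemma anti_Se : Anti (Se f l) := fun _ _ n hn h1 h2 => h1.2 n hn h2.1

lemma anc_anc (j m : ℤ) (n k : ℕ) : j + n + k = j + (n+k:ℕ) ∧ m/2^n/2^k = m/2^(n+k) := by
  constructor
  · push_cast; ring
  · rw [pow_add, Int.ediv_ediv_of_nonneg (by positivity)]

lemma WD.not_PP (h : WD μ c K Q) (hf : Measurable f) (hX : Xt μ f ≠ ∞) (hl : l ≠ 0) (j m : ℤ) :
    ∃ N : ℕ, ∀ n : ℕ, N ≤ n → ¬ PP f l (j+n) (m/2^n) := by
  have h1 := (h.decay hf hX j m).eventually (gt_mem_nhds (pos_iff_ne_zero.2 hl))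
  obtain ⟨N, hN⟩ := Filter.eventually_atTop.1 h1
  refine ⟨N, fun n hn hP => ?_⟩
  have h2 := hN n hn
  rw [ENNReal.div_lt_iff (Or.inl (V_ne_zero _)) (Or.inl (V_ne_top _))] at h2
  exact lt_asymm h2 hP

lemma WD.ex_Se (h : WD μ c K Q) (hf : Measurable f) (hX : Xt μ f ≠ ∞) (hl : l ≠ 0) {j m : ℤ} {n : ℕ}
    (hP : PP f l (j+n) (m/2^n)) : ∃ n : ℕ, Se f l (j+n) (m/2^n) := by
  classical
  obtain ⟨N, hN⟩ := h.not_PP hf hX hl j m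
  have hb : ∀ k, PP f l (j+(k:ℕ)) (m/2^k) → k ≤ N := fun k hk => by
    by_contra hc
    exact hN k (by omega) hk
  let n0 := Nat.findGreatest (fun k : ℕ => PP f l (j+(k:ℕ)) (m/2^k)) N
  have s1 : PP f l (j+(n0:ℕ)) (m/2^n0) := Nat.findGreatest_spec (P := fun k : ℕ => PP f l (j+(k:ℕ)) (m/2^k)) (hb n hP) hP
  refine ⟨n0, s1, fun k hk hP' => ?_⟩
  obtain ⟨e1, e2⟩ := anc_anc j m n0 k
  rw [e1, e2] at hP'
  have := Nat.le_findGreatest (P := fun k : ℕ => PP f l (j+(k:ℕ)) (m/2^k)) (hb _ hP') hP'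
  omega

lemma WD.hE (h : WD μ c K Q) (hf : Measurable f) (hX : Xt μ f ≠ ∞) (hl : l ≠ 0) (j m : ℤ) :
    Filter.Tendsto (fun n : ℕ => EE (GG (Fp f) (Se f l)) (j+n) (m/2^n)) Filter.atTop (𝓝 0) := by
  refine (h.EE_decay hf hX j m).congr' ?_
  obtain ⟨N, hN⟩ := h.not_PP hf hX hl j m
  filter_upwards [Filter.eventually_ge_atTop N] with n hn
  rw [EE_unhalted anti_Se]
  intro k hk
  obtain ⟨e1, e2⟩ := anc_anc j m n k
  rw [e1, e2] at hk
  exact hN _ (by omega) hk.1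

/-- selected cells have averages at most `2l` -/
lemma Se_le {i p : ℤ} (hs : Se f l i p) : Xf volume f i p ≤ 2 * l * V i := by
  have h1 := hs.2 1 le_rfl
  unfold PP at h1
  rw [not_lt] at h1
  have h2 : Xf volume f i p ≤ Xf volume f (i+(1:ℕ)) (p/2^1) := lintegral_mono_set (cell_subset i p 1)
  refine h2.trans (h1.trans (le_of_eq ?_))
  rw [V_add]; ring

lemma EE_Se_le (hi : ∀ a b, IntervalIntegrable f volume a b) {i p : ℤ} (hs : Se f l i p) :
    ENNReal.ofReal |EE (Fp f) i p| ≤ 2 * l := by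
  have h1 := (EE_le hi i p).trans (Se_le hs)
  exact (ENNReal.mul_le_mul_iff_left (V_ne_zero i) (V_ne_top i)).1 h1

lemma not_PP_le (hi : ∀ a b, IntervalIntegrable f volume a b) {i p : ℤ} (hs : ¬ PP f l i p) :
    ENNReal.ofReal |EE (Fp f) i p| ≤ l := by
  have h1 := (EE_le hi i p).trans (not_lt.1 hs)
  exact (ENNReal.mul_le_mul_iff_left (V_ne_zero i) (V_ne_top i)).1 h1

/-- the set of a selected cell, or empty -/
def sc (f : ℝ → ℝ) (l : ℝ≥0∞) (q : ℤ × ℤ) : Set ℝ := {x | Se f l q.1 q.2 ∧ x ∈ cell q.1 q.2}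

lemma sc_pos {q : ℤ × ℤ} (hs : Se f l q.1 q.2) : sc f l q = cell q.1 q.2 := by
  ext x; simp [sc, hs]
lemma sc_neg {q : ℤ × ℤ} (hs : ¬ Se f l q.1 q.2) : sc f l q = ∅ := by
  ext x; simp [sc, hs]

lemma measurableSet_sc (q : ℤ × ℤ) : MeasurableSet (sc f l q) := by
  by_cases hs : Se f l q.1 q.2
  · rw [sc_pos hs]; exact measurableSet_cell _ _
  · rw [sc_neg hs]; exact MeasurableSet.empty

lemma sc_disj : Pairwise (Function.onFun Disjoint (sc f l)) := by
  rintro ⟨i, p⟩ ⟨j, q⟩ hne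
  rw [Function.onFun, Set.disjoint_left]
  rintro x ⟨h1, h1'⟩ ⟨h2, h2'⟩
  simp only at h1 h1' h2 h2'
  rw [mem_cell] at h1' h2'
  rw [← h1'] at h1
  rw [← h2'] at h2
  have e := sel_unique anti_Se h1 h2
  subst e
  apply hne
  rw [← h1', ← h2']

lemma sum_sc (g : ℝ → ℝ≥0∞) : ∑' q, ∫⁻ x in sc f l q, g x ∂μ ≤ ∫⁻ x, g x ∂μ := by
  rw [← lintegral_iUnion measurableSet_sc sc_disj]
  exact setLIntegral_le_lintegral _ _

/-- `∑` over selected cells of the weighted mass -/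
lemma sum_Se {Z : ℤ × ℤ → ℝ≥0∞} {A : ℝ≥0∞} (h0 : ∀ q : ℤ × ℤ, ¬ Se f l q.1 q.2 → Z q = 0)
    (h1 : ∀ q : ℤ × ℤ, Se f l q.1 q.2 → Z q ≤ A * Xf μ f q.1 q.2) : ∑' q, Z q ≤ A * Xt μ f := by
  refine le_trans ?_ (mul_le_mul_right (sum_sc (μ := μ) (f := f) (l := l) (fun x => ENNReal.ofReal |f x|)) A)
  rw [← ENNReal.tsum_mul_left]
  refine ENNReal.tsum_le_tsum fun q => ?_
  by_cases hs : Se f l q.1 q.2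
  · rw [sc_pos hs]; exact h1 q hs
  · rw [h0 q hs]; exact bot_le

lemma WD.ej_le (h : WD μ c K Q) (hf : Measurable f) (hX : Xt μ f ≠ ∞) (hl : l ≠ 0) (j : ℤ) :
    ej c (GG (Fp f) (Se f l)) j ≤ 2 * l * (K + 2 * K^2) * Xt μ f := by
  classical
  have hi := h.intInt hf hX
  set G := GG (Fp f) (Se f l)
  -- contribution of selected cells
  let st : ℤ → ℤ × ℤ → ℝ≥0∞ := fun m q =>
    if Se f l q.1 q.2 ∧ cell j m ⊆ cell q.1 q.2 then
      2 * l * K * ENNReal.ofReal |EE (Fp f) q.1 q.2| * μ (cell j m) else 0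
  have key : ∀ m, V j * ENNReal.ofReal |EE G j m| ^ 2 * U c j m ≤
      2 * l * K * Xf μ f j m + ∑' q, st m q := by
    intro m
    by_cases hs : ∃ n : ℕ, Se f l (j+n) (m/2^n)
    · obtain ⟨n, hn⟩ := hs
      refine le_trans ?_ (le_add_left (ENNReal.le_tsum (j+n, m/2^n)))
      simp only [st]
      rw [if_pos ⟨hn, cell_subset j m n⟩, EE_halted anti_Se hn]
      set e := ENNReal.ofReal |EE (Fp f) (j+n) (m/2^n)|
      calc V j * e^2 * U c j m = e * e * (U c j m * V j) := by ring
        _ ≤ (2 * l) * e * (K * μ (cell j m)) := by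
            exact mul_le_mul' (mul_le_mul' (EE_Se_le hi hn) le_rfl) (h.hU1 j m)
        _ = _ := by ring
    · push Not at hs
      refine le_trans ?_ le_self_add
      rw [EE_unhalted anti_Se hs]
      have hP : ¬ PP f l j m := by
        intro hP
        obtain ⟨n, hn⟩ := h.ex_Se hf hX hl (j := j) (m := m) (n := 0) (by simpa using hP)
        exact hs n hn
      set e := ENNReal.ofReal |EE (Fp f) j m|
      calc V j * e^2 * U c j m = e * (U c j m * (e * V j)) := by ring
        _ ≤ l * (U c j m * Xf volume f j m) := by
            gcongr
            · exact not_PP_le hi hP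
            · exact EE_le hi j m
        _ ≤ l * (K * Xf μ f j m) := by
            exact mul_le_mul' le_rfl (h.hU j m _ (meas_abs hf))
        _ ≤ 2 * (l * (K * Xf μ f j m)) := by
            rw [two_mul]; exact le_self_add
        _ = _ := by ring
  have k1 : ∑' m, Xf μ f j m = Xt μ f := (lintegral_cells μ j _).symm
  have k2 : ∑' q, ∑' m, st m q ≤ 4 * l * K^2 * Xt μ f := by
    apply sum_Se (l := l)
    · intro q hq
      simp [st, hq]
    · intro q hq
      have a1 : ∀ m, st m q ≤ 2 * l * K * ENNReal.ofReal |EE (Fp f) q.1 q.2| * μ (cell j m ∩ cell q.1 q.2) := by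
        intro m
        simp only [st]
        split_ifs with h1
        · rw [inter_eq_self_of_subset_left h1.2]
        · exact bot_le
      have a2 : ∑' m, μ (cell j m ∩ cell q.1 q.2) = μ (cell q.1 q.2) := by
        have := lintegral_cells μ j ((cell q.1 q.2).indicator 1)
        rw [lintegral_indicator_one (measurableSet_cell _ _)] at this
        rw [this]
        refine tsum_congr fun m => ?_
        rw [lintegral_indicator_one (measurableSet_cell _ _),
          Measure.restrict_apply (measurableSet_cell _ _), inter_comm]
      calc ∑' m, st m q ≤ 2 * l * K * ENNReal.ofReal |EE (Fp f) q.1 q.2| * μ (cell q.1 q.2) := by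
            rw [← a2, ← ENNReal.tsum_mul_left]
            exact ENNReal.tsum_le_tsum a1
        _ ≤ 2 * l * K * ENNReal.ofReal |EE (Fp f) q.1 q.2| * (2 * V q.1 * c q.1 q.2) := by
            gcongr
            exact (measure_mono (cell_sub_cell2 _ _)).trans (h.h3 _ _)
        _ = 4 * l * K * (c q.1 q.2 * (ENNReal.ofReal |EE (Fp f) q.1 q.2| * V q.1)) := by ring
        _ ≤ 4 * l * K * (c q.1 q.2 * Xf volume f q.1 q.2) := by
            gcongr
            exact EE_le hi _ _
        _ ≤ 4 * l * K * (K * Xf μ f q.1 q.2) := by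
            exact mul_le_mul' le_rfl (h.cX0 hf _ _)
        _ = _ := by ring
  calc ej c G j ≤ ∑' m, (2 * l * K * Xf μ f j m + ∑' q, st m q) := ENNReal.tsum_le_tsum key
    _ = 2 * l * K * Xt μ f + ∑' q, ∑' m, st m q := by
        rw [ENNReal.tsum_add, ENNReal.tsum_mul_left, k1, ENNReal.tsum_comm]
    _ ≤ 2 * l * K * Xt μ f + 4 * l * K^2 * Xt μ f := by gcongr
    _ = _ := by ring

/-- exceptional set -/
def Om (f : ℝ → ℝ) (l : ℝ≥0∞) : Set ℝ := ⋃ q : ℤ × ℤ, {x | Se f l q.1 q.2 ∧ x ∈ cell2 q.1 q.2}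

lemma WD.Om_le (h : WD μ c K Q) (hf : Measurable f) :
    l * μ (Om f l) ≤ 2 * K * Xt μ f := by
  refine (mul_le_mul_right (measure_iUnion_le _) l).trans ?_
  rw [← ENNReal.tsum_mul_left]
  apply sum_Se (f := f) (l := l)
  · intro q hq; simp [hq]
  · intro q hq
    have e : {x | Se f l q.1 q.2 ∧ x ∈ cell2 q.1 q.2} = cell2 q.1 q.2 := by ext x; simp [hq]
    rw [e]
    calc l * μ (cell2 q.1 q.2) ≤ l * (2 * V q.1 * c q.1 q.2) := by gcongr; exact h.h3 _ _
      _ = 2 * (c q.1 q.2 * (l * V q.1)) := by ring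
      _ ≤ 2 * (c q.1 q.2 * Xf volume f q.1 q.2) := by gcongr; exact hq.1.le
      _ ≤ 2 * (K * Xf μ f q.1 q.2) := mul_le_mul' le_rfl (h.cX0 hf _ _)
      _ = _ := by ring

end VarW

namespace VarW

variable {μ : Measure ℝ} {c : ℤ → ℤ → ℝ≥0∞} {K Q : ℝ≥0∞} {f : ℝ → ℝ} {l : ℝ≥0∞}

noncomputable def Bb (f : ℝ → ℝ) (l : ℝ≥0∞) (x : ℝ) : ℝ := Fp f x - GG (Fp f) (Se f l) x

lemma Bb_not {x : ℝ} (hx : ∀ j, ¬ Se f l j (idx j x)) : Bb f l x = 0 := by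
  unfold Bb; rw [G_not hx, sub_self]

lemma Bb_zero {x : ℝ} (hx : x ∉ Om f l) : Bb f l x = 0 := by
  apply Bb_not
  intro j hj
  exact hx (mem_iUnion.2 ⟨(j, idx j x), hj, cell_sub_cell2 _ _ (mem_cell_idx j x)⟩)

lemma Bb_le (hi : ∀ a b, IntervalIntegrable f volume a b) {i p : ℤ} (hs : Se f l i p) {x : ℝ}
    (hx : x ∈ cell i p) : ENNReal.ofReal |Bb f l x| ≤ 2 * Xf volume f i p := by
  unfold Bb
  have hp := p2 i
  have h3 : (p:ℝ) * 2^i ≤ ((p:ℝ)+1) * 2^i := by nlinarith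
  rw [G_lin anti_Se hs hx.1 hx.2.le]
  have a1 : |Fp f x - (Fp f (p * 2^i) + (x - p * 2^i) * EE (Fp f) i p)| ≤
      |Fp f x - Fp f (p * 2^i)| + |EE (Fp f) i p| * 2^i := by
    have : Fp f x - (Fp f (p * 2^i) + (x - p * 2^i) * EE (Fp f) i p) =
      (Fp f x - Fp f (p * 2^i)) - (x - p * 2^i) * EE (Fp f) i p := by ring
    rw [this]
    refine (abs_sub _ _).trans ?_
    rw [abs_mul, mul_comm |x - _|]
    gcongr
    rw [abs_of_nonneg (by linarith [hx.1])]
    have := hx.2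
    linarith
  refine (ENNReal.ofReal_le_ofReal a1).trans ?_
  rw [ENNReal.ofReal_add (abs_nonneg _) (by positivity), ENNReal.ofReal_mul (abs_nonneg _), two_mul]
  exact add_le_add (Fp_diff hi (left_mem_Icc.2 h3) ⟨hx.1, hx.2.le⟩) (EE_le hi i p)

noncomputable def hb (f : ℝ → ℝ) (l : ℝ≥0∞) (q : ℤ × ℤ) (n : ℕ) : ℝ → ℝ≥0∞ :=
  ((fun x => x + (2:ℝ)^(q.1+n)) ⁻¹' (sc f l q)).indicator
    (fun _ => 2 * Xf volume f q.1 q.2 * (V (q.1+n))⁻¹)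

noncomputable def HB (f : ℝ → ℝ) (l : ℝ≥0∞) (x : ℝ) : ℝ≥0∞ := ∑' q, ∑' n, hb f l q n x

lemma meas_pre (q : ℤ × ℤ) (n : ℕ) : MeasurableSet ((fun x => x + (2:ℝ)^(q.1+n)) ⁻¹' (sc f l q)) :=
  (measurable_id.add_const _) (measurableSet_sc q)

lemma measurable_hb (q : ℤ × ℤ) (n : ℕ) : Measurable (hb f l q n) :=
  measurable_const.indicator (meas_pre q n)

lemma measurable_HB : Measurable (HB f l) :=
  Measurable.tsum fun q => Measurable.tsum fun n => measurable_hb q n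

lemma WD.int_HB (h : WD μ c K Q) (hf : Measurable f) :
    ∫⁻ x, HB f l x ∂μ ≤ (4 * K * (1 - Q)⁻¹) * Xt μ f := by
  unfold HB
  rw [lintegral_tsum fun q => (Measurable.tsum fun n => measurable_hb q n).aemeasurable]
  have e : ∀ q, ∫⁻ x, ∑' n, hb f l q n x ∂μ = ∑' n, ∫⁻ x, hb f l q n x ∂μ := fun q =>
    lintegral_tsum fun n => (measurable_hb q n).aemeasurable
  simp_rw [e]
  apply sum_Se (f := f) (l := l)
  · intro q hq
    simp [hb, sc_neg hq]
  · intro q hq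
    rw [← ENNReal.tsum_geometric, ← ENNReal.tsum_mul_left, ← ENNReal.tsum_mul_right]
    refine ENNReal.tsum_le_tsum fun n => ?_
    unfold hb
    rw [lintegral_indicator_const (meas_pre q n), sc_pos hq]
    have a1 := h.h2 q.1 (q.2/2^n) n ((fun x => x + (2:ℝ)^(q.1+n)) ⁻¹' (cell q.1 q.2))
      ((measurable_id.add_const _) (measurableSet_cell _ _))
      (fun x hx => sub_mem_cell2 _ _ _ _ hx) (by rw [measure_preimage_add_right, volume_cell])
    calc _ ≤ 2 * Xf volume f q.1 q.2 * (V (q.1+n))⁻¹ * (2 * V (q.1+n) * Q^n * c (q.1+n) (q.2/2^n)) :=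
          mul_le_mul' le_rfl a1
      _ = 4 * Q^n * ((V (q.1+n))⁻¹ * V (q.1+n)) * (c (q.1+n) (q.2/2^n) * Xf volume f q.1 q.2) := by ring
      _ = 4 * Q^n * (c (q.1+n) (q.2/2^n) * Xf volume f q.1 q.2) := by
          rw [ENNReal.inv_mul_cancel (V_ne_zero _) (V_ne_top _), mul_one]
      _ ≤ 4 * Q^n * (K * Xf μ f q.1 q.2) := mul_le_mul' le_rfl (h.cX hf _ _ _)
      _ = _ := by ring

lemma AGB_le (hi : ∀ a b, IntervalIntegrable f volume a b) {x : ℝ} (hx : x ∉ Om f l) (k : ℤ) :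
    ENNReal.ofReal |AG (Bb f l) k x| ≤ ∑' q : ℤ × ℤ, ∑' n : ℕ, (if k = q.1 + n then hb f l q n x else 0) := by
  unfold AG
  rw [Bb_zero hx, sub_zero]
  by_cases hs : ∃ j, Se f l j (idx j (x+2^k))
  · obtain ⟨i, hi'⟩ := hs
    set p := idx i (x+2^k) with hp
    have hc : x + 2^k ∈ cell i p := mem_cell_idx _ _
    have hik : i ≤ k := by
      by_contra hlt
      push Not at hlt
      apply hx
      refine mem_iUnion.2 ⟨(i, p), hi', ?_⟩
      have h2 : (2:ℝ)^k ≤ 2^i := zpow_le_zpow_right₀ (by norm_num) hlt.le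
      have := p2 k
      unfold cell at hc
      unfold cell2
      simp only
      constructor
      · have := hc.1; linarith
      · have := hc.2; linarith
    obtain ⟨n, rfl⟩ : ∃ n : ℕ, k = i + n := ⟨(k-i).toNat, by omega⟩
    refine le_trans ?_ (ENNReal.le_tsum (i, p))
    refine le_trans ?_ (ENNReal.le_tsum n)
    simp only [if_true]
    unfold hb
    rw [indicator_of_mem]
    · rw [abs_div, abs_of_pos (p2 _), ENNReal.ofReal_div_of_pos (p2 _), div_eq_mul_inv]
      exact mul_le_mul' (Bb_le hi hi' hc) le_rfl
    · exact ⟨hi', hc⟩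
  · rw [Bb_not (by simpa using hs)]
    simp

lemma sum_AGB (hi : ∀ a b, IntervalIntegrable f volume a b) {x : ℝ} (hx : x ∉ Om f l) :
    ∑' k, ENNReal.ofReal |AG (Bb f l) k x| ≤ HB f l x := by
  refine (ENNReal.tsum_le_tsum (AGB_le hi hx)).trans (le_of_eq ?_)
  rw [ENNReal.tsum_comm]
  refine tsum_congr fun q => ?_
  rw [ENNReal.tsum_comm]
  refine tsum_congr fun n => ?_
  rw [tsum_ite_eq]

lemma sum_sq_le (b : ℤ → ℝ≥0∞) : ∑' k, b k ^ 2 ≤ (∑' k, b k)^2 := by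
  rw [sq (∑' k, b k), ← ENNReal.tsum_mul_left]
  refine ENNReal.tsum_le_tsum fun k => ?_
  rw [sq]
  exact mul_le_mul' (ENNReal.le_tsum k) le_rfl

lemma WD.sum_T (h : WD μ c K Q) (hf : Measurable f) (hX : Xt μ f ≠ ∞) (hl : l ≠ 0) {x : ℝ} (hx : x ∉ Om f l) :
    2 * ∑' k, ENNReal.ofReal |AG (Fp f) (k+1) x - AG (Fp f) k x| ^ 2 ≤
      4 * HG (GG (Fp f) (Se f l)) x + (4 * HB f l x)^2 := by
  have hi := h.intInt hf hX
  set G := GG (Fp f) (Se f l)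
  let b : ℤ → ℝ≥0∞ := fun k => ENNReal.ofReal |AG (Bb f l) (k+1) x - AG (Bb f l) k x|
  have hb : ∑' k, b k ≤ 2 * HB f l x := by
    have : ∀ k, b k ≤ ENNReal.ofReal |AG (Bb f l) (k+1) x| + ENNReal.ofReal |AG (Bb f l) k x| := fun k => by
      rw [← ENNReal.ofReal_add (abs_nonneg _) (abs_nonneg _)]
      exact ENNReal.ofReal_le_ofReal (abs_sub _ _)
    refine (ENNReal.tsum_le_tsum this).trans ?_
    rw [ENNReal.tsum_add, tsum_shift (fun k => ENNReal.ofReal |AG (Bb f l) k x|) 1, two_mul]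
    exact add_le_add (sum_AGB hi hx) (sum_AGB hi hx)
  have hG := T_le_HG G (G_tendsto anti_Se (Fp_cont hi)) (h.hE hf hX hl) x
  have ht : ∀ k, ENNReal.ofReal |AG (Fp f) (k+1) x - AG (Fp f) k x| ^ 2 ≤
      2 * (ENNReal.ofReal |AG G (k+1) x - AG G k x| ^ 2 + b k ^ 2) := fun k => by
    refine le_trans ?_ (sq_add_le _ _)
    gcongr
    rw [← ENNReal.ofReal_add (abs_nonneg _) (abs_nonneg _)]
    apply ENNReal.ofReal_le_ofReal
    refine le_trans (le_of_eq ?_) (abs_add_le _ _)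
    congr 1
    unfold AG Bb
    ring
  calc _ ≤ 2 * ∑' k, (2 * (ENNReal.ofReal |AG G (k+1) x - AG G k x| ^ 2 + b k ^ 2)) :=
        mul_le_mul' le_rfl (ENNReal.tsum_le_tsum ht)
    _ = 4 * (∑' k, ENNReal.ofReal |AG G (k+1) x - AG G k x| ^ 2) + 4 * ∑' k, b k ^ 2 := by
        rw [ENNReal.tsum_mul_left, ENNReal.tsum_add]; ring
    _ ≤ 4 * HG G x + 4 * (2 * HB f l x)^2 :=
        add_le_add (mul_le_mul' le_rfl hG) (mul_le_mul' le_rfl ((sum_sq_le b).trans (by gcongr)))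
    _ = _ := by ring

noncomputable def CC (K Q : ℝ≥0∞) : ℝ≥0∞ :=
  2 * K + 4 * ((16 * (SS 2⁻¹ * 2 + SS Q * 16) + 4) * (2 * (K + 2 * K^2))) + 4 * (4 * K * (1 - Q)⁻¹)

lemma CC_ne_top (hK : K ≠ ∞) (hQ : Q < 1) : CC K Q ≠ ∞ := by
  have h1 := SS_ne_top Q hQ
  have h2 := SS_ne_top 2⁻¹ (by simp)
  have h3 : (1 - Q)⁻¹ ≠ ∞ := ENNReal.inv_ne_top.2 (tsub_pos_of_lt hQ).ne'
  unfold CC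
  finiteness

theorem WD.weak (h : WD μ c K Q) (hf : Measurable f) (hX : Xt μ f ≠ ∞) (hl : l ≠ 0) (hl' : l ≠ ∞) :
    l * μ {x | l^2 < ∑' k, ENNReal.ofReal |AG (Fp f) (k+1) x - AG (Fp f) k x| ^ 2} ≤ CC K Q * Xt μ f := by
  set G := GG (Fp f) (Se f l)
  have hsub : {x | l^2 < ∑' k, ENNReal.ofReal |AG (Fp f) (k+1) x - AG (Fp f) k x| ^ 2} ⊆
      Om f l ∪ {x | l^2 ≤ 4 * HG G x} ∪ {x | l ≤ 4 * HB f l x} := by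
    intro x hx
    by_contra hc
    simp only [mem_union, mem_ofPred_eq, not_or, not_le] at hc
    obtain ⟨⟨c1, c2⟩, c3⟩ := hc
    have h1 := h.sum_T hf hX hl c1
    have h2 : 4 * HG G x + (4 * HB f l x)^2 ≤ 2 * l^2 := by
      rw [two_mul]
      exact add_le_add c2.le (by gcongr)
    have h3 := (ENNReal.mul_le_mul_iff_right (by simp) (by simp)).1 (h1.trans h2)
    exact absurd hx (not_lt.2 h3)
  have e1 := h.Om_le (l := l) hf
  have e2 : l * μ {x | l^2 ≤ 4 * HG G x} ≤ 4 * ((16 * (SS 2⁻¹ * 2 + SS Q * 16) + 4) * (2 * (K + 2 * K^2))) * Xt μ f := by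
    have a1 := mul_meas_ge_le_lintegral (μ := μ) ((measurable_HG G).const_mul 4) (l^2)
    rw [lintegral_const_mul _ (measurable_HG G)] at a1
    have a2 := a1.trans (mul_le_mul' le_rfl (int_HG h G _ (h.ej_le hf hX hl)))
    refine (ENNReal.mul_le_mul_iff_right hl hl').1 ?_
    calc l * (l * μ {x | l^2 ≤ 4 * HG G x}) = l^2 * μ {x | l^2 ≤ 4 * HG G x} := by ring
      _ ≤ _ := a2
      _ = _ := by ring
  have e3 : l * μ {x | l ≤ 4 * HB f l x} ≤ 4 * (4 * K * (1 - Q)⁻¹) * Xt μ f := by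
    have a1 := mul_meas_ge_le_lintegral (μ := μ) ((measurable_HB (f := f) (l := l)).const_mul 4) l
    rw [lintegral_const_mul _ measurable_HB] at a1
    refine a1.trans ((mul_le_mul' le_rfl (h.int_HB hf)).trans (le_of_eq (by ring)))
  calc _ ≤ l * (μ (Om f l) + μ {x | l^2 ≤ 4 * HG G x} + μ {x | l ≤ 4 * HB f l x}) := by
        refine mul_le_mul' le_rfl ((measure_mono hsub).trans ((measure_union_le _ _).trans ?_))
        gcongr
        exact measure_union_le _ _
    _ = l * μ (Om f l) + l * μ {x | l^2 ≤ 4 * HG G x} + l * μ {x | l ≤ 4 * HB f l x} := by ring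
    _ ≤ _ := add_le_add (add_le_add e1 e2) e3
    _ = _ := by unfold CC; ring

end VarW

namespace VarW

lemma Aop_eq {f : ℝ → ℝ} (hi : ∀ a b, IntervalIntegrable f volume a b) (n : ℤ) (x : ℝ) :
    Aop n f x = AG (Fp f) n x := by
  unfold Aop AG
  rw [Fp_sub hi, div_eq_inv_mul]

lemma Vop_lt {f : ℝ → ℝ} (hi : ∀ a b, IntervalIntegrable f volume a b) {s lam : ℝ} (hs : 2 ≤ s)
    (hlam : 0 < lam) {x : ℝ} (hx : lam < Vop s f x) :
    ENNReal.ofReal lam ^ 2 < ∑' k, ENNReal.ofReal |AG (Fp f) (k+1) x - AG (Fp f) k x| ^ 2 := by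
  let a : ℤ → ℝ := fun n => |Aop n f x - Aop (n-1) f x|
  have ha : ∀ n, 0 ≤ a n := fun n => abs_nonneg _
  have e : ∑' k, ENNReal.ofReal |AG (Fp f) (k+1) x - AG (Fp f) k x| ^ 2 = ∑' n, ENNReal.ofReal (a n) ^ 2 := by
    rw [← tsum_shift (fun n => ENNReal.ofReal (a n) ^ 2) 1]
    refine tsum_congr fun k => ?_
    simp only [a, Aop_eq hi, add_sub_cancel_right]
  rw [e]
  by_contra hc
  rw [not_lt] at hc
  have hs0 : 0 < s := by linarith
  have hsum : Summable fun n => a n ^ s := by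
    by_contra hns
    unfold Vop at hx
    rw [tsum_eq_zero_of_not_summable hns, Real.zero_rpow (by positivity)] at hx
    linarith
  have hal : ∀ n, a n ≤ lam := fun n => by
    have h1 := (ENNReal.le_tsum (f := fun n => ENNReal.ofReal (a n) ^ 2) n).trans hc
    have h2 := (ENNReal.pow_le_pow_left_iff two_ne_zero).1 h1
    exact (ENNReal.ofReal_le_ofReal_iff hlam.le).1 h2
  have hle : ∀ n, a n ^ s ≤ lam ^ (s-2) * a n ^ 2 := fun n => by
    rcases (ha n).eq_or_lt with h0 | h0
    · rw [← h0, Real.zero_rpow hs0.ne']; simp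
    · have : a n ^ s = a n ^ (s-2) * a n ^ 2 := by
        rw [← Real.rpow_natCast (a n) 2, ← Real.rpow_add h0]; congr 1; push_cast; ring
      rw [this]
      exact mul_le_mul_of_nonneg_right (Real.rpow_le_rpow h0.le (hal n) (by linarith)) (sq_nonneg _)
  have hS : ∑' n, a n ^ s ≤ lam ^ s := by
    rw [← ENNReal.ofReal_le_ofReal_iff (by positivity),
      ENNReal.ofReal_tsum_of_nonneg (fun n => Real.rpow_nonneg (ha n) s) hsum]
    calc _ ≤ ∑' n, ENNReal.ofReal (lam ^ (s-2)) * ENNReal.ofReal (a n) ^ 2 := by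
          refine ENNReal.tsum_le_tsum fun n => ?_
          rw [← ENNReal.ofReal_pow (ha n), ← ENNReal.ofReal_mul (by positivity)]
          exact ENNReal.ofReal_le_ofReal (hle n)
      _ ≤ ENNReal.ofReal (lam ^ (s-2)) * ENNReal.ofReal lam ^ 2 := by
          rw [ENNReal.tsum_mul_left]
          exact mul_le_mul' le_rfl hc
      _ = _ := by
          rw [← ENNReal.ofReal_pow hlam.le, ← ENNReal.ofReal_mul (by positivity)]
          congr 1
          rw [← Real.rpow_natCast lam 2, ← Real.rpow_add hlam]; congr 1; push_cast; ring
  have h3 : Vop s f x ≤ (lam ^ s) ^ (1/s) := by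
    unfold Vop
    exact Real.rpow_le_rpow (tsum_nonneg fun n => Real.rpow_nonneg (ha n) s) hS (by positivity)
  rw [← Real.rpow_mul hlam.le, mul_one_div_cancel hs0.ne', Real.rpow_one] at h3
  linarith

noncomputable def av (v : ℝ → ℝ) (j m : ℤ) : ℝ :=
  ((((m:ℝ)+1) * 2^j) - (((m:ℝ)-1) * 2^j))⁻¹ * ∫ t in (((m:ℝ)-1) * 2^j)..(((m:ℝ)+1) * 2^j), v t

lemma len2 (j m : ℤ) : (((m:ℝ)+1) * 2^j) - (((m:ℝ)-1) * 2^j) = 2 * 2^j := by ring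

lemma volume_cell2 (j m : ℤ) : volume (cell2 j m) = 2 * V j := by
  unfold cell2 V
  rw [Real.volume_Ico, len2, ENNReal.ofReal_mul (by norm_num)]; simp

theorem mkWD {r r' : ℝ} (hr : 1 < r) (hrr' : 1/r + 1/r' = 1)
    {w : ℝ → ℝ} (hwpos : ∀ x, 0 < w x) (hw : IsA1Weight (fun x => w x ^ r')) :
    AEMeasurable w ∧ ∃ c K Q, WD (volume.withDensity fun x => ENNReal.ofReal (w x)) c K Q := by
  obtain ⟨hv, hloc, C, hC, hA⟩ := hw
  have hpq : r.HolderConjugate r' := by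
    rw [Real.holderConjugate_iff]; exact ⟨hr, by simpa using hrr'⟩
  have hr0 : 0 < r := hpq.pos
  have hr'0 : 0 < r' := hpq.symm.pos
  have hm : AEMeasurable w := by
    have h1 := hloc.aestronglyMeasurable.aemeasurable.pow_const (1/r')
    refine h1.congr (Filter.Eventually.of_forall fun x => ?_)
    simp only
    rw [← Real.rpow_mul (hwpos x).le, mul_one_div_cancel hr'0.ne', Real.rpow_one]
  refine ⟨hm, ?_⟩
  have hW : AEMeasurable (fun x => ENNReal.ofReal (w x)) := hm.ennreal_ofReal
  set v : ℝ → ℝ := fun x => w x ^ r' with hvdef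
  set μ := volume.withDensity fun x => ENNReal.ofReal (w x) with hμ
  have hint : ∀ j m, ∫⁻ x in cell2 j m, ENNReal.ofReal (w x) ^ r' = 2 * V j * ENNReal.ofReal (av v j m) := by
    intro j m
    have hp := p2 j
    have hle : ((m:ℝ)-1) * 2^j ≤ ((m:ℝ)+1) * 2^j := by nlinarith
    unfold av V
    rw [len2]
    have e2 : (2:ℝ≥0∞) = ENNReal.ofReal 2 := by simp
    rw [e2, ← ENNReal.ofReal_mul (by norm_num), ← ENNReal.ofReal_mul (by positivity),
      ← mul_assoc, mul_inv_cancel₀ (by positivity), one_mul, intervalIntegral.integral_of_le hle,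
      integral_Ioc_eq_integral_Ioo, ← integral_Ico_eq_integral_Ioo, ofReal_integral_eq_lintegral_ofReal]
    · refine lintegral_congr fun x => ?_
      rw [ENNReal.ofReal_rpow_of_pos (hwpos x)]
    · exact (hloc.integrableOn_isCompact isCompact_Icc).mono_set Ico_subset_Icc_self
    · exact Filter.Eventually.of_forall fun x => (hv x).le
  let c : ℤ → ℤ → ℝ≥0∞ := fun j m => ENNReal.ofReal (av v j m) ^ (1/r')
  have hold : ∀ j m S, MeasurableSet S → S ⊆ cell2 j m →
      μ S ≤ volume S ^ (1/r) * ((2 * V j) ^ (1/r') * c j m) := by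
    intro j m S hS hsub
    rw [hμ, withDensity_apply _ hS]
    have h1 := ENNReal.lintegral_mul_le_Lp_mul_Lq (volume.restrict S) hpq
      (f := fun _ => 1) (g := fun x => ENNReal.ofReal (w x)) aemeasurable_const hW.restrict
    simp only [Pi.mul_apply, one_mul, ENNReal.one_rpow, lintegral_const, Measure.restrict_apply_univ] at h1
    refine h1.trans (mul_le_mul' le_rfl ?_)
    rw [← ENNReal.mul_rpow_of_nonneg _ _ (by positivity), ← hint]
    gcongr
  have hrsum : 1/r + 1/r' = 1 := hrr'
  refine ⟨c, ENNReal.ofReal (C ^ (1/r')), (2:ℝ≥0∞) ^ (-(1/r)), by simp, ?_, ?_, ?_, ?_, ?_, ?_⟩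
  · simp [ENNReal.rpow_eq_zero_iff]
  · exact ENNReal.rpow_lt_one_of_one_lt_of_neg (by norm_num) (by simp [hr0])
  · intro j m F hF
    have hp := p2 j
    rw [hμ, restrict_withDensity (measurableSet_cell j m),
      lintegral_withDensity_eq_lintegral_mul₀ hW.restrict hF.aemeasurable,
      ← lintegral_const_mul _ hF, ← lintegral_const_mul' _ _ (by simp)]
    apply lintegral_mono_ae
    have := hA (((m:ℝ)-1) * 2^j) (((m:ℝ)+1) * 2^j) (by nlinarith)
    filter_upwards [ae_restrict_of_ae this, ae_restrict_mem (measurableSet_cell j m)] with x hx hxm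
    have hx := hx (Ico_subset_Icc_self (cell_sub_cell2 _ _ hxm))
    simp only [Pi.mul_apply]
    rw [← mul_assoc]
    refine mul_le_mul' ?_ le_rfl
    simp only [c]
    have hx' : av v j m ≤ C * w x ^ r' := hx
    rw [← ENNReal.ofReal_mul (by positivity)]
    refine (ENNReal.rpow_le_rpow (ENNReal.ofReal_le_ofReal hx') (by positivity)).trans (le_of_eq ?_)
    rw [ENNReal.ofReal_rpow_of_pos (by have := hv x; positivity), Real.mul_rpow hC.le (hv x).le,
      ← Real.rpow_mul (hwpos x).le, mul_one_div_cancel hr'0.ne', Real.rpow_one]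
  · intro j m n S hS hsub hvol
    refine (hold _ _ S hS hsub).trans ?_
    have e1 : V j = V (j+n) * (2:ℝ≥0∞) ^ (-(n:ℝ)) := by
      rw [V_add, ENNReal.rpow_neg, ENNReal.rpow_natCast, mul_assoc,
        ENNReal.mul_inv_cancel (by simp) (by simp), mul_one]
    have e2 : ((2:ℝ≥0∞) ^ (-(n:ℝ))) ^ (1/r) = ((2:ℝ≥0∞) ^ (-(1/r)))^n := by
      rw [← ENNReal.rpow_mul, ← ENNReal.rpow_natCast, ← ENNReal.rpow_mul]; congr 1; ring
    have e3 : (2:ℝ≥0∞) ^ (1/r') ≤ 2 := by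
      conv_rhs => rw [← ENNReal.rpow_one 2]
      apply ENNReal.rpow_le_rpow_of_exponent_le (by norm_num)
      have : 0 < 1/r := by positivity
      linarith
    have e4 : V (j+n) ^ (1/r) * V (j+n) ^ (1/r') = V (j+n) := by
      rw [← ENNReal.rpow_add _ _ (V_ne_zero _) (V_ne_top _), hrsum, ENNReal.rpow_one]
    calc volume S ^ (1/r) * ((2 * V (j+n)) ^ (1/r') * c (j+n) m)
        ≤ (V (j+n) * (2:ℝ≥0∞) ^ (-(n:ℝ))) ^ (1/r) * ((2 * V (j+n)) ^ (1/r') * c (j+n) m) := by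
          rw [← e1]; gcongr
      _ = 2 ^ (1/r') * (V (j+n) ^ (1/r) * V (j+n) ^ (1/r')) * ((2:ℝ≥0∞) ^ (-(1/r)))^n * c (j+n) m := by
          rw [ENNReal.mul_rpow_of_nonneg _ _ (by positivity), ENNReal.mul_rpow_of_nonneg _ _ (by positivity), e2]
          ring
      _ ≤ _ := by rw [e4]; gcongr
  · intro j m
    refine (hold _ _ _ (measurableSet_cell2 j m) subset_rfl).trans (le_of_eq ?_)
    rw [volume_cell2, ← mul_assoc, ← ENNReal.rpow_add _ _ (by simp [V_ne_zero]) (ENNReal.mul_ne_top (by simp) (V_ne_top _)),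
      hrsum, ENNReal.rpow_one]
  · intro j m h0
    have hac : volume ≪ μ := withDensity_absolutelyContinuous' hW
      (Filter.Eventually.of_forall fun x => by simp [hwpos x])
    have := hac h0
    rw [volume_cell] at this
    exact V_ne_zero j this

end VarW

theorem stmt11 (s r r' : ℝ) (hs : 2 ≤ s) (hr : 1 < r) (hrr' : 1/r + 1/r' = 1)
    (w : ℝ → ℝ) (hwpos : ∀ x, 0 < w x)
    (hw : IsA1Weight (fun x => w x ^ r')) :
    ∃ C > 0, ∀ f : ℝ → ℝ, Measurable f → ∀ lam : ℝ, 0 < lam →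
      ∫⁻ x in {x : ℝ | lam < Vop s f x}, ENNReal.ofReal (w x)
        ≤ ENNReal.ofReal (C / lam) * ∫⁻ x : ℝ, ENNReal.ofReal (|f x| * w x) := by
  obtain ⟨hm, c, K, Q, h⟩ := VarW.mkWD hr hrr' hwpos hw
  have hT := VarW.CC_ne_top h.hK h.hQ
  refine ⟨(VarW.CC K Q).toReal + 1, by positivity, fun f hf lam hlam => ?_⟩
  set μ := volume.withDensity fun x => ENNReal.ofReal (w x) with hμ
  have hX : VarW.Xt μ f = ∫⁻ x : ℝ, ENNReal.ofReal (|f x| * w x) := by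
    unfold VarW.Xt
    rw [hμ, lintegral_withDensity_eq_lintegral_mul₀ hm.ennreal_ofReal (VarW.meas_abs hf).aemeasurable]
    refine lintegral_congr fun x => ?_
    rw [Pi.mul_apply, mul_comm, ENNReal.ofReal_mul (abs_nonneg _)]
  rw [← hX, ← withDensity_apply' , ← hμ]
  by_cases hXt : VarW.Xt μ f = ⊤
  · rw [hXt, ENNReal.mul_top]
    · exact le_top
    · have : 0 < ((VarW.CC K Q).toReal + 1) / lam := by positivity
      simpa using this
  have hi := h.intInt hf hXt
  have hl : ENNReal.ofReal lam ≠ 0 := by simpa using hlam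
  have h1 := h.weak hf hXt hl ENNReal.ofReal_ne_top
  have h2 := (mul_le_mul' (le_refl (ENNReal.ofReal lam))
    (measure_mono (μ := μ) fun x hx => VarW.Vop_lt hi hs hlam hx)).trans h1
  rw [ENNReal.ofReal_div_of_pos hlam, ENNReal.div_eq_inv_mul, mul_assoc]
  rw [← ENNReal.div_eq_inv_mul, ENNReal.le_div_iff_mul_le (Or.inl hl) (Or.inl ENNReal.ofReal_ne_top), mul_comm]
  refine h2.trans (mul_le_mul' ?_ le_rfl)
  rw [ENNReal.ofReal_add ENNReal.toReal_nonneg zero_le_one, ENNReal.ofReal_toReal hT]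
  exact le_self_add
end
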